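/- arXiv:1006.1261 — 2 statements merged into one kernel-verified Lean document; each statement's English description precedes it below -/
import Mathlib

section
/- Let M be a Riemannian three-manifold carrying a unit Killing field ξ with associated function τ (so that ∇̃_X ξ = τ(X × ξ)), let p ∈ M, and suppose there is a totally geodesic surface Σ₁ passing through p which is neither orthogonal nor tangent to ξ at p. If M does not have constant positive curvature near p, then there exists a totally geodesic surface through p which is tangent to ξ at p if and only if τ(p) = 0. -/
noncomputable section
open Real Set

/-- Points of the coordinate chart `ℝⁿ`. -/
abbrev Pt (n : ℕ) := Fin n → ℝ

/-- The `i`-th standard coordinate vector. -/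
def stdb (n : ℕ) (i : Fin n) : Pt n := Pi.single i 1

/-- Riemannian metric data in coordinates: a field of symmetric bilinear forms. -/
abbrev Met (n : ℕ) := Pt n → Fin n → Fin n → ℝ

/-- The inner product of the vectors `v`, `w` at the point `x`, with respect to `g`. -/
def minner {n : ℕ} (g : Met n) (x v w : Pt n) : ℝ := ∑ i, ∑ j, g x i j * v i * w j

/-- `g` is a smooth Riemannian metric on `U`. -/
def IsMetricOn {n : ℕ} (U : Set (Pt n)) (g : Met n) : Prop :=
  (∀ i j, ContDiffOn ℝ (⊤ : ℕ∞) (fun x => g x i j) U) ∧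
  (∀ x i j, g x i j = g x j i) ∧
  (∀ x ∈ U, ∀ v : Pt n, v ≠ 0 → 0 < minner g x v v)

/-- The inverse metric `g^{kl}`. -/
def ginv {n : ℕ} (g : Met n) (x : Pt n) : Fin n → Fin n → ℝ :=
  fun k l => (Matrix.of (g x))⁻¹ k l

/-- The Christoffel symbols `Γᵏᵢⱼ` of the Levi-Civita connection of `g`. -/
def christoffel {n : ℕ} (g : Met n) (x : Pt n) (k i j : Fin n) : ℝ :=
  (1/2) * ∑ l, ginv g x k l *
    (fderiv ℝ (fun y => g y j l) x (stdb n i) + fderiv ℝ (fun y => g y i l) x (stdb n j)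
      - fderiv ℝ (fun y => g y i j) x (stdb n l))

/-- The covariant derivative (Levi-Civita connection of `g`) of the vector field `Y`
at the point `x` in the direction `v`. -/
def covD {n : ℕ} (g : Met n) (Y : Pt n → Pt n) (x v : Pt n) : Pt n :=
  fun k => fderiv ℝ (fun y => Y y k) x v + ∑ i, ∑ j, christoffel g x k i j * v i * Y x j

/-- `X` is a Killing field of `g` on `U`. -/
def IsKillingOn {n : ℕ} (U : Set (Pt n)) (g : Met n) (X : Pt n → Pt n) : Prop :=
  ∀ x ∈ U, ∀ v w : Pt n,
    minner g x (covD g X x v) w + minner g x (covD g X x w) v = 0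

/-- `X` has unit length on `U`. -/
def IsUnitOn {n : ℕ} (U : Set (Pt n)) (g : Met n) (X : Pt n → Pt n) : Prop :=
  ∀ x ∈ U, minner g x (X x) (X x) = 1

/-- The Lie bracket `[X,Y]` of two vector fields, in coordinates. -/
def lieB {n : ℕ} (X Y : Pt n → Pt n) (x : Pt n) : Pt n :=
  fun k => fderiv ℝ (fun y => Y y k) x (X x) - fderiv ℝ (fun y => X y k) x (Y x)

/-- A parametrized hypersurface `F : V → ℝ^{n+1}` with a chosen unit normal field `N`. -/
structure Hyp (n : ℕ) where
  V : Set (Pt n)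
  F : Pt n → Pt (n+1)
  N : Pt n → Pt (n+1)

/-- The ambient covariant derivative, along the map `F`, of the ambient-vector-valued
field `W` defined on the parameter domain, in the coordinate direction `v`. -/
def covAlong {n : ℕ} (g : Met (n+1)) (F W : Pt n → Pt (n+1)) (u v : Pt n) : Pt (n+1) :=
  fun k => fderiv ℝ (fun y => W y k) u v +
    ∑ i, ∑ j, christoffel g (F u) k i j * fderiv ℝ F u v i * W u j

/-- `S` is a smooth immersed hypersurface inside the chart `U`, with unit normal `N`. -/
def Hyp.IsRegular {n : ℕ} (S : Hyp n) (U : Set (Pt (n+1))) (g : Met (n+1)) : Prop :=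
  IsOpen S.V ∧ ContDiffOn ℝ (⊤ : ℕ∞) S.F S.V ∧ (∀ u ∈ S.V, S.F u ∈ U) ∧
  (∀ u ∈ S.V, LinearIndependent ℝ (fun a : Fin n => fderiv ℝ S.F u (stdb n a))) ∧
  ContDiffOn ℝ (⊤ : ℕ∞) S.N S.V ∧
  (∀ u ∈ S.V, minner g (S.F u) (S.N u) (S.N u) = 1) ∧
  (∀ u ∈ S.V, ∀ a : Fin n, minner g (S.F u) (S.N u) (fderiv ℝ S.F u (stdb n a)) = 0)

/-- `S` is totally geodesic: the shape operator `X ↦ -∇̃_X N` vanishes. -/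
def Hyp.TotallyGeodesic {n : ℕ} (S : Hyp n) (g : Met (n+1)) : Prop :=
  ∀ u ∈ S.V, ∀ a : Fin n, covAlong g S.F S.N u (stdb n a) = 0

/-- `S` is totally umbilical: the shape operator `X ↦ -∇̃_X N` is pointwise a
multiple of the identity. -/
def Hyp.TotallyUmbilical {n : ℕ} (S : Hyp n) (g : Met (n+1)) : Prop :=
  ∃ lam : Pt n → ℝ, ∀ u ∈ S.V, ∀ a : Fin n,
    covAlong g S.F S.N u (stdb n a) = lam u • fderiv ℝ S.F u (stdb n a)

/-- Projection onto the first `n` coordinates. -/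
def projBase {n : ℕ} (x : Pt (n+1)) : Pt n := fun i => x i.castSucc

/-- The product metric of `g₀` with the Euclidean line (last coordinate). -/
def prodMet {n : ℕ} (g₀ : Met n) : Met (n+1) := fun x i j =>
  Fin.lastCases (Fin.lastCases 1 (fun _ => 0) j)
    (fun i' => Fin.lastCases 0 (fun j' => g₀ (projBase x) i' j') j) i

/-- The coordinate domain of a product `𝕄 × I`. -/
def prodDom {n : ℕ} (U₀ : Set (Pt n)) (I : Set ℝ) : Set (Pt (n+1)) :=
  {x | projBase x ∈ U₀ ∧ x (Fin.last n) ∈ I}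

/-- The unit vertical field `ξ` of a product `𝕄 × I`. -/
def vert (n : ℕ) : Pt (n+1) → Pt (n+1) := fun _ => stdb (n+1) (Fin.last n)

/-- The pullback of the metric `g` under the map `Φ`. -/
def pullMet {n : ℕ} (g : Met n) (Φ : Pt n → Pt n) : Met n :=
  fun x i j => minner g (Φ x) (fderiv ℝ Φ x (stdb n i)) (fderiv ℝ Φ x (stdb n j))

/-- `g` has, on the coordinate domain `W`, the shape `dt² + f(t)² g_M` of a warped
product of an interval (the `0`-th coordinate) with an `n`-dimensional manifold. -/
def IsWarpedForm {n : ℕ} (g : Met (n+1)) (W : Set (Pt (n+1))) : Prop :=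
  ∃ f : ℝ → ℝ, ContDiff ℝ (⊤ : ℕ∞) f ∧ (∀ t, 0 < f t) ∧
    ∀ x ∈ W, g x 0 0 = 1 ∧
      (∀ i : Fin (n+1), i ≠ 0 → g x 0 i = 0 ∧ g x i 0 = 0) ∧
      (∀ i j : Fin (n+1), i ≠ 0 → j ≠ 0 →
        fderiv ℝ (fun y => g y i j / f (y 0) ^ 2) x (stdb (n+1) 0) = 0)

/-- The Riemannian manifold `(U₀, g₀)` has, in a neighborhood of `p`, the structure of a
warped product of an interval of the Euclidean line with an `n`-dimensional manifold:
there is a diffeomorphism `Φ` from a coordinate domain `W` onto a neighborhood of `p`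
pulling `g₀` back to a warped-product metric. -/
def LocallyWarpedAt {n : ℕ} (U₀ : Set (Pt (n+1))) (g₀ : Met (n+1)) (p : Pt (n+1)) : Prop :=
  ∃ (W : Set (Pt (n+1))) (Φ Ψ : Pt (n+1) → Pt (n+1)),
    IsOpen W ∧ ContDiffOn ℝ (⊤ : ℕ∞) Φ W ∧ MapsTo Φ W U₀ ∧
    IsOpen (Φ '' W) ∧ p ∈ Φ '' W ∧
    ContDiffOn ℝ (⊤ : ℕ∞) Ψ (Φ '' W) ∧ (∀ w ∈ W, Ψ (Φ w) = w) ∧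
    IsWarpedForm (pullMet g₀ Φ) W

/-- The Levi-Civita symbol on three indices. -/
def lcSymb (i j k : Fin 3) : ℝ :=
  ((j.val : ℝ) - (i.val : ℝ)) * ((k.val : ℝ) - (i.val : ℝ)) * ((k.val : ℝ) - (j.val : ℝ)) / 2

/-- The cross product of `v` and `w` at `x`, with respect to the metric `g` and the
orientation of the chart. -/
def crossG (g : Met 3) (x v w : Pt 3) : Pt 3 :=
  fun k => Real.sqrt (Matrix.det (Matrix.of (g x))) *
    ∑ l, ginv g x k l * ∑ i, ∑ j, lcSymb l i j * v i * w j

/-- The components `Rˡᵢⱼₖ` of the Riemann curvature tensor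
(`R(∂ᵢ,∂ⱼ)∂ₖ = Rˡᵢⱼₖ ∂ₗ`, with `R(X,Y) = ∇_X∇_Y - ∇_Y∇_X - ∇_{[X,Y]}`). -/
def riem {n : ℕ} (g : Met n) (x : Pt n) (l i j k : Fin n) : ℝ :=
  fderiv ℝ (fun y => christoffel g y l j k) x (stdb n i)
  - fderiv ℝ (fun y => christoffel g y l i k) x (stdb n j)
  + ∑ m, (christoffel g x l i m * christoffel g x m j k
      - christoffel g x l j m * christoffel g x m i k)

/-- The curvature operator `R(v,w)z` at `x`. -/
def riemVec {n : ℕ} (g : Met n) (x v w z : Pt n) : Pt n :=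
  fun l => ∑ i, ∑ j, ∑ k, riem g x l i j k * v i * w j * z k

/-- `g` has constant sectional curvature `c` on `W`. -/
def HasConstCurv {n : ℕ} (W : Set (Pt n)) (g : Met n) (c : ℝ) : Prop :=
  ∀ x ∈ W, ∀ v w : Pt n,
    minner g x (riemVec g x v w w) v
      = c * (minner g x v v * minner g x w w - (minner g x v w) ^ 2)

/-- The Ricci tensor of `g`. -/
def ricci {n : ℕ} (g : Met n) (x : Pt n) (j k : Fin n) : ℝ := ∑ i, riem g x i i j k

/-- The scalar curvature of `g`. -/
def scal {n : ℕ} (g : Met n) (x : Pt n) : ℝ := ∑ j, ∑ k, ginv g x j k * ricci g x j k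

/-- The metric `dx² + sin²θ(x) dy² + cos²θ(x) dz²` on a three-dimensional chart. -/
def tgMet (θ : ℝ → ℝ) : Met 3 := fun x i j =>
  if i = j then
    (if i = 0 then 1 else if i = 1 then (Real.sin (θ (x 0))) ^ 2 else (Real.cos (θ (x 0))) ^ 2)
  else 0

/-- The warped product metric `dt² + f(t)² g₀` (interval coordinate first). -/
def warpMet {n : ℕ} (f : ℝ → ℝ) (g₀ : Met n) : Met (n+1) := fun x i j =>
  Fin.cases (Fin.cases 1 (fun _ => 0) j)
    (fun i' => Fin.cases 0 (fun j' => f (x 0) ^ 2 * g₀ (Fin.tail x) i' j') j) i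

/-- The coordinate domain of a warped product `I ×_f 𝕄` (interval coordinate first). -/
def warpDom {n : ℕ} (I : Set ℝ) (U₀ : Set (Pt n)) : Set (Pt (n+1)) :=
  {x | x 0 ∈ I ∧ Fin.tail x ∈ U₀}

/-- The covariant acceleration of a curve `γ`, whose vanishing defines geodesics. -/
def curveAccel {n : ℕ} (g : Met n) (γ : ℝ → Pt n) (s : ℝ) : Pt n :=
  fun k => deriv (fun t => deriv (fun r => γ r k) t) s +
    ∑ i, ∑ j, christoffel g (γ s) k i j * deriv (fun r => γ r i) s * deriv (fun r => γ r j) s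

/-- The velocity of a curve. -/
def vel {n : ℕ} (γ : ℝ → Pt n) (s : ℝ) : Pt n := fun k => deriv (fun r => γ r k) s

set_option maxSynthPendingDepth 3

section Flow
open Filter Topology
open scoped ContDiff unitInterval

/-- Pointwise application of a continuous family of operators to a continuous map. -/
def pointwiseApply (K : Type) [TopologicalSpace K] [CompactSpace K] (E F : Type*)
    [NormedAddCommGroup E] [NormedSpace ℝ E] [NormedAddCommGroup F] [NormedSpace ℝ F] :
    C(K, E →L[ℝ] F) →L[ℝ] C(K, E) →L[ℝ] C(K, F) :=
  LinearMap.mkContinuous₂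
    (LinearMap.mk₂ ℝ
      (fun (A : C(K, E →L[ℝ] F)) (h : C(K, E)) => (⟨fun t => A t (h t), by fun_prop⟩ : C(K, F)))
      (fun _ _ _ => by ext; simp) (fun _ _ _ => by ext; simp)
      (fun _ _ _ => by ext; simp) (fun _ _ _ => by ext; simp)) 1
    (fun A h => by
      rw [ContinuousMap.norm_le _ (by positivity)]
      intro t
      simp only [LinearMap.mk₂_apply, ContinuousMap.coe_mk, one_mul]
      exact (A t).le_of_opNorm_le_of_le (A.norm_coe_le_norm t) (h.norm_coe_le_norm t))

theorem pointwiseApply_apply {K : Type} [TopologicalSpace K] [CompactSpace K] {E F : Type*}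
    [NormedAddCommGroup E] [NormedSpace ℝ E] [NormedAddCommGroup F] [NormedSpace ℝ F]
    (A : C(K, E →L[ℝ] F)) (h : C(K, E)) (t : K) :
    pointwiseApply K E F A h t = A t (h t) := rfl

theorem hasFDerivAt_postcomp {K : Type} [TopologicalSpace K] [CompactSpace K] {E F : Type*}
    [NormedAddCommGroup E] [NormedSpace ℝ E] [NormedAddCommGroup F] [NormedSpace ℝ F]
    {f : C(E, F)} {f' : C(E, E →L[ℝ] F)} (hf : ∀ x, HasFDerivAt f (f' x) x) (y : C(K, E)) :
    HasFDerivAt (fun y : C(K, E) => f.comp y) (pointwiseApply K E F (f'.comp y)) y := by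
  rw [hasFDerivAt_iff_isLittleO, Asymptotics.isLittleO_iff]
  intro ε hε
  have hK : IsCompact (range y) := isCompact_range y.continuous
  have hu := hK.uniformContinuousAt_of_continuousAt f' (fun x _ => f'.continuous.continuousAt)
    (Metric.dist_mem_uniformity hε)
  obtain ⟨δ, hδ, h⟩ := Metric.mem_uniformity_dist.1 hu
  filter_upwards [Metric.ball_mem_nhds y hδ] with z hz
  rw [ContinuousMap.norm_le _ (by positivity)]
  intro t
  have hzt : dist (z t) (y t) < δ := (ContinuousMap.dist_apply_le_dist t).trans_lt hz
  have key := (convex_ball (y t) δ).norm_image_sub_le_of_norm_hasFDerivWithin_le'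
    (f := f) (f' := f') (φ := f' (y t)) (C := ε) (x := y t) (y := z t)
    (fun x _ => (hf x).hasFDerivWithinAt)
    (fun x hx => by
      have := h (a := y t) (b := x) (by rw [dist_comm]; exact hx) (mem_range_self t)
      rw [← dist_eq_norm, dist_comm]
      exact le_of_lt this)
    (Metric.mem_ball_self hδ) hzt
  refine (le_of_eq ?_).trans (key.trans ?_)
  · simp [pointwiseApply_apply]
  · gcongr
    exact (z - y).norm_coe_le_norm t

theorem contDiff_postcomp_nat {K : Type} [TopologicalSpace K] [CompactSpace K] {E : Type}
    [NormedAddCommGroup E] [NormedSpace ℝ E] (n : ℕ) :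
    ∀ {F : Type} [NormedAddCommGroup F] [NormedSpace ℝ F] (f : C(E, F)), ContDiff ℝ n f →
      ContDiff ℝ n (fun y : C(K, E) => (f.comp y : C(K, F))) := by
  induction n with
  | zero =>
    intro F _ _ f _
    exact contDiff_zero.2 (ContinuousMap.continuous_postcomp f)
  | succ n ih =>
    intro F _ _ f hf
    have h1 : ContDiff ℝ n (fderiv ℝ f) := hf.fderiv_right (by simp)
    let f' : C(E, E →L[ℝ] F) := ⟨fderiv ℝ f, h1.continuous⟩
    have hd : ∀ x, HasFDerivAt f (f' x) x := fun x =>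
      (hf.differentiable (by simp) x).hasFDerivAt
    rw [Nat.cast_succ, contDiff_succ_iff_hasFDerivAt]
    exact ⟨fun y => pointwiseApply K E F (f'.comp y),
      (pointwiseApply K E F).contDiff.fun_comp (ih f' h1), fun y => hasFDerivAt_postcomp hd y⟩

theorem contDiff_postcomp {K : Type} [TopologicalSpace K] [CompactSpace K] {E F : Type}
    [NormedAddCommGroup E] [NormedSpace ℝ E] [NormedAddCommGroup F] [NormedSpace ℝ F]
    (f : C(E, F)) (hf : ContDiff ℝ ∞ f) :
    ContDiff ℝ ∞ (fun y : C(K, E) => (f.comp y : C(K, F))) :=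
  contDiff_infty.2 fun n => contDiff_postcomp_nat n f (hf.of_le (mod_cast le_top))

variable {E : Type} [NormedAddCommGroup E] [NormedSpace ℝ E]

/-- The primitive vanishing at `0` of a continuous path on the unit interval. -/
def primitive (E : Type) [NormedAddCommGroup E] [NormedSpace ℝ E] :
    C(I, E) →L[ℝ] C(I, E) :=
  LinearMap.mkContinuous
    { toFun := fun y => ⟨fun t => ∫ r in (0:ℝ)..t, IccExtend zero_le_one y r,
        (intervalIntegral.continuous_primitive
          (fun a b => (y.continuous.Icc_extend').intervalIntegrable a b) 0).comp
          continuous_subtype_val⟩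
      map_add' := fun y z => by
        ext t
        simp only [ContinuousMap.coe_mk, ContinuousMap.add_apply]
        rw [← intervalIntegral.integral_add
          ((y.continuous.Icc_extend').intervalIntegrable _ _)
          ((z.continuous.Icc_extend').intervalIntegrable _ _)]
        rfl
      map_smul' := fun c y => by
        ext t
        simp only [ContinuousMap.coe_mk, ContinuousMap.smul_apply, RingHom.id_apply]
        rw [← intervalIntegral.integral_smul]
        rfl } 1
    (fun y => by
      rw [ContinuousMap.norm_le _ (by positivity)]
      intro t
      have := intervalIntegral.norm_integral_le_of_norm_le_const (a := (0:ℝ)) (b := (t:ℝ))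
        (f := IccExtend zero_le_one y) (C := ‖y‖) (fun x _ => y.norm_coe_le_norm _)
      refine this.trans ?_
      have h0 := t.2.1
      have h1 := t.2.2
      rw [sub_zero, abs_of_nonneg h0, one_mul]
      exact mul_le_of_le_one_right (norm_nonneg _) h1)

theorem primitive_apply (y : C(I, E)) (t : I) :
    primitive E y t = ∫ r in (0:ℝ)..t, IccExtend zero_le_one y r := rfl

/-- The map whose zeros `((x, s), y)` are the solutions on `[0, 1]` of `y' = s • f y`, `y 0 = x`. -/
def flowEq (f : C(E, E)) (q : (E × ℝ) × C(I, E)) : C(I, E) :=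
  q.2 - ContinuousLinearMap.const ℝ I q.1.1 - q.1.2 • primitive E (f.comp q.2)

theorem contDiff_flowEq {f : C(E, E)} (hf : ContDiff ℝ ∞ f) : ContDiff ℝ ∞ (flowEq f) := by
  have h := (primitive E).contDiff.comp ((contDiff_postcomp (K := I) f hf).comp
    (contDiff_snd (E := E × ℝ)))
  have h2 := (ContinuousLinearMap.const ℝ (M := E) I).contDiff (n := ∞)
  unfold flowEq
  have h3 : ContDiff ℝ ∞ (fun q : (E × ℝ) × C(I, E) => ContinuousLinearMap.const ℝ I q.1.1) :=
    h2.comp (contDiff_fst.comp contDiff_fst)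
  have h4 : ContDiff ℝ ∞ (fun q : (E × ℝ) × C(I, E) => q.1.2) := by fun_prop
  exact (contDiff_snd.sub h3).sub (h4.smul h)

theorem flowEq_reparam {f : C(E, E)} {x : E} {s : ℝ} {y : C(I, E)} (h : flowEq f ((x, s), y) = 0)
    (r : I) : flowEq f ((x, r * s), y.comp ⟨fun t => r * t, by fun_prop⟩) = 0 := by
  ext t
  have ht := congrArg (fun z : C(I, E) => z (r * t)) h
  simp only [flowEq, ContinuousMap.sub_apply, ContinuousMap.smul_apply, ContinuousMap.zero_apply,
    primitive_apply, ContinuousMap.comp_apply, ContinuousMap.coe_mk] at ht ⊢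
  rw [← ht]
  have hi : ∀ u ∈ uIcc (0:ℝ) t, IccExtend zero_le_one
      (f.comp (y.comp ⟨fun t : I => r * t, by fun_prop⟩)) u =
      IccExtend zero_le_one (f.comp y) (r * u) := by
    intro u hu
    rw [uIcc_of_le t.2.1] at hu
    have hu1 : u ∈ Icc (0:ℝ) 1 := ⟨hu.1, hu.2.trans t.2.2⟩
    have hu2 : (r:ℝ) * u ∈ Icc (0:ℝ) 1 := unitInterval.mul_mem r.2 hu1
    rw [IccExtend_of_mem _ _ hu1, IccExtend_of_mem _ _ hu2]
    rfl
  rw [intervalIntegral.integral_congr hi, mul_comm (r : ℝ) s, mul_smul,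
    intervalIntegral.smul_integral_comp_mul_left]
  simp

theorem hasDerivWithinAt_of_flowEq [CompleteSpace E] {f : C(E, E)} {x : E} {s : ℝ} {y : C(I, E)}
    (h : flowEq f ((x, s), y) = 0) :
    HasDerivWithinAt (fun t => IccExtend zero_le_one y t) (s • f (y 1)) (Icc 0 1) 1 := by
  have hy : ∀ t ∈ Icc (0:ℝ) 1, IccExtend zero_le_one y t =
      x + s • ∫ r in (0:ℝ)..t, IccExtend zero_le_one (f.comp y) r := by
    intro t ht
    have := congrArg (fun z : C(I, E) => z ⟨t, ht⟩) h
    simp only [flowEq, ContinuousMap.sub_apply, ContinuousMap.zero_apply,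
      sub_sub, sub_eq_zero] at this
    rw [IccExtend_of_mem _ _ ht, this]
    rfl
  have hc : Continuous (IccExtend zero_le_one (f.comp y)) := (f.comp y).continuous.Icc_extend'
  have hd := ((hc.integral_hasStrictDerivAt 0 1).hasDerivAt.const_smul s).const_add x
  have h1 : IccExtend zero_le_one (f.comp y) (1:ℝ) = f (y 1) := by
    rw [IccExtend_of_mem _ _ (right_mem_Icc.2 zero_le_one)]
    rfl
  rw [h1] at hd
  exact hd.hasDerivWithinAt.congr hy (hy 1 (right_mem_Icc.2 zero_le_one))

/-- Smooth dependence of the flow of an autonomous smooth vector field on the initial condition. -/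
theorem exists_smooth_flow_of_contDiff [CompleteSpace E] {f : E → E}
    (hf : ContDiff ℝ ∞ f) (x₀ : E) :
    ∃ φ : E × ℝ → E, (∀ᶠ q in 𝓝 (x₀, (0:ℝ)), ContDiffAt ℝ ∞ φ q ∧
      HasDerivAt (fun t => φ (q.1, t)) (f (φ q)) q.2) ∧ ∀ᶠ x in 𝓝 x₀, φ (x, 0) = x := by
  let fc : C(E, E) := ⟨f, hf.continuous⟩
  have hG : ContDiff ℝ ∞ (flowEq fc) := contDiff_flowEq (f := fc) hf
  let u₀ : (E × ℝ) × C(I, E) := ((x₀, 0), ContinuousLinearMap.const ℝ I x₀)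
  have hu₀ : flowEq fc u₀ = 0 := by simp [flowEq, u₀]
  have hinv₀ : fderiv ℝ (flowEq fc) u₀ ∘L .inr ℝ (E × ℝ) C(I, E) = .id ℝ _ := by
    have h1 : HasFDerivAt (fun y => flowEq fc ((x₀, 0), y))
        (fderiv ℝ (flowEq fc) u₀ ∘L .inr ℝ (E × ℝ) C(I, E)) (ContinuousLinearMap.const ℝ I x₀) :=
      HasFDerivAt.comp (g := flowEq fc) (f := fun y => ((x₀, (0:ℝ)), y)) _
        (hG.differentiable (by simp) u₀).hasFDerivAt (hasFDerivAt_prodMk_right _ _)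
    refine h1.unique ?_
    simp only [flowEq, zero_smul, sub_zero]
    exact (hasFDerivAt_id _).sub_const _
  have hinv : (fderiv ℝ (flowEq fc) u₀ ∘L .inr ℝ (E × ℝ) C(I, E)).IsInvertible := by
    rw [hinv₀]
    exact ⟨.refl ℝ _, rfl⟩
  let ψ := (hG.contDiffAt (x := u₀)).implicitFunction (by simp) hinv
  have hsol : ∀ᶠ q in 𝓝 (x₀, (0:ℝ)), flowEq fc (q, ψ q) = 0 := by
    have := (hG.contDiffAt (x := u₀)).eventually_apply_implicitFunction (by simp) hinv
    rwa [hu₀] at this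
  have huniq : ∀ᶠ v in 𝓝 u₀, flowEq fc v = 0 → ψ v.1 = v.2 := by
    have := (hG.contDiffAt (x := u₀)).eventually_apply_eq_iff_implicitFunction (by simp) hinv
    rw [hu₀] at this
    exact this.mono fun v hv => hv.1
  have hψ₀ : ψ (x₀, 0) = ContinuousLinearMap.const ℝ I x₀ :=
    (hG.contDiffAt (x := u₀)).implicitFunction_apply_self (by simp) hinv
  have hψc : ∀ᶠ q in 𝓝 (x₀, (0:ℝ)), ContDiffAt ℝ ∞ ψ q := by
    have hc₀ : ContDiffAt ℝ ∞ ψ (x₀, 0) :=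
      (hG.contDiffAt (x := u₀)).contDiffAt_implicitFunction (by simp) hinv
    have hopen : ∀ᶠ q in 𝓝 (x₀, (0:ℝ)),
        (fderiv ℝ (flowEq fc) (q, ψ q) ∘L .inr ℝ (E × ℝ) C(I, E)).IsInvertible := by
      have hcont : ContinuousAt (fun q => fderiv ℝ (flowEq fc) (q, ψ q) ∘L
          .inr ℝ (E × ℝ) C(I, E)) (x₀, (0:ℝ)) := by
        have h1 : Continuous (fderiv ℝ (flowEq fc)) := hG.continuous_fderiv (by simp)
        have h2 : ContinuousAt (fun q => (q, ψ q)) (x₀, (0:ℝ)) :=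
          continuousAt_id.prodMk hc₀.continuousAt
        exact (h1.continuousAt.comp h2).clm_comp continuousAt_const
      have hn : range ((↑) : (C(I, E) ≃L[ℝ] C(I, E)) → _) ∈
          𝓝 (fderiv ℝ (flowEq fc) ((x₀, 0), ψ (x₀, 0)) ∘L .inr ℝ (E × ℝ) C(I, E)) := by
        rw [hψ₀, hinv₀]
        exact ContinuousLinearEquiv.nhds (.refl ℝ C(I, E))
      exact (hcont.eventually hn).mono fun q hq => hq
    filter_upwards [hopen, hsol.eventually_nhds, hsol,
      (hc₀.of_le (m := 1) (by simp)).eventually (by simp)] with q hq hs hs0 hcq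
    have hcd := (hG.contDiffAt (x := (q, ψ q))).contDiffAt_implicitFunction (by simp) hq
    refine hcd.congr_of_eventuallyEq ?_
    have h2 : ContinuousAt (fun q' => (q', ψ q')) q := continuousAt_id.prodMk hcq.continuousAt
    have h3 := (hG.contDiffAt (x := (q, ψ q))).eventually_apply_eq_iff_implicitFunction
      (by simp) hq
    filter_upwards [h2.eventually h3, hs] with q' hq' hs'
    exact (hq'.1 (hs'.trans hs0.symm)).symm
  refine ⟨fun q => ψ q 1, ?_, ?_⟩
  · have hcφ : ∀ᶠ q in 𝓝 (x₀, (0:ℝ)), ContDiffAt ℝ ∞ (fun q => ψ q 1) q := by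
      filter_upwards [hψc] with q hq
      exact (ContinuousMap.evalCLM ℝ (1 : I)).contDiff.contDiffAt.comp q hq
    obtain ⟨ε, hε, huniq⟩ := Metric.eventually_nhds_iff_ball.1 huniq
    have hψn : ∀ᶠ q in 𝓝 (x₀, (0:ℝ)), ψ q ∈ Metric.ball (ContinuousLinearMap.const ℝ I x₀) ε :=
      hψc.self_of_nhds.continuousAt.eventually_mem (by rw [hψ₀]; exact Metric.ball_mem_nhds _ hε)
    obtain ⟨δ, hδ, hall⟩ := Metric.eventually_nhds_iff_ball.1
      ((hψn.and hsol).and (hcφ.and (Metric.ball_mem_nhds (x₀, (0:ℝ)) hε)))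
    have hder : ∀ q ∈ Metric.ball (x₀, (0:ℝ)) δ, HasDerivAt (fun t => ψ (q.1, t) 1)
        (fderiv ℝ (fun q => ψ q 1) q (0, 1)) q.2 := by
      intro q hq
      have hl : HasDerivAt (fun t : ℝ => (q.1, t)) (0, 1) q.2 :=
        (hasDerivAt_const _ q.1).prodMk (hasDerivAt_id _)
      exact HasFDerivAt.comp_hasDerivAt (f := fun t : ℝ => (q.1, t)) (l := fun q => ψ q 1) q.2
        ((hall q hq).2.1.differentiableAt (by simp)).hasFDerivAt hl
    have hne : ∀ q ∈ Metric.ball (x₀, (0:ℝ)) δ, q.2 ≠ 0 →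
        fderiv ℝ (fun q => ψ q 1) q (0, 1) = f (ψ q 1) := by
      rintro ⟨x, s⟩ hq hs
      obtain ⟨⟨hq1, hq2⟩, hq3, hq4⟩ := hall _ hq
      have hrep : ∀ r : I, ψ (x, r * s) 1 = ψ (x, s) r := by
        intro r
        have h1 := huniq ((x, r * s), (ψ (x, s)).comp ⟨fun t => r * t, by fun_prop⟩) (by
          simp only [u₀, Metric.mem_ball, Prod.dist_eq, max_lt_iff] at hq4 ⊢
          refine ⟨⟨hq4.1, ?_⟩, ?_⟩
          · refine lt_of_le_of_lt ?_ hq4.2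
            simp only [dist_zero_right, norm_mul]
            exact mul_le_of_le_one_left (norm_nonneg _)
              (by rw [Real.norm_of_nonneg r.2.1]; exact r.2.2)
          · rw [ContinuousMap.dist_lt_iff hε]
            intro t
            exact (ContinuousMap.dist_lt_iff hε).1 hq1 (r * t)) (flowEq_reparam hq2 r)
        rw [h1]
        simp
      have hd1 := (hasDerivWithinAt_of_flowEq hq2)
      have hd2 : HasDerivWithinAt (fun t => ψ (x, t * s) 1) (s • f (ψ (x, s) 1)) (Icc (0:ℝ) 1) 1 :=
        hd1.congr (fun t ht => by rw [IccExtend_of_mem _ _ ht]; exact hrep ⟨t, ht⟩)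
          (by rw [IccExtend_of_mem _ _ (right_mem_Icc.2 zero_le_one)]; exact hrep 1)
      have hd3 : HasDerivAt (fun t => ψ (x, t * s) 1)
          (s • fderiv ℝ (fun q => ψ q 1) (x, s) (0, 1)) 1 :=
        HasDerivAt.scomp_of_eq (g₁ := fun t => ψ (x, t) 1) (h := fun t => t * s) 1 (hder _ hq)
          (by simpa using (hasDerivAt_id (1:ℝ)).mul_const s) (by simp)
      have := (uniqueDiffOn_Icc zero_lt_one 1 (right_mem_Icc.2 zero_le_one)).eq_deriv _
        hd3.hasDerivWithinAt hd2
      exact smul_right_injective _ hs this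
    filter_upwards [hcφ, Metric.ball_mem_nhds (x₀, (0:ℝ)) hδ] with q hq hqb
    refine ⟨hq, ?_⟩
    have := hder q hqb
    suffices h : fderiv ℝ (fun q => ψ q 1) q (0, 1) = f (ψ q 1) by rwa [h] at this
    by_cases hs : q.2 = 0
    · obtain ⟨x, s⟩ := q
      have hline : ContinuousAt (fun t : ℝ => (x, t)) s := by fun_prop
      have hc1 : ContinuousAt (fun t => fderiv ℝ (fun q => ψ q 1) (x, t) (0, 1)) s :=
        ((((hq.fderiv_right (m := 0) (by simp)).continuousAt).comp
          (f := fun t => (x, t)) hline).clm_apply continuousAt_const)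
      have hc2 : ContinuousAt (fun t => f (ψ (x, t) 1)) s :=
        hf.continuous.continuousAt.comp (hq.continuousAt.comp (f := fun t => (x, t)) hline)
      have he : ∀ᶠ t in 𝓝[≠] s, fderiv ℝ (fun q => ψ q 1) (x, t) (0, 1) = f (ψ (x, t) 1) := by
        have : ∀ᶠ t in 𝓝 s, (x, t) ∈ Metric.ball (x₀, (0:ℝ)) δ :=
          hline.eventually (Metric.isOpen_ball.mem_nhds hqb)
        filter_upwards [this.filter_mono nhdsWithin_le_nhds, self_mem_nhdsWithin] with t ht hts
        exact hne _ ht (by simp only at hs; rw [← hs]; exact hts)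
      exact tendsto_nhds_unique_of_eventuallyEq (hc1.tendsto.mono_left nhdsWithin_le_nhds)
        (hc2.tendsto.mono_left nhdsWithin_le_nhds) he
    · exact hne q hqb hs
  · have h0 : Tendsto (fun x : E => (x, (0:ℝ))) (𝓝 x₀) (𝓝 (x₀, 0)) := by
      exact (Continuous.prodMk_left (0:ℝ)).tendsto x₀
    filter_upwards [h0.eventually hsol] with x hx
    have := congrArg (fun z : C(I, E) => z 1) hx
    simpa [flowEq, sub_eq_zero] using this

/-- A smooth function on an open set agrees near any point of it with a globally smooth one. -/
theorem exists_contDiff_eventuallyEq {E F : Type} [NormedAddCommGroup E] [NormedSpace ℝ E]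
    [FiniteDimensional ℝ E] [NormedAddCommGroup F] [NormedSpace ℝ F]
    {U : Set E} (hU : IsOpen U) {f : E → F} (hf : ContDiffOn ℝ ∞ f U) {x₀ : E} (hx₀ : x₀ ∈ U) :
    ∃ f₁ : E → F, ContDiff ℝ ∞ f₁ ∧ f₁ =ᶠ[𝓝 x₀] f := by
  obtain ⟨r, hr, hrU⟩ := Metric.nhds_basis_closedBall.mem_iff.1 (hU.mem_nhds hx₀)
  let χ : ContDiffBump x₀ := ⟨r / 3, r / 2, by positivity, by linarith⟩
  refine ⟨fun x => χ x • f x, ?_, ?_⟩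
  · rw [contDiff_iff_contDiffAt]
    intro x
    by_cases hx : x ∈ Metric.ball x₀ r
    · exact χ.contDiff.contDiffAt.smul
        (hf.contDiffAt (hU.mem_nhds (hrU (Metric.ball_subset_closedBall hx))))
    · have : x ∉ Metric.closedBall x₀ (r / 2) := fun h =>
        hx (Metric.closedBall_subset_ball (by linarith) h)
      refine (contDiffAt_const (c := (0:F))).congr_of_eventuallyEq ?_
      filter_upwards [Metric.isClosed_closedBall.isOpen_compl.mem_nhds this] with y hy
      rw [χ.zero_of_le_dist (le_of_lt (not_le.1 fun h => hy (Metric.mem_closedBall.2 h))),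
        zero_smul]
  · filter_upwards [χ.eventuallyEq_one] with x hx
    rw [hx]
    simp

/-- The local flow of a smooth vector field is smooth. -/
theorem exists_smooth_flow {E : Type} [NormedAddCommGroup E] [NormedSpace ℝ E]
    [FiniteDimensional ℝ E] {U : Set E} (hU : IsOpen U) {f : E → E} (hf : ContDiffOn ℝ ∞ f U)
    {x₀ : E} (hx₀ : x₀ ∈ U) :
    ∃ φ : E × ℝ → E, (∀ᶠ q in 𝓝 (x₀, (0:ℝ)), ContDiffAt ℝ ∞ φ q ∧ φ q ∈ U ∧
      HasDerivAt (fun t => φ (q.1, t)) (f (φ q)) q.2) ∧ ∀ᶠ x in 𝓝 x₀, φ (x, 0) = x := by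
  have := FiniteDimensional.complete ℝ E
  obtain ⟨f₁, hf₁, he⟩ := exists_contDiff_eventuallyEq hU hf hx₀
  obtain ⟨φ, h1, h2⟩ := exists_smooth_flow_of_contDiff hf₁ x₀
  refine ⟨φ, ?_, h2⟩
  have hc : Tendsto φ (𝓝 (x₀, 0)) (𝓝 x₀) := by
    have := h1.self_of_nhds.1.continuousAt.tendsto
    rwa [h2.self_of_nhds] at this
  filter_upwards [h1, hc.eventually he, hc.eventually (hU.mem_nhds hx₀)] with q hq hq1 hq2
  exact ⟨hq.1, hq2, hq1 ▸ hq.2⟩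

end Flow

section Bilinear
open Filter Topology
open scoped ContDiff

variable {n : ℕ}

/-- The coordinate metric `g` at `x` as a continuous bilinear form. -/
def gL (g : Met n) (x : Pt n) : Pt n →L[ℝ] Pt n →L[ℝ] ℝ :=
  ∑ i, ∑ j, g x i j • (ContinuousLinearMap.proj (R := ℝ) (φ := fun _ : Fin n => ℝ) i).smulRight
    (ContinuousLinearMap.proj (R := ℝ) (φ := fun _ : Fin n => ℝ) j)

/-- The Christoffel symbols of `g` at `x` as a continuous bilinear map. -/
def chrL (g : Met n) (x : Pt n) : Pt n →L[ℝ] Pt n →L[ℝ] Pt n :=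
  ∑ k, ∑ i, ∑ j, christoffel g x k i j •
    (ContinuousLinearMap.proj (R := ℝ) (φ := fun _ : Fin n => ℝ) i).smulRight
      ((ContinuousLinearMap.proj (R := ℝ) (φ := fun _ : Fin n => ℝ) j).smulRight (stdb n k))

theorem gL_apply (g : Met n) (x v w : Pt n) : gL g x v w = minner g x v w := by
  simp [gL, minner, mul_assoc]

theorem chrL_apply (g : Met n) (x v w : Pt n) (k : Fin n) :
    chrL g x v w k = ∑ i, ∑ j, christoffel g x k i j * v i * w j := by
  simp only [chrL, sum_apply, smul_apply,
    ContinuousLinearMap.smulRight_apply, ContinuousLinearMap.proj_apply, Finset.sum_apply,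
    Pi.smul_apply, smul_eq_mul, stdb]
  rw [Finset.sum_eq_single k]
  · simp [mul_assoc]
  · intro b _ hb
    simp [Pi.single_eq_of_ne hb.symm]
  · simp

theorem eq_zero_of_stdb {f : Pt n → ℝ} (hadd : ∀ a b, f (a + b) = f a + f b)
    (hsmul : ∀ (r : ℝ) a, f (r • a) = r * f a) (h : ∀ i, f (stdb n i) = 0) (a : Pt n) :
    f a = 0 := by
  let F : Pt n →ₗ[ℝ] ℝ := ⟨⟨f, hadd⟩, hsmul⟩
  have : F = 0 := (Pi.basisFun ℝ (Fin n)).ext fun i => by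
    rw [Pi.basisFun_apply]
    exact h i
  exact congrArg (fun L : Pt n →ₗ[ℝ] ℝ => L a) this

theorem contDiffOn_det {U : Set (Pt n)} {m : ℕ} {A : Pt n → Matrix (Fin m) (Fin m) ℝ}
    (h : ∀ i j, ContDiffOn ℝ ∞ (fun x => A x i j) U) : ContDiffOn ℝ ∞ (fun x => (A x).det) U := by
  simp only [Matrix.det_apply]
  exact ContDiffOn.sum fun σ _ => (contDiffOn_prod fun i _ => h _ _).const_smul _

theorem det_pos_of_isMetricOn {U : Set (Pt n)} {g : Met n} (hg : IsMetricOn U g) {x : Pt n}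
    (hx : x ∈ U) : 0 < (Matrix.of (g x)).det := by
  refine Matrix.PosDef.det_pos (Matrix.PosDef.of_dotProduct_mulVec_pos ?_ fun v hv => ?_)
  · exact Matrix.IsHermitian.ext fun i j => hg.2.1 x j i
  · have e : star v ⬝ᵥ (Matrix.of (g x)).mulVec v = minner g x v v := by
      simp only [minner, dotProduct, Matrix.mulVec, Finset.mul_sum, Pi.star_apply, star_trivial]
      refine Finset.sum_congr rfl fun i _ => Finset.sum_congr rfl fun j _ => ?_
      rw [Matrix.of_apply]
      ring
    rw [e]
    exact hg.2.2 x hx v hv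

theorem contDiffOn_ginv {U : Set (Pt n)} {g : Met n} (hg : IsMetricOn U g) (k l : Fin n) :
    ContDiffOn ℝ ∞ (fun x => ginv g x k l) U := by
  have hd : ContDiffOn ℝ ∞ (fun x => (Matrix.of (g x)).det) U := contDiffOn_det fun i j => hg.1 i j
  have ha : ContDiffOn ℝ ∞ (fun x => (Matrix.of (g x)).adjugate k l) U := by
    simp only [Matrix.adjugate_apply]
    refine contDiffOn_det fun i j => ?_
    by_cases h : i = l
    · subst h
      simpa using contDiffOn_const
    · simpa [Matrix.updateRow_ne h] using hg.1 i j
  refine ((hd.inv fun x hx => (det_pos_of_isMetricOn hg hx).ne').mul ha).congr fun x hx => ?_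
  simp [ginv, Matrix.inv_def]

theorem contDiffOn_christoffel {U : Set (Pt n)} (hU : IsOpen U) {g : Met n} (hg : IsMetricOn U g)
    (k i j : Fin n) : ContDiffOn ℝ ∞ (fun x => christoffel g x k i j) U := by
  have h : ∀ i j l, ContDiffOn ℝ ∞ (fun x => fderiv ℝ (fun y => g y i j) x (stdb n l)) U :=
    fun i j l => ((hg.1 i j).fderiv_of_isOpen hU (by simp)).clm_apply contDiffOn_const
  unfold christoffel
  exact contDiffOn_const.mul (ContDiffOn.sum fun l _ => (contDiffOn_ginv hg k l).mul
    (((h _ _ _).add (h _ _ _)).sub (h _ _ _)))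

theorem contDiffOn_gL {U : Set (Pt n)} {g : Met n} (hg : IsMetricOn U g) :
    ContDiffOn ℝ ∞ (gL g) U :=
  ContDiffOn.sum fun i _ => ContDiffOn.sum fun j _ => (hg.1 i j).smul contDiffOn_const

theorem contDiffOn_chrL {U : Set (Pt n)} (hU : IsOpen U) {g : Met n} (hg : IsMetricOn U g) :
    ContDiffOn ℝ ∞ (chrL g) U :=
  ContDiffOn.sum fun k _ => ContDiffOn.sum fun i _ => ContDiffOn.sum fun j _ =>
    (contDiffOn_christoffel hU hg k i j).smul contDiffOn_const

theorem fderiv_gL_apply {U : Set (Pt n)} (hU : IsOpen U) {g : Met n} (hg : IsMetricOn U g)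
    {x : Pt n} (hx : x ∈ U) (a b c : Pt n) : fderiv ℝ (gL g) x a b c =
      ∑ i, ∑ j, fderiv ℝ (fun y => g y i j) x a * b i * c j := by
  have hd : DifferentiableAt ℝ (gL g) x :=
    ((contDiffOn_gL hg).contDiffAt (hU.mem_nhds hx)).differentiableAt (by simp)
  have h1 := ((hd.hasFDerivAt.clm_apply (hasFDerivAt_const b x)).clm_apply
    (hasFDerivAt_const c x)).fderiv
  have h2 : HasFDerivAt (fun y => gL g y b c)
      (∑ i, ∑ j, (b i * c j) • fderiv ℝ (fun y => g y i j) x) x := by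
    simp only [gL_apply, minner]
    refine HasFDerivAt.fun_sum fun i _ => HasFDerivAt.fun_sum fun j _ => ?_
    have := (((hg.1 i j).contDiffAt (hU.mem_nhds hx)).differentiableAt
      (by simp)).hasFDerivAt.mul_const (b i * c j)
    simpa only [mul_assoc] using this
  have h3 := congrArg (fun L => L a) (h1.symm.trans h2.fderiv)
  simp only [sum_apply, smul_apply, smul_eq_mul] at h3
  simp at h3
  rw [h3]
  exact Finset.sum_congr rfl fun i _ => Finset.sum_congr rfl fun j _ => by ring

theorem fderiv_chrL_apply {U : Set (Pt n)} (hU : IsOpen U) {g : Met n} (hg : IsMetricOn U g)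
    {x : Pt n} (hx : x ∈ U) (a b c : Pt n) (k : Fin n) : fderiv ℝ (chrL g) x a b c k =
      ∑ i, ∑ j, fderiv ℝ (fun y => christoffel g y k i j) x a * b i * c j := by
  have hd : DifferentiableAt ℝ (chrL g) x :=
    ((contDiffOn_chrL hU hg).contDiffAt (hU.mem_nhds hx)).differentiableAt (by simp)
  have h1 := (hasFDerivAt_pi'.1 ((hd.hasFDerivAt.clm_apply (hasFDerivAt_const b x)).clm_apply
    (hasFDerivAt_const c x)) k).fderiv
  have h2 : HasFDerivAt (fun y => chrL g y b c k)
      (∑ i, ∑ j, (b i * c j) • fderiv ℝ (fun y => christoffel g y k i j) x) x := by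
    simp only [chrL_apply]
    refine HasFDerivAt.fun_sum fun i _ => HasFDerivAt.fun_sum fun j _ => ?_
    have := (((contDiffOn_christoffel hU hg k i j).contDiffAt (hU.mem_nhds hx)).differentiableAt
      (by simp)).hasFDerivAt.mul_const (b i * c j)
    simpa only [mul_assoc] using this
  have h3 := congrArg (fun L => L a) (h1.symm.trans h2.fderiv)
  simp only [sum_apply, smul_apply, smul_eq_mul] at h3
  simp at h3
  rw [h3]
  exact Finset.sum_congr rfl fun i _ => Finset.sum_congr rfl fun j _ => by ring

theorem christoffel_symm {g : Met n} (hs : ∀ x i j, g x i j = g x j i) (x : Pt n)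
    (k i j : Fin n) : christoffel g x k i j = christoffel g x k j i := by
  unfold christoffel
  congr 1
  refine Finset.sum_congr rfl fun l _ => ?_
  rw [show (fun y => g y i j) = fun y => g y j i from funext fun y => hs y i j]
  ring

theorem sum_metric_mul_christoffel {U : Set (Pt n)} {g : Met n} (hg : IsMetricOn U g)
    {x : Pt n} (hx : x ∈ U) (i j m : Fin n) : 2 * ∑ k, g x m k * christoffel g x k i j =
      fderiv ℝ (fun y => g y j m) x (stdb n i) + fderiv ℝ (fun y => g y i m) x (stdb n j)
        - fderiv ℝ (fun y => g y i j) x (stdb n m) := by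
  have hinv : Matrix.of (g x) * (Matrix.of (g x))⁻¹ = 1 :=
    Matrix.mul_nonsing_inv _ (det_pos_of_isMetricOn hg hx).ne'.isUnit
  set D : Fin n → ℝ := fun l => fderiv ℝ (fun y => g y j l) x (stdb n i) +
    fderiv ℝ (fun y => g y i l) x (stdb n j) - fderiv ℝ (fun y => g y i j) x (stdb n l) with hD
  have h1 : ∀ k, christoffel g x k i j = (1/2) * ((Matrix.of (g x))⁻¹.mulVec D) k := fun k => rfl
  have h2 : ∑ k, g x m k * ((Matrix.of (g x))⁻¹.mulVec D) k = D m := by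
    have := congrArg (fun v => v m) (Matrix.mulVec_mulVec D (Matrix.of (g x)) (Matrix.of (g x))⁻¹)
    simp only [hinv, Matrix.one_mulVec] at this
    exact this
  rw [show _ - _ = D m from rfl, ← h2, Finset.mul_sum]
  refine Finset.sum_congr rfl fun k _ => ?_
  rw [h1]
  ring

theorem minner_stdb (g : Met n) (x v : Pt n) (m : Fin n) :
    minner g x v (stdb n m) = ∑ k, g x k m * v k := by
  simp [minner, stdb, Pi.single_apply]

theorem koszul_chrL {U : Set (Pt n)} (hU : IsOpen U) {g : Met n} (hg : IsMetricOn U g)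
    {x : Pt n} (hx : x ∈ U) (a b c : Pt n) : 2 * gL g x (chrL g x a b) c =
      fderiv ℝ (gL g) x a b c + fderiv ℝ (gL g) x b a c - fderiv ℝ (gL g) x c a b := by
  rw [← sub_eq_zero]
  refine eq_zero_of_stdb (f := fun a => 2 * gL g x (chrL g x a b) c -
    (fderiv ℝ (gL g) x a b c + fderiv ℝ (gL g) x b a c - fderiv ℝ (gL g) x c a b)) ?_ ?_ ?_ a
  · intro a b
    simp
    ring
  · intro r a
    simp
    ring
  intro i
  refine eq_zero_of_stdb (f := fun b => 2 * gL g x (chrL g x (stdb n i) b) c -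
    (fderiv ℝ (gL g) x (stdb n i) b c + fderiv ℝ (gL g) x b (stdb n i) c -
      fderiv ℝ (gL g) x c (stdb n i) b)) ?_ ?_ ?_ b
  · intro a b
    simp
    ring
  · intro r a
    simp
    ring
  intro j
  refine eq_zero_of_stdb (f := fun c => 2 * gL g x (chrL g x (stdb n i) (stdb n j)) c -
    (fderiv ℝ (gL g) x (stdb n i) (stdb n j) c + fderiv ℝ (gL g) x (stdb n j) (stdb n i) c -
      fderiv ℝ (gL g) x c (stdb n i) (stdb n j))) ?_ ?_ ?_ c
  · intro a b
    simp
    ring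
  · intro r a
    simp
    ring
  intro m
  have h := sum_metric_mul_christoffel hg hx i j m
  simp only [gL_apply, minner_stdb, chrL_apply, fderiv_gL_apply hU hg hx]
  have e : ∀ k, (∑ i', ∑ j', christoffel g x k i' j' * stdb n i i' * stdb n j j') =
      christoffel g x k i j := by
    intro k
    simp [stdb, Pi.single_apply]
  simp only [e, hg.2.1 x _ m, h]
  simp [stdb, Pi.single_apply]

/-- A metric `G` and its Levi-Civita connection `∂ + B` on the open set `U`. -/
structure IsLC {M : Type} [NormedAddCommGroup M] [NormedSpace ℝ M] (U : Set M)
    (G : M → M →L[ℝ] M →L[ℝ] ℝ) (B : M → M →L[ℝ] M →L[ℝ] M) : Prop where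
  isOpen : IsOpen U
  smoothG : ContDiffOn ℝ ∞ G U
  smoothB : ContDiffOn ℝ ∞ B U
  symmG : ∀ x a b, G x a b = G x b a
  pos : ∀ x ∈ U, ∀ a, a ≠ 0 → 0 < G x a a
  symmB : ∀ x a b, B x a b = B x b a
  compat : ∀ x ∈ U, ∀ a b c, fderiv ℝ G x a b c = G x (B x a b) c + G x b (B x a c)

theorem gL_symm {U : Set (Pt n)} {g : Met n} (hg : IsMetricOn U g) (x a b : Pt n) :
    gL g x a b = gL g x b a := by
  simp only [gL_apply, minner]
  rw [Finset.sum_comm]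
  refine Finset.sum_congr rfl fun i _ => Finset.sum_congr rfl fun j _ => ?_
  rw [hg.2.1 x j i]
  ring

theorem IsMetricOn.isLC {U : Set (Pt n)} (hU : IsOpen U) {g : Met n} (hg : IsMetricOn U g) :
    IsLC U (gL g) (chrL g) where
  isOpen := hU
  smoothG := contDiffOn_gL hg
  smoothB := contDiffOn_chrL hU hg
  symmG := gL_symm hg
  pos x hx a ha := by
    rw [gL_apply]
    exact hg.2.2 x hx a ha
  symmB x a b := by
    ext k
    rw [chrL_apply, chrL_apply, Finset.sum_comm]
    refine Finset.sum_congr rfl fun i _ => Finset.sum_congr rfl fun j _ => ?_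
    rw [christoffel_symm hg.2.1]
    ring
  compat x hx a b c := by
    have hs : ∀ a b c, fderiv ℝ (gL g) x a b c = fderiv ℝ (gL g) x a c b := by
      intro a b c
      simp only [fderiv_gL_apply hU hg hx]
      rw [Finset.sum_comm]
      refine Finset.sum_congr rfl fun i _ => Finset.sum_congr rfl fun j _ => ?_
      rw [show (fun y => g y j i) = fun y => g y i j from funext fun y => hg.2.1 y j i]
      ring
    have h1 := koszul_chrL hU hg hx a b c
    have h2 := koszul_chrL hU hg hx a c b
    rw [gL_symm hg x b]
    linarith [hs a b c, hs b a c, hs c a b]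

/-- The curvature operator of the connection `∂ + B`. -/
def curvB {M : Type} [NormedAddCommGroup M] [NormedSpace ℝ M]
    (B : M → M →L[ℝ] M →L[ℝ] M) (x a b c : M) : M :=
  fderiv ℝ B x a b c - fderiv ℝ B x b a c + (B x a (B x b c) - B x b (B x a c))

/-- The covariant derivative, along `F`, of the field `W`. -/
def cov {E M : Type} [NormedAddCommGroup E] [NormedSpace ℝ E] [NormedAddCommGroup M]
    [NormedSpace ℝ M] (B : M → M →L[ℝ] M →L[ℝ] M) (F W : E → M) (u v : E) : M :=
  fderiv ℝ W u v + B (F u) (fderiv ℝ F u v) (W u)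

theorem covD_eq_cov (g : Met n) {Y : Pt n → Pt n} {x : Pt n} (hY : DifferentiableAt ℝ Y x)
    (v : Pt n) : covD g Y x v = cov (chrL g) id Y x v := by
  ext k
  simp only [covD, cov, Pi.add_apply, chrL_apply, fderiv_id, id, ContinuousLinearMap.id_apply]
  rw [fderiv_apply hY]
  rfl

theorem covAlong_eq_cov (g : Met (n + 1)) {F W : Pt n → Pt (n + 1)} {u : Pt n}
    (hW : DifferentiableAt ℝ W u) (v : Pt n) : covAlong g F W u v = cov (chrL g) F W u v := by
  ext k
  simp only [covAlong, cov, Pi.add_apply, chrL_apply]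
  rw [fderiv_apply hW]
  rfl

theorem riemVec_eq_curvB {U : Set (Pt n)} (hU : IsOpen U) {g : Met n} (hg : IsMetricOn U g)
    {x : Pt n} (hx : x ∈ U) (a b c : Pt n) : riemVec g x a b c = curvB (chrL g) x a b c := by
  ext l
  rw [← sub_eq_zero]
  refine eq_zero_of_stdb (f := fun a => riemVec g x a b c l - curvB (chrL g) x a b c l) ?_ ?_ ?_ a
  · intro a b
    simp [riemVec, curvB, mul_add, add_mul, Finset.sum_add_distrib]
    ring
  · intro r a
    simp [riemVec, curvB, mul_sub, Finset.mul_sum, mul_assoc, mul_left_comm _ r]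
    ring
  intro i
  refine eq_zero_of_stdb (f := fun b => riemVec g x (stdb n i) b c l -
    curvB (chrL g) x (stdb n i) b c l) ?_ ?_ ?_ b
  · intro a b
    simp [riemVec, curvB, mul_add, add_mul, Finset.sum_add_distrib]
    ring
  · intro r a
    simp [riemVec, curvB, mul_sub, Finset.mul_sum, mul_assoc, mul_left_comm _ r]
    ring
  intro j
  refine eq_zero_of_stdb (f := fun c => riemVec g x (stdb n i) (stdb n j) c l -
    curvB (chrL g) x (stdb n i) (stdb n j) c l) ?_ ?_ ?_ c
  · intro a b
    simp [riemVec, curvB, mul_add, Finset.sum_add_distrib]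
    ring
  · intro r a
    simp [riemVec, curvB, mul_sub, Finset.mul_sum, mul_assoc, mul_left_comm _ r]
    ring
  intro k
  have h1 : riemVec g x (stdb n i) (stdb n j) (stdb n k) l = riem g x l i j k := by
    simp [riemVec, stdb, Pi.single_apply]
  rw [h1]
  simp only [riem, curvB, Pi.add_apply, Pi.sub_apply, fderiv_chrL_apply hU hg hx, chrL_apply]
  simp [stdb, Pi.single_apply]

end Bilinear

section Covariant
open Filter Topology
open scoped ContDiff

variable {E M : Type} [NormedAddCommGroup E] [NormedSpace ℝ E] [NormedAddCommGroup M]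
  [NormedSpace ℝ M] {U : Set M} {G : M → M →L[ℝ] M →L[ℝ] ℝ} {B : M → M →L[ℝ] M →L[ℝ] M}

theorem cov_smul_dir (B : M → M →L[ℝ] M →L[ℝ] M) (F W : E → M) (u v : E) (r : ℝ) :
    cov B F W u (r • v) = r • cov B F W u v := by
  simp [cov]

theorem cov_add_dir (B : M → M →L[ℝ] M →L[ℝ] M) (F W : E → M) (u v w : E) :
    cov B F W u (v + w) = cov B F W u v + cov B F W u w := by
  simp [cov]
  abel

theorem cov_congr (B : M → M →L[ℝ] M →L[ℝ] M) {F W F' W' : E → M} {u : E} (hF : F =ᶠ[𝓝 u] F')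
    (hW : W =ᶠ[𝓝 u] W') (v : E) : cov B F W u v = cov B F' W' u v := by
  simp only [cov, hF.fderiv_eq, hW.fderiv_eq, hF.self_of_nhds, hW.self_of_nhds]

theorem cov_add (B : M → M →L[ℝ] M →L[ℝ] M) (F : E → M) {V W : E → M} {u : E}
    (hV : DifferentiableAt ℝ V u) (hW : DifferentiableAt ℝ W u) (v : E) :
    cov B F (fun y => V y + W y) u v = cov B F V u v + cov B F W u v := by
  simp [cov, fderiv_fun_add hV hW]
  abel

theorem cov_smul (B : M → M →L[ℝ] M →L[ℝ] M) (F : E → M) {a : E → ℝ} {W : E → M} {u : E}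
    (ha : DifferentiableAt ℝ a u) (hW : DifferentiableAt ℝ W u) (v : E) :
    cov B F (fun y => a y • W y) u v = fderiv ℝ a u v • W u + a u • cov B F W u v := by
  simp [cov, fderiv_fun_smul ha hW]
  abel

theorem cov_comp {E' : Type} [NormedAddCommGroup E'] [NormedSpace ℝ E']
    (B : M → M →L[ℝ] M →L[ℝ] M) {F W : E → M} {f : E' → E} {u : E'}
    (hF : DifferentiableAt ℝ F (f u)) (hW : DifferentiableAt ℝ W (f u))
    (hf : DifferentiableAt ℝ f u) (v : E') :
    cov B (fun y => F (f y)) (fun y => W (f y)) u v = cov B F W (f u) (fderiv ℝ f u v) := by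
  have h1 : fderiv ℝ (fun y => F (f y)) u = _ := fderiv_comp u hF hf
  have h2 : fderiv ℝ (fun y => W (f y)) u = _ := fderiv_comp u hW hf
  simp [cov, h1, h2]

theorem cov_field_comp (B : M → M →L[ℝ] M →L[ℝ] M) {F : E → M} {X : M → M} {u : E}
    (hX : DifferentiableAt ℝ X (F u)) (hF : DifferentiableAt ℝ F u) (v : E) :
    cov B F (fun y => X (F y)) u v = cov B id X (F u) (fderiv ℝ F u v) :=
  cov_comp B (F := id) differentiableAt_id hX hF v

theorem ContDiffAt.differentiableAt_fderiv_apply {N : Type} [NormedAddCommGroup N]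
    [NormedSpace ℝ N] {F : E → N} {u : E} (hF : ContDiffAt ℝ 2 F u) (w : E) :
    DifferentiableAt ℝ (fun y => fderiv ℝ F y w) u :=
  ((hF.fderiv_right (m := 1) (by norm_num)).differentiableAt (by simp)).clm_apply
    (differentiableAt_const w)

theorem fderiv_fderiv_apply {N : Type} [NormedAddCommGroup N]
    [NormedSpace ℝ N] {F : E → N} {u : E} (hF : ContDiffAt ℝ 2 F u) (v w : E) :
    fderiv ℝ (fun y => fderiv ℝ F y w) u v = fderiv ℝ (fderiv ℝ F) u v w := by
  rw [fderiv_clm_apply ((hF.fderiv_right (m := 1) (by norm_num)).differentiableAt (by simp))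
    (differentiableAt_const w)]
  simp

theorem fderiv_fderiv_apply_comm {N : Type} [NormedAddCommGroup N]
    [NormedSpace ℝ N] {F : E → N} {u : E} (hF : ContDiffAt ℝ 2 F u) (v w : E) :
    fderiv ℝ (fun y => fderiv ℝ F y w) u v = fderiv ℝ (fun y => fderiv ℝ F y v) u w := by
  rw [fderiv_fderiv_apply hF, fderiv_fderiv_apply hF]
  exact hF.isSymmSndFDerivAt (by simp) v w

namespace IsLC

theorem differentiableAt_inner (h : IsLC U G B) {F V W : E → M} {u : E} (hu : F u ∈ U)
    (hF : DifferentiableAt ℝ F u) (hV : DifferentiableAt ℝ V u) (hW : DifferentiableAt ℝ W u) :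
    DifferentiableAt ℝ (fun y => G (F y) (V y) (W y)) u :=
  ((((h.smoothG.contDiffAt (h.isOpen.mem_nhds hu)).differentiableAt (by simp)).comp u
    hF).clm_apply hV).clm_apply hW

/-- Metric compatibility along a map. -/
theorem fderiv_inner (h : IsLC U G B) {F V W : E → M} {u : E} (hu : F u ∈ U)
    (hF : DifferentiableAt ℝ F u) (hV : DifferentiableAt ℝ V u) (hW : DifferentiableAt ℝ W u)
    (v : E) : fderiv ℝ (fun y => G (F y) (V y) (W y)) u v =
      G (F u) (cov B F V u v) (W u) + G (F u) (V u) (cov B F W u v) := by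
  have hG : DifferentiableAt ℝ G (F u) :=
    (h.smoothG.contDiffAt (h.isOpen.mem_nhds hu)).differentiableAt (by simp)
  have := (((hG.hasFDerivAt.comp u hF.hasFDerivAt).clm_apply hV.hasFDerivAt).clm_apply
    hW.hasFDerivAt).fderiv
  simp only [Function.comp_apply] at this
  rw [this]
  simp [cov, h.compat _ hu]
  ring

/-- The connection is torsion free. -/
theorem cov_fderiv_comm (h : IsLC U G B) {F : E → M} {u : E} (hF : ContDiffAt ℝ 2 F u) (v w : E) :
    cov B F (fun y => fderiv ℝ F y w) u v = cov B F (fun y => fderiv ℝ F y v) u w := by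
  simp only [cov, fderiv_fderiv_apply_comm hF v w, h.symmB _ (fderiv ℝ F u v)]

/-- The Koszul formula for a parametrization. -/
theorem koszul (h : IsLC U G B) {F : E → M} {u : E} (hu : F u ∈ U) (hF : ContDiffAt ℝ 2 F u)
    (v w z : E) : 2 * G (F u) (cov B F (fun y => fderiv ℝ F y w) u v) (fderiv ℝ F u z) =
      fderiv ℝ (fun y => G (F y) (fderiv ℝ F y w) (fderiv ℝ F y z)) u v
      + fderiv ℝ (fun y => G (F y) (fderiv ℝ F y v) (fderiv ℝ F y z)) u w
      - fderiv ℝ (fun y => G (F y) (fderiv ℝ F y v) (fderiv ℝ F y w)) u z := by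
  have hd := hF.differentiableAt (by simp)
  simp only [h.fderiv_inner hu hd (hF.differentiableAt_fderiv_apply _)
    (hF.differentiableAt_fderiv_apply _)]
  rw [h.cov_fderiv_comm hF w v, h.cov_fderiv_comm hF z v, h.cov_fderiv_comm hF z w,
    h.symmG _ (fderiv ℝ F u w) (cov B F (fun y => fderiv ℝ F y z) u v)]
  rw [h.symmG _ (fderiv ℝ F u v) (cov B F (fun y => fderiv ℝ F y z) u w)]
  ring

/-- The Gram matrix of a parametrization is constant along a Killing coordinate direction. -/
theorem fderiv_gram_eq_zero (h : IsLC U G B) {F : E → M} {u : E} (hu : F u ∈ U)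
    (hF : ContDiffAt ℝ 2 F u) {e : E}
    (he : ∀ v w, G (F u) (cov B F (fun y => fderiv ℝ F y e) u v) (fderiv ℝ F u w) +
      G (F u) (cov B F (fun y => fderiv ℝ F y e) u w) (fderiv ℝ F u v) = 0) (v w : E) :
    fderiv ℝ (fun y => G (F y) (fderiv ℝ F y v) (fderiv ℝ F y w)) u e = 0 := by
  rw [h.fderiv_inner hu (hF.differentiableAt (by simp)) (hF.differentiableAt_fderiv_apply _)
    (hF.differentiableAt_fderiv_apply _), h.cov_fderiv_comm hF, h.cov_fderiv_comm hF e w,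
    h.symmG _ (fderiv ℝ F u v), he]

/-- The commutator of covariant derivatives along a map is the curvature. -/
theorem cov_cov_sub (h : IsLC U G B) {F W : E → M} {u : E} (hu : F u ∈ U)
    (hF : ContDiffAt ℝ 2 F u) (hW : ContDiffAt ℝ 2 W u) (v w : E) :
    cov B F (fun y => cov B F W y w) u v - cov B F (fun y => cov B F W y v) u w =
      curvB B (F u) (fderiv ℝ F u v) (fderiv ℝ F u w) (W u) := by
  have hB : DifferentiableAt ℝ B (F u) :=
    (h.smoothB.contDiffAt (h.isOpen.mem_nhds hu)).differentiableAt (by simp)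
  have hFd := hF.differentiableAt (by simp)
  have hWd := hW.differentiableAt (by simp)
  have key : ∀ v w, fderiv ℝ (fun y => cov B F W y w) u v =
      fderiv ℝ (fun y => fderiv ℝ W y w) u v
      + (fderiv ℝ B (F u) (fderiv ℝ F u v) (fderiv ℝ F u w) (W u)
        + B (F u) (fderiv ℝ (fun y => fderiv ℝ F y w) u v) (W u)
        + B (F u) (fderiv ℝ F u w) (fderiv ℝ W u v)) := by
    intro v w
    have h1 := (((hB.hasFDerivAt.comp u hFd.hasFDerivAt).clm_apply
      (hF.differentiableAt_fderiv_apply w).hasFDerivAt).clm_apply hWd.hasFDerivAt)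
    have h2 := ((hW.differentiableAt_fderiv_apply w).hasFDerivAt.add h1).fderiv
    have h3 := congrArg (fun L => L v) h2
    refine Eq.trans h3 ?_
    simp
    abel
  have e1 := fderiv_fderiv_apply_comm hF v w
  have e2 := fderiv_fderiv_apply_comm hW v w
  have unfold_cov : ∀ v w, cov B F (fun y => cov B F W y w) u v =
      fderiv ℝ (fun y => cov B F W y w) u v + B (F u) (fderiv ℝ F u v) (cov B F W u w) :=
    fun _ _ => rfl
  rw [unfold_cov, unfold_cov, key, key, e1, e2]
  simp only [cov, curvB, map_add]
  abel

end IsLC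

end Covariant

section FlowMaps
open Filter Topology
open scoped ContDiff

theorem eventually_fst {E : Type} [NormedAddCommGroup E] {P : E → Prop}
    (h : ∀ᶠ e in 𝓝 (0:E), P e) : ∀ᶠ q in 𝓝 (0 : E × ℝ), P q.1 :=
  (continuous_fst.tendsto' (0 : E × ℝ) 0 rfl).eventually h

theorem eventually_prodMk_zero {E : Type} [NormedAddCommGroup E] {P : E × ℝ → Prop}
    (h : ∀ᶠ q in 𝓝 (0 : E × ℝ), P q) : ∀ᶠ e in 𝓝 (0:E), P (e, 0) :=
  ((Continuous.prodMk_left (0:ℝ)).tendsto' (0:E) (0 : E × ℝ) rfl).eventually h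

/-- Moving a parametrization along the flow of a vector field. -/
theorem exists_flow_map {E P : Type} [NormedAddCommGroup E] [NormedSpace ℝ E]
    [NormedAddCommGroup P] [NormedSpace ℝ P] [FiniteDimensional ℝ P] {U : Set P} (hU : IsOpen U)
    {X : P → P} (hX : ContDiffOn ℝ ∞ X U) {σ : E → P} (hσ : ∀ᶠ e in 𝓝 0, ContDiffAt ℝ ∞ σ e)
    (h0 : σ 0 ∈ U) : ∃ f : E × ℝ → P,
      (∀ᶠ q in 𝓝 0, ContDiffAt ℝ ∞ f q ∧ f q ∈ U ∧ fderiv ℝ f q (0, 1) = X (f q)) ∧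
      ∀ᶠ e in 𝓝 0, f (e, 0) = σ e ∧
        ∀ v r, fderiv ℝ f (e, 0) (v, r) = fderiv ℝ σ e v + r • X (σ e) := by
  obtain ⟨φ, h1, h2⟩ := exists_smooth_flow hU hX h0
  have hσ0 := hσ.self_of_nhds.continuousAt
  have hg : Tendsto (fun q : E × ℝ => (σ q.1, q.2)) (𝓝 0) (𝓝 (σ 0, 0)) :=
    ContinuousAt.prodMk (ContinuousAt.comp (f := Prod.fst) (x := (0 : E × ℝ)) hσ0 continuousAt_fst)
      continuousAt_snd
  have hA : ∀ᶠ q in 𝓝 (0 : E × ℝ), ContDiffAt ℝ ∞ (fun q : E × ℝ => φ (σ q.1, q.2)) q ∧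
      φ (σ q.1, q.2) ∈ U ∧
      fderiv ℝ (fun q : E × ℝ => φ (σ q.1, q.2)) q (0, 1) = X (φ (σ q.1, q.2)) := by
    filter_upwards [hg.eventually h1, eventually_fst hσ] with q hq hqσ
    have hc : ContDiffAt ℝ ∞ (fun q : E × ℝ => φ (σ q.1, q.2)) q :=
      ContDiffAt.comp q hq.1 ((hqσ.comp q contDiffAt_fst).prodMk contDiffAt_snd)
    refine ⟨hc, hq.2.1, ?_⟩
    have hl : HasDerivAt (fun t : ℝ => (q.1, t)) (0, 1) q.2 :=
      (hasDerivAt_const _ q.1).prodMk (hasDerivAt_id _)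
    exact (HasFDerivAt.comp_hasDerivAt (f := fun t : ℝ => (q.1, t))
      (l := fun q : E × ℝ => φ (σ q.1, q.2)) q.2
      (hc.differentiableAt (by simp)).hasFDerivAt hl).unique hq.2.2
  have hB : ∀ᶠ e in 𝓝 (0:E), φ (σ e, 0) = σ e := hσ0.eventually h2
  refine ⟨_, hA, ?_⟩
  filter_upwards [hB, hB.eventually_nhds, eventually_prodMk_zero hA] with e he he' hq
  refine ⟨he, fun v r => ?_⟩
  have hd : DifferentiableAt ℝ (fun q : E × ℝ => φ (σ q.1, q.2)) (e, 0) :=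
    hq.1.differentiableAt (by simp)
  have h3 : HasFDerivAt (fun e : E => φ (σ e, 0)) _ e :=
    HasFDerivAt.comp (g := fun q : E × ℝ => φ (σ q.1, q.2)) (f := fun e : E => (e, (0:ℝ))) e
      hd.hasFDerivAt
      (hasFDerivAt_prodMk_left e (0:ℝ))
  have h4 : fderiv ℝ σ e = _ := (Filter.EventuallyEq.fderiv_eq he').symm.trans h3.fderiv
  have h5 : ((v, r) : E × ℝ) = (v, 0) + r • (0, 1) := by simp
  rw [h5, map_add, map_smul, hq.2.2, h4]
  simp [he]

/-- A function with vanishing derivative in the last direction does not depend on it. -/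
theorem eventually_eq_of_fderiv_eq_zero {E ι : Type} [NormedAddCommGroup E] [NormedSpace ℝ E]
    {H : ι → E × ℝ → ℝ}
    (h : ∀ᶠ q in 𝓝 (0 : E × ℝ), ∀ i, DifferentiableAt ℝ (H i) q ∧ fderiv ℝ (H i) q (0, 1) = 0) :
    ∀ᶠ q in 𝓝 (0 : E × ℝ), ∀ i, H i q = H i (q.1, 0) := by
  obtain ⟨δ, hδ, hb⟩ := Metric.eventually_nhds_iff_ball.1 h
  filter_upwards [Metric.ball_mem_nhds _ hδ] with q hq i
  have hmem : ∀ t ∈ Metric.ball (0:ℝ) δ, (q.1, t) ∈ Metric.ball (0 : E × ℝ) δ := by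
    intro t ht
    simp only [Metric.mem_ball, Prod.dist_eq, max_lt_iff, Prod.fst_zero, Prod.snd_zero] at hq ht ⊢
    exact ⟨hq.1, ht⟩
  have hd : ∀ t ∈ Metric.ball (0:ℝ) δ, HasDerivAt (fun t => H i (q.1, t)) 0 t := by
    intro t ht
    obtain ⟨h1, h2⟩ := hb _ (hmem t ht) i
    rw [← h2]
    have hl : HasDerivAt (fun t : ℝ => (q.1, t)) (0, 1) t :=
      (hasDerivAt_const _ q.1).prodMk (hasDerivAt_id _)
    exact HasFDerivAt.comp_hasDerivAt (f := fun t : ℝ => (q.1, t)) t h1.hasFDerivAt hl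
  refine Metric.isOpen_ball.is_const_of_deriv_eq_zero (convex_ball (0:ℝ) δ).isPreconnected
    (f := fun t => H i (q.1, t)) (fun t ht => (hd t ht).differentiableAt.differentiableWithinAt)
    (fun t ht => (hd t ht).deriv) (x := q.2) ?_ (Metric.mem_ball_self hδ)
  simp only [Metric.mem_ball, Prod.dist_eq, max_lt_iff, Prod.fst_zero, Prod.snd_zero] at hq ⊢
  exact hq.2

variable {E M : Type} [NormedAddCommGroup E] [NormedSpace ℝ E] [NormedAddCommGroup M]
  [NormedSpace ℝ M] {U : Set M} {G : M → M →L[ℝ] M →L[ℝ] ℝ} {B : M → M →L[ℝ] M →L[ℝ] M}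

theorem IsLC.gram_const (h : IsLC U G B) {F : E × ℝ → M}
    (hF : ∀ᶠ q in 𝓝 0, ContDiffAt ℝ ∞ F q ∧ F q ∈ U ∧
      ∀ v w, G (F q) (cov B F (fun y => fderiv ℝ F y (0, 1)) q v) (fderiv ℝ F q w) +
      G (F q) (cov B F (fun y => fderiv ℝ F y (0, 1)) q w) (fderiv ℝ F q v) = 0) :
    ∀ᶠ q in 𝓝 0, ∀ v w, G (F q) (fderiv ℝ F q v) (fderiv ℝ F q w) =
      G (F (q.1, 0)) (fderiv ℝ F (q.1, 0) v) (fderiv ℝ F (q.1, 0) w) := by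
  have := eventually_eq_of_fderiv_eq_zero (ι := (E × ℝ) × (E × ℝ))
    (H := fun i q => G (F q) (fderiv ℝ F q i.1) (fderiv ℝ F q i.2)) (by
      filter_upwards [hF] with q hq i
      have h2 : ContDiffAt ℝ 2 F q := hq.1.of_le ENat.LEInfty.out
      exact ⟨h.differentiableAt_inner hq.2.1 (h2.differentiableAt (by simp))
        (h2.differentiableAt_fderiv_apply _) (h2.differentiableAt_fderiv_apply _),
        h.fderiv_gram_eq_zero hq.2.1 h2 hq.2.2 _ _⟩)
  filter_upwards [this] with q hq v w
  exact hq (v, w)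

end FlowMaps

section Frame
open Filter Topology
open scoped ContDiff

theorem eq_zero_of_orthogonal {M : Type} [NormedAddCommGroup M] [NormedSpace ℝ M]
    (hdim : Module.finrank ℝ M = 3) {g : M →L[ℝ] M →L[ℝ] ℝ} (hpos : ∀ a, a ≠ 0 → 0 < g a a)
    {v : Fin 2 → M} (hv : LinearIndependent ℝ v) {n r : M} (hn : g n n ≠ 0)
    (hnv : ∀ a, g n (v a) = 0) (hrv : ∀ a, g r (v a) = 0) (hrn : g r n = 0) : r = 0 := by
  have hspan : ∀ y, ∀ x ∈ Submodule.span ℝ (range v), (∀ a, g y (v a) = 0) → g y x = 0 := by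
    intro y x hx hy
    induction hx using Submodule.span_induction with
    | mem x hx => obtain ⟨a, rfl⟩ := hx; exact hy a
    | zero => simp
    | add x y _ _ h1 h2 => simp [h1, h2]
    | smul c x _ h1 => simp [h1]
  have hli : LinearIndependent ℝ (Fin.cons n v : Fin 3 → M) :=
    linearIndependent_finCons.2 ⟨hv, fun hmem => hn (hspan n n hmem hnv)⟩
  have htop := hli.span_eq_top_of_card_eq_finrank (by simp [hdim])
  by_contra hr
  refine (hpos r hr).ne' ?_
  have hmem : r ∈ Submodule.span ℝ (range (Fin.cons n v : Fin 3 → M)) := htop ▸ Submodule.mem_top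
  rw [Fin.range_cons, Submodule.mem_span_insert] at hmem
  obtain ⟨a, z, hz, hrz⟩ := hmem
  conv_lhs => arg 2; rw [hrz]
  simp [hrn, hspan r z hz hrv]

theorem gram_det_pos {M : Type} [NormedAddCommGroup M] [NormedSpace ℝ M]
    {g : M →L[ℝ] M →L[ℝ] ℝ} (hsymm : ∀ a b, g a b = g b a) (hpos : ∀ a, a ≠ 0 → 0 < g a a)
    {v : Fin 2 → M} (hv : LinearIndependent ℝ v) :
    0 < g (v 0) (v 0) * g (v 1) (v 1) - g (v 0) (v 1) ^ 2 := by
  have h0 := hpos _ (hv.ne_zero 0)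
  have hw : g (v 0) (v 0) • v 1 - g (v 0) (v 1) • v 0 ≠ 0 := by
    intro hw
    have h2 : LinearIndependent ℝ ![v 0, v 1] := by
      convert hv using 1
      ext i
      fin_cases i <;> rfl
    have := (LinearIndependent.pair_iff.1 h2) (-g (v 0) (v 1)) (g (v 0) (v 0))
      (by rw [← hw]; module)
    exact h0.ne' this.2
  have h1 := hpos _ hw
  simp only [map_sub, map_smul, sub_apply, smul_apply, smul_eq_mul, hsymm (v 1) (v 0)] at h1
  refine pos_of_mul_pos_right (a := g (v 0) (v 0)) ?_ h0.le
  linarith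

variable {M : Type} [NormedAddCommGroup M] [NormedSpace ℝ M] {U : Set M}
  {G : M → M →L[ℝ] M →L[ℝ] ℝ} {B : M → M →L[ℝ] M →L[ℝ] M}

/-- On a surface with unit normal `N` which is neither orthogonal nor tangent to `ξ`, the tangential
part of `ξ` and a unit tangent field orthogonal to it. -/
theorem exists_tangent_frame (h : IsLC U G B) (hdim : Module.finrank ℝ M = 3) {V : Set (Pt 2)}
    (hV : IsOpen V) {F N : Pt 2 → M} (hF : ContDiffOn ℝ ∞ F V) (hFU : ∀ u ∈ V, F u ∈ U)
    (hLI : ∀ u ∈ V, LinearIndependent ℝ (fun a : Fin 2 => fderiv ℝ F u (stdb 2 a)))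
    (hN : ContDiffOn ℝ ∞ N V) (hNN : ∀ u ∈ V, G (F u) (N u) (N u) = 1)
    (hNF : ∀ u ∈ V, ∀ a, G (F u) (N u) (fderiv ℝ F u (stdb 2 a)) = 0)
    {ξ : M → M} (hξ : ContDiffOn ℝ ∞ ξ U) (hξu : ∀ x ∈ U, G x (ξ x) (ξ x) = 1)
    {u₁ : Pt 2} (hu₁ : u₁ ∈ V) (hnt : G (F u₁) (ξ (F u₁)) (N u₁) ≠ 0)
    (hno : ∃ a : Fin 2, G (F u₁) (ξ (F u₁)) (fderiv ℝ F u₁ (stdb 2 a)) ≠ 0) :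
    ∃ V' ⊆ V, IsOpen V' ∧ u₁ ∈ V' ∧ ∃ T X : Pt 2 → Pt 2, ContDiffOn ℝ ∞ T V' ∧
      ContDiffOn ℝ ∞ X V' ∧ ∀ u ∈ V',
        ξ (F u) = fderiv ℝ F u (T u) + G (F u) (ξ (F u)) (N u) • N u ∧
        G (F u) (fderiv ℝ F u (X u)) (fderiv ℝ F u (X u)) = 1 ∧
        G (F u) (fderiv ℝ F u (X u)) (fderiv ℝ F u (T u)) = 0 ∧
        0 < G (F u) (ξ (F u)) (N u) ^ 2 ∧ G (F u) (ξ (F u)) (N u) ^ 2 < 1 := by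
  let f : Fin 2 → Pt 2 → M := fun a u => fderiv ℝ F u (stdb 2 a)
  have hf : ∀ a, ContDiffOn ℝ ∞ (f a) V := fun a =>
    (hF.fderiv_of_isOpen hV (by simp)).clm_apply contDiffOn_const
  have hGF : ContDiffOn ℝ ∞ (fun u => G (F u)) V := h.smoothG.comp hF hFU
  have hξF : ContDiffOn ℝ ∞ (fun u => ξ (F u)) V := hξ.comp hF hFU
  let η : Fin 2 → Pt 2 → ℝ := fun a u => G (F u) (ξ (F u)) (f a u)
  have hη : ∀ a, ContDiffOn ℝ ∞ (η a) V := fun a => (hGF.clm_apply hξF).clm_apply (hf a)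
  let k : Fin 2 → Fin 2 → Pt 2 → ℝ := fun a b u => G (F u) (f a u) (f b u)
  have hk : ∀ a b, ContDiffOn ℝ ∞ (k a b) V := fun a b => (hGF.clm_apply (hf a)).clm_apply (hf b)
  let ν : Pt 2 → ℝ := fun u => G (F u) (ξ (F u)) (N u)
  have hν : ContDiffOn ℝ ∞ ν V := (hGF.clm_apply hξF).clm_apply hN
  let D : Pt 2 → ℝ := fun u => k 0 0 u * k 1 1 u - k 0 1 u ^ 2
  have hD : ContDiffOn ℝ ∞ D V := ((hk 0 0).mul (hk 1 1)).sub ((hk 0 1).pow 2)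
  have hDpos : ∀ u ∈ V, 0 < D u := fun u hu =>
    gram_det_pos (h.symmG _) (h.pos _ (hFU u hu)) (hLI u hu)
  let t₀ : Pt 2 → ℝ := fun u => (k 1 1 u * η 0 u - k 0 1 u * η 1 u) / D u
  let t₁ : Pt 2 → ℝ := fun u => (k 0 0 u * η 1 u - k 0 1 u * η 0 u) / D u
  let T : Pt 2 → Pt 2 := fun u => t₀ u • stdb 2 0 + t₁ u • stdb 2 1
  have hT : ContDiffOn ℝ ∞ T V :=
    (((((hk 1 1).mul (hη 0)).sub ((hk 0 1).mul (hη 1))).div hD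
      fun u hu => (hDpos u hu).ne').smul contDiffOn_const).add
    (((((hk 0 0).mul (hη 1)).sub ((hk 0 1).mul (hη 0))).div hD
      fun u hu => (hDpos u hu).ne').smul contDiffOn_const)
  have hFT : ∀ u, fderiv ℝ F u (T u) = t₀ u • f 0 u + t₁ u • f 1 u := by
    intro u
    simp [T, f]
  have hk10 : ∀ u, k 1 0 u = k 0 1 u := fun u => h.symmG _ _ _
  have hTf : ∀ u ∈ V, ∀ a, G (F u) (fderiv ℝ F u (T u)) (f a u) = η a u := by
    intro u hu a
    have hd := (hDpos u hu).ne'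
    have e : G (F u) (fderiv ℝ F u (T u)) (f a u) = t₀ u * k 0 a u + t₁ u * k 1 a u := by
      simp [hFT, k]
    rw [e]
    fin_cases a
    · simp only [t₀, t₁, Fin.zero_eta, hk10]
      field_simp
      simp only [D]
      ring
    · simp only [t₀, t₁, Fin.mk_one]
      field_simp
      simp only [D]
      ring
  have hdec : ∀ u ∈ V, ξ (F u) = fderiv ℝ F u (T u) + ν u • N u := by
    intro u hu
    have hNf : ∀ a, G (F u) (N u) (f a u) = 0 := hNF u hu
    have hTN : G (F u) (fderiv ℝ F u (T u)) (N u) = 0 := by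
      rw [h.symmG, hFT]
      simp [hNf]
    rw [← sub_eq_zero]
    refine eq_zero_of_orthogonal hdim (h.pos _ (hFU u hu)) (hLI u hu) (n := N u) ?_ (hNF u hu)
      (fun a => ?_) ?_
    · rw [hNN u hu]
      exact one_ne_zero
    · have := hTf u hu a
      simp only [f, η] at this hNf
      simp [this, hNf]
    · simp [hTN, hNN u hu, ν]
  have hNT : ∀ u ∈ V, G (F u) (N u) (fderiv ℝ F u (T u)) = 0 := by
    intro u hu
    have hNf : ∀ a, G (F u) (N u) (f a u) = 0 := hNF u hu
    rw [hFT]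
    simp [hNf]
  have hTT : ∀ u ∈ V, G (F u) (fderiv ℝ F u (T u)) (fderiv ℝ F u (T u)) =
      t₀ u * η 0 u + t₁ u * η 1 u := by
    intro u hu
    conv_lhs => arg 2; rw [hFT]
    simp [hTf u hu]
  have hνT : ∀ u ∈ V, ν u ^ 2 = 1 - (t₀ u * η 0 u + t₁ u * η 1 u) := by
    intro u hu
    have h1 := hξu _ (hFU u hu)
    rw [hdec u hu] at h1
    simp only [map_add, map_smul, add_apply, smul_apply, smul_eq_mul, hNT u hu, hNN u hu, hTT u hu,
      h.symmG _ (fderiv ℝ F u (T u)) (N u)] at h1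
    linarith
  let w : Pt 2 → ℝ := fun u => D u * (1 - ν u ^ 2)
  have hw : ContDiffOn ℝ ∞ w V := hD.mul (contDiffOn_const.sub (hν.pow 2))
  have hV' : IsOpen (V ∩ {u | 0 < ν u ^ 2 ∧ ν u ^ 2 < 1}) := by
    have := (hν.pow 2).continuousOn.isOpen_inter_preimage hV (isOpen_Ioo (a := (0:ℝ)) (b := 1))
    exact this
  have hwpos : ∀ u ∈ V ∩ {u | 0 < ν u ^ 2 ∧ ν u ^ 2 < 1}, 0 < w u := fun u hu =>
    mul_pos (hDpos u hu.1) (sub_pos.2 hu.2.2)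
  let X : Pt 2 → Pt 2 := fun u => (√(w u))⁻¹ • ((-η 1 u) • stdb 2 0 + η 0 u • stdb 2 1)
  have hX : ContDiffOn ℝ ∞ X (V ∩ {u | 0 < ν u ^ 2 ∧ ν u ^ 2 < 1}) := by
    refine ContDiffOn.smul (ContDiffOn.inv ((hw.mono inter_subset_left).sqrt
      fun u hu => (hwpos u hu).ne') fun u hu => (Real.sqrt_pos.2 (hwpos u hu)).ne') ?_
    exact (((hη 1).mono inter_subset_left).neg.smul contDiffOn_const).add
      (((hη 0).mono inter_subset_left).smul contDiffOn_const)
  have hFX : ∀ u, fderiv ℝ F u (X u) = (√(w u))⁻¹ • ((-η 1 u) • f 0 u + η 0 u • f 1 u) := by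
    intro u
    simp [X, f]
  refine ⟨_, inter_subset_left, hV', ⟨hu₁, by positivity, ?_⟩, T, X, hT.mono inter_subset_left,
    hX, fun u hu => ⟨hdec u hu.1, ?_, ?_, hu.2⟩⟩
  · rw [hνT u₁ hu₁, ← hTT u₁ hu₁, sub_lt_self_iff]
    refine h.pos _ (hFU _ hu₁) _ fun h0 => ?_
    obtain ⟨a, ha⟩ := hno
    refine ha ?_
    have := hTf u₁ hu₁ a
    rw [h0] at this
    simpa [f, η] using this.symm
  · have hs : (√(w u))⁻¹ * (√(w u))⁻¹ * w u = 1 := by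
      have := hwpos u hu
      rw [← mul_inv, Real.mul_self_sqrt this.le, inv_mul_cancel₀ this.ne']
    have e1 : G (F u) (fderiv ℝ F u (X u)) (fderiv ℝ F u (X u)) = (√(w u))⁻¹ * (√(w u))⁻¹ *
        (η 1 u ^ 2 * k 0 0 u - 2 * η 0 u * η 1 u * k 0 1 u + η 0 u ^ 2 * k 1 1 u) := by
      rw [hFX]
      simp only [map_add, map_smul, add_apply, smul_apply, smul_eq_mul,
        h.symmG _ (f 1 u) (f 0 u), k]
      ring
    have e2 : w u = η 1 u ^ 2 * k 0 0 u - 2 * η 0 u * η 1 u * k 0 1 u + η 0 u ^ 2 * k 1 1 u := by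
      have hd := (hDpos u hu.1).ne'
      simp only [w, hνT u hu.1, t₀, t₁]
      field_simp
      ring
    rw [e1, ← e2, hs]
  · rw [h.symmG, hFX]
    simp only [map_add, map_smul, smul_eq_mul, hTf u hu.1]
    ring

end Frame

section Chart
open Filter Topology
open scoped ContDiff

variable {M : Type} [NormedAddCommGroup M] [NormedSpace ℝ M] {U : Set M}
  {G : M → M →L[ℝ] M →L[ℝ] ℝ} {B : M → M →L[ℝ] M →L[ℝ] M}

/-- A chart `Φ` around `p`, defined on a box, in which the metric is
`dx² + a(x)² dy² + b(x)² dz²` with `a² + b² = 1` and `ξ = ∂_y + ∂_z`. -/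
structure IsAdaptedChart (U : Set M) (G : M → M →L[ℝ] M →L[ℝ] ℝ) (ξ : M → M) (p : M)
    (Φ : ℝ × ℝ × ℝ → M) (a b : ℝ → ℝ) (δ : ℝ) : Prop where
  pos : 0 < δ
  smooth : ∀ q ∈ Metric.ball 0 δ, ContDiffAt ℝ ∞ Φ q
  mem : ∀ q ∈ Metric.ball 0 δ, Φ q ∈ U
  base : Φ 0 = p
  smooth_a : ∀ x ∈ Metric.ball 0 δ, ContDiffAt ℝ ∞ a x
  smooth_b : ∀ x ∈ Metric.ball 0 δ, ContDiffAt ℝ ∞ b x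
  a_pos : ∀ x ∈ Metric.ball 0 δ, 0 < a x
  b_pos : ∀ x ∈ Metric.ball 0 δ, 0 < b x
  sq_add_sq : ∀ x ∈ Metric.ball 0 δ, a x ^ 2 + b x ^ 2 = 1
  gram : ∀ q ∈ Metric.ball 0 δ, ∀ v w, G (Φ q) (fderiv ℝ Φ q v) (fderiv ℝ Φ q w) =
    v.1 * w.1 + a q.1 ^ 2 * (v.2.1 * w.2.1) + b q.1 ^ 2 * (v.2.2 * w.2.2)
  field : ∀ q ∈ Metric.ball 0 δ, fderiv ℝ Φ q (0, 1, 1) = ξ (Φ q)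

theorem exists_isAdaptedChart [FiniteDimensional ℝ M] (h : IsLC U G B)
    (hdim : Module.finrank ℝ M = 3) {V : Set (Pt 2)}
    (hV : IsOpen V) {F N : Pt 2 → M} (hF : ContDiffOn ℝ ∞ F V) (hFU : ∀ u ∈ V, F u ∈ U)
    (hLI : ∀ u ∈ V, LinearIndependent ℝ (fun a : Fin 2 => fderiv ℝ F u (stdb 2 a)))
    (hN : ContDiffOn ℝ ∞ N V) (hNN : ∀ u ∈ V, G (F u) (N u) (N u) = 1)
    (hNF : ∀ u ∈ V, ∀ v, G (F u) (N u) (fderiv ℝ F u v) = 0)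
    (htg : ∀ u ∈ V, ∀ v, cov B F N u v = 0)
    {ξ : M → M} (hξ : ContDiffOn ℝ ∞ ξ U) (hξu : ∀ x ∈ U, G x (ξ x) (ξ x) = 1)
    (hξk : ∀ x ∈ U, ∀ v w, G x (cov B id ξ x v) w + G x (cov B id ξ x w) v = 0)
    {u₁ : Pt 2} (hu₁ : u₁ ∈ V) (hnt : G (F u₁) (ξ (F u₁)) (N u₁) ≠ 0)
    (hno : ∃ a : Fin 2, G (F u₁) (ξ (F u₁)) (fderiv ℝ F u₁ (stdb 2 a)) ≠ 0) :
    ∃ Φ a b δ, IsAdaptedChart U G ξ (F u₁) Φ a b δ := by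
  obtain ⟨V', hV'V, hV', hu₁', T, X, hT, hX, hfr⟩ := exists_tangent_frame h hdim hV hF hFU
    hLI hN hNN
    (fun u hu a => hNF u hu _) hξ hξu hu₁ hnt hno
  have hFd : ∀ u ∈ V', ContDiffAt ℝ ∞ F u := fun u hu => hF.contDiffAt (hV.mem_nhds (hV'V hu))
  have hNd : ∀ u ∈ V', ContDiffAt ℝ ∞ N u := fun u hu => hN.contDiffAt (hV.mem_nhds (hV'V hu))
  have hξd : ∀ x ∈ U, ContDiffAt ℝ ∞ ξ x := fun x hx => hξ.contDiffAt (h.isOpen.mem_nhds hx)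
  let ν : Pt 2 → ℝ := fun u => G (F u) (ξ (F u)) (N u)
  have hνd : ∀ u ∈ V', ContDiffAt ℝ ∞ ν u := fun u hu =>
    ((((h.smoothG.contDiffAt (h.isOpen.mem_nhds (hFU u (hV'V hu)))).comp u (hFd u hu)).clm_apply
      ((hξd _ (hFU u (hV'V hu))).comp u (hFd u hu))).clm_apply (hNd u hu))
  have hTT : ∀ u ∈ V', G (F u) (fderiv ℝ F u (T u)) (fderiv ℝ F u (T u)) = 1 - ν u ^ 2 := by
    intro u hu
    have h1 := hξu _ (hFU u (hV'V hu))
    rw [(hfr u hu).1] at h1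
    simp only [map_add, map_smul, add_apply, smul_apply, smul_eq_mul, hNF u (hV'V hu),
      hNN u (hV'V hu), h.symmG _ (fderiv ℝ F u (T u)) (N u)] at h1
    linarith
  -- the integral curve of `X`
  obtain ⟨φ, hφ, hφ0⟩ := exists_smooth_flow hV' hX hu₁'
  let c : ℝ → Pt 2 := fun x => φ (u₁, x)
  have hc0 : c 0 = u₁ := hφ0.self_of_nhds
  have hc : ∀ᶠ x in 𝓝 (0:ℝ), ContDiffAt ℝ ∞ c x ∧ c x ∈ V' ∧ fderiv ℝ c x 1 = X (c x) := by
    have hl : Tendsto (fun x : ℝ => (u₁, x)) (𝓝 0) (𝓝 (u₁, 0)) :=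
      (Continuous.prodMk_right u₁).tendsto 0
    filter_upwards [hl.eventually hφ] with x hx
    refine ⟨ContDiffAt.comp x (g := φ) hx.1 (contDiffAt_const.prodMk contDiffAt_id), hx.2.1, ?_⟩
    rw [fderiv_apply_one_eq_deriv]
    exact hx.2.2.deriv
  -- the surface in the new parameters
  obtain ⟨f, hf, hf0⟩ := exists_flow_map hV' hT (hc.mono fun x hx => hx.1) (hc0 ▸ hu₁')
  let σ : ℝ × ℝ → M := fun q => F (f q)
  have hσd : ∀ q, ContDiffAt ℝ ∞ f q → f q ∈ V' → ContDiffAt ℝ ∞ σ q ∧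
      ∀ v, fderiv ℝ σ q v = fderiv ℝ F (f q) (fderiv ℝ f q v) := by
    intro q h1 h2
    refine ⟨(hFd _ h2).comp q h1, fun v => ?_⟩
    have h3 : fderiv ℝ σ q = _ := fderiv_comp q ((hFd _ h2).differentiableAt (by simp))
      (h1.differentiableAt (by simp))
    rw [h3]
    rfl
  have hσz : ∀ᶠ q in 𝓝 (0 : ℝ × ℝ), fderiv ℝ σ q (0, 1) + ν (f q) • N (f q) = ξ (σ q) := by
    filter_upwards [hf] with q hq
    rw [(hσd q hq.1 hq.2.1).2, hq.2.2, (hfr _ hq.2.1).1]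
  have hσk : ∀ᶠ q in 𝓝 (0 : ℝ × ℝ), ContDiffAt ℝ ∞ σ q ∧ σ q ∈ U ∧
      ∀ v w, G (σ q) (cov B σ (fun y => fderiv ℝ σ y (0, 1)) q v) (fderiv ℝ σ q w) +
      G (σ q) (cov B σ (fun y => fderiv ℝ σ y (0, 1)) q w) (fderiv ℝ σ q v) = 0 := by
    filter_upwards [hf, hσz.eventually_nhds] with q hq hqz
    obtain ⟨hσ1, hσ2⟩ := hσd q hq.1 hq.2.1
    have hqU : σ q ∈ U := hFU _ (hV'V hq.2.1)
    refine ⟨hσ1, hqU, ?_⟩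
    have hfd := hq.1.differentiableAt (by simp : (∞ : WithTop ℕ∞) ≠ 0)
    have hνf : DifferentiableAt ℝ (fun y => ν (f y)) q :=
      ((hνd _ hq.2.1).differentiableAt (by simp)).comp q hfd
    have hNf : DifferentiableAt ℝ (fun y => N (f y)) q :=
      ((hNd _ hq.2.1).differentiableAt (by simp)).comp q hfd
    have hσ' : ContDiffAt ℝ 2 σ q := hσ1.of_le ENat.LEInfty.out
    have key : ∀ v w, G (σ q) (cov B σ (fun y => fderiv ℝ σ y (0, 1)) q v) (fderiv ℝ σ q w) =
        G (σ q) (cov B id ξ (σ q) (fderiv ℝ σ q v)) (fderiv ℝ σ q w) := by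
      intro v w
      have h1 : cov B σ (fun y => N (f y)) q v = 0 := by
        rw [← htg _ (hV'V hq.2.1) (fderiv ℝ f q v)]
        exact cov_comp B ((hFd _ hq.2.1).differentiableAt (by simp))
          ((hNd _ hq.2.1).differentiableAt (by simp)) hfd v
      have h2 := cov_congr B (EventuallyEq.refl (𝓝 q) σ) hqz v
      rw [cov_add B σ (hσ'.differentiableAt_fderiv_apply _) (hνf.fun_smul hNf),
        cov_smul B σ hνf hNf, h1, cov_field_comp B ((hξd _ hqU).differentiableAt (by simp))
        (hσ1.differentiableAt (by simp))] at h2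
      rw [← h2]
      have h3 : G (σ q) (N (f q)) (fderiv ℝ σ q w) = 0 := by
        rw [hσ2]
        exact hNF _ (hV'V hq.2.1) _
      simp [h3]
    intro v w
    rw [key, key]
    exact hξk _ hqU _ _
  have hσg : ∀ᶠ q in 𝓝 (0 : ℝ × ℝ), ∀ v w : ℝ × ℝ,
      G (σ q) (fderiv ℝ σ q v) (fderiv ℝ σ q w) =
        v.1 * w.1 + (1 - ν (c q.1) ^ 2) * (v.2 * w.2) := by
    filter_upwards [h.gram_const hσk, eventually_fst hf0, eventually_fst hc,
      eventually_fst (eventually_prodMk_zero hf)] with q hq hq0 hqc hqf v w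
    obtain ⟨h1, h2⟩ := hσd (q.1, 0) hqf.1 hqf.2.1
    have h3 : ∀ v, fderiv ℝ c q.1 v = v • X (c q.1) := by
      intro v
      rw [← hqc.2.2, ← map_smul]
      simp
    have h4 : ∀ v : ℝ × ℝ, fderiv ℝ σ (q.1, 0) v =
        v.1 • fderiv ℝ F (c q.1) (X (c q.1)) + v.2 • fderiv ℝ F (c q.1) (T (c q.1)) := by
      intro v
      rw [h2, hq0.1, show v = (v.1, v.2) from rfl, hq0.2, h3]
      simp
    have h5 : σ (q.1, 0) = F (c q.1) := congrArg F hq0.1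
    obtain ⟨-, hXX, hXT, -, -⟩ := hfr _ hqc.2.1
    rw [hq, h4, h4, h5]
    simp only [map_add, map_smul, add_apply, smul_apply, smul_eq_mul, hXX, hXT, hTT _ hqc.2.1,
      h.symmG _ (fderiv ℝ F (c q.1) (T (c q.1))) (fderiv ℝ F (c q.1) (X (c q.1)))]
    ring
  have hσξ : ∀ᶠ q in 𝓝 (0 : ℝ × ℝ), ∀ v : ℝ × ℝ, G (σ q) (fderiv ℝ σ q v) (ξ (σ q)) =
      (1 - ν (c q.1) ^ 2) * v.2 := by
    filter_upwards [hσg, hσz, hf] with q hq hqz hqf v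
    have h1 : G (σ q) (fderiv ℝ σ q v) (N (f q)) = 0 := by
      rw [(hσd q hqf.1 hqf.2.1).2, h.symmG]
      exact hNF _ (hV'V hqf.2.1) _
    rw [← hqz, map_add, hq, map_smul, h1]
    simp
  -- flowing along `ξ`
  have hσU : ∀ᶠ q in 𝓝 (0 : ℝ × ℝ), σ q ∈ U := hσk.mono fun q hq => hq.2.1
  have hσ0 : σ 0 = F u₁ := by
    rw [← hc0]
    exact congrArg F hf0.self_of_nhds.1
  obtain ⟨Ψ, hΨ, hΨ0⟩ := exists_flow_map h.isOpen hξ (hσk.mono fun q hq => hq.1) hσU.self_of_nhds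
  have hΨk : ∀ᶠ q in 𝓝 (0 : (ℝ × ℝ) × ℝ), ContDiffAt ℝ ∞ Ψ q ∧ Ψ q ∈ U ∧
      ∀ v w, G (Ψ q) (cov B Ψ (fun y => fderiv ℝ Ψ y (0, 1)) q v) (fderiv ℝ Ψ q w) +
      G (Ψ q) (cov B Ψ (fun y => fderiv ℝ Ψ y (0, 1)) q w) (fderiv ℝ Ψ q v) = 0 := by
    filter_upwards [hΨ, hΨ.eventually_nhds] with q hq hq'
    refine ⟨hq.1, hq.2.1, fun v w => ?_⟩
    have h1 : (fun y => fderiv ℝ Ψ y (0, 1)) =ᶠ[𝓝 q] fun y => ξ (Ψ y) := hq'.mono fun y hy => hy.2.2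
    rw [cov_congr B (EventuallyEq.refl (𝓝 q) Ψ) h1, cov_congr B (EventuallyEq.refl (𝓝 q) Ψ) h1,
      cov_field_comp B ((hξd _ hq.2.1).differentiableAt (by simp))
        (hq.1.differentiableAt (by simp)),
      cov_field_comp B ((hξd _ hq.2.1).differentiableAt (by simp))
        (hq.1.differentiableAt (by simp))]
    exact hξk _ hq.2.1 _ _
  have hΨg : ∀ᶠ q in 𝓝 (0 : (ℝ × ℝ) × ℝ), ∀ v w : (ℝ × ℝ) × ℝ,
      G (Ψ q) (fderiv ℝ Ψ q v) (fderiv ℝ Ψ q w) = v.1.1 * w.1.1 + v.2 * w.2 +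
        (1 - ν (c q.1.1) ^ 2) * (v.1.2 * w.1.2 + v.1.2 * w.2 + v.2 * w.1.2) := by
    filter_upwards [h.gram_const hΨk, eventually_fst hΨ0, eventually_fst hσg,
      eventually_fst hσξ, eventually_fst hσU] with q hq hq0 hqσ hqξ hqU v w
    have h4 : ∀ v : (ℝ × ℝ) × ℝ, fderiv ℝ Ψ (q.1, 0) v = fderiv ℝ σ q.1 v.1 + v.2 • ξ (σ q.1) :=
      fun v => hq0.2 v.1 v.2
    rw [hq, h4, h4, hq0.1]
    simp only [map_add, map_smul, add_apply, smul_apply, smul_eq_mul, hqσ, hqξ, hξu _ hqU,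
      h.symmG _ (ξ (σ q.1)) (fderiv ℝ σ q.1 _)]
    ring
  -- the final change of coordinates
  let L : ℝ × ℝ × ℝ →L[ℝ] (ℝ × ℝ) × ℝ :=
    ((ContinuousLinearMap.fst ℝ ℝ (ℝ × ℝ)).prod
      (.snd ℝ ℝ ℝ ∘L .snd ℝ ℝ (ℝ × ℝ) - .fst ℝ ℝ ℝ ∘L .snd ℝ ℝ (ℝ × ℝ))).prod
      (.fst ℝ ℝ ℝ ∘L .snd ℝ ℝ (ℝ × ℝ))
  have hL : ∀ v : ℝ × ℝ × ℝ, L v = ((v.1, v.2.2 - v.2.1), v.2.1) := fun v => rfl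
  have hL0 : Tendsto L (𝓝 0) (𝓝 0) := L.continuous.tendsto' 0 0 (map_zero L)
  have hx0 : Tendsto (fun q : ℝ × ℝ × ℝ => q.1) (𝓝 0) (𝓝 0) := continuous_fst.tendsto' 0 0 rfl
  obtain ⟨δ, hδ, hall⟩ := Metric.eventually_nhds_iff_ball.1
    ((hL0.eventually hΨ).and (hL0.eventually hΨg))
  obtain ⟨δ', hδ', hall'⟩ := Metric.eventually_nhds_iff_ball.1 hc
  have hcν : ∀ x ∈ Metric.ball 0 δ', ContDiffAt ℝ ∞ (fun x => ν (c x)) x := fun x hx =>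
    (hνd _ (hall' x hx).2.1).comp x (hall' x hx).1
  have hsub : ∀ {X : Type} [PseudoMetricSpace X] {x y : X}, x ∈ Metric.ball y (min δ δ') →
      x ∈ Metric.ball y δ ∧ x ∈ Metric.ball y δ' := fun hx =>
    ⟨Metric.ball_subset_ball (min_le_left _ _) hx, Metric.ball_subset_ball (min_le_right _ _) hx⟩
  have hνlt : ∀ x ∈ Metric.ball 0 (min δ δ'), 0 < ν (c x) ^ 2 ∧ 0 < 1 - ν (c x) ^ 2 := by
    intro x hx
    obtain ⟨-, -, -, h1, h2⟩ := hfr _ (hall' x (hsub hx).2).2.1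
    exact ⟨h1, sub_pos.2 h2⟩
  have hfst : ∀ q ∈ Metric.ball (0 : ℝ × ℝ × ℝ) (min δ δ'), q.1 ∈ Metric.ball 0 (min δ δ') := by
    intro q hq
    rw [Metric.mem_ball, Prod.dist_eq] at hq
    exact (le_max_left _ _).trans_lt hq
  have hfd : ∀ q ∈ Metric.ball 0 (min δ δ'), ∀ v,
      fderiv ℝ (fun q => Ψ (L q)) q v = fderiv ℝ Ψ (L q) (L v) := by
    intro q hq v
    have h1 : fderiv ℝ (fun q => Ψ (L q)) q = _ := fderiv_comp q
      ((hall q (hsub hq).1).1.1.differentiableAt (by simp)) L.differentiableAt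
    rw [h1, ContinuousLinearMap.fderiv]
    rfl
  refine ⟨fun q => Ψ (L q), fun x => √(ν (c x) ^ 2), fun x => √(1 - ν (c x) ^ 2), min δ δ',
    lt_min hδ hδ', fun q hq => (hall q (hsub hq).1).1.1.comp q L.contDiff.contDiffAt,
    fun q hq => (hall q (hsub hq).1).1.2.1, ?_,
    fun x hx => ((hcν x (hsub hx).2).pow 2).sqrt (hνlt x hx).1.ne',
    fun x hx => (contDiffAt_const.sub ((hcν x (hsub hx).2).pow 2)).sqrt (hνlt x hx).2.ne',
    fun x hx => Real.sqrt_pos.2 (hνlt x hx).1, fun x hx => Real.sqrt_pos.2 (hνlt x hx).2,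
    fun x hx => ?_, fun q hq v w => ?_, fun q hq => ?_⟩
  · rw [map_zero, ← hσ0]
    exact hΨ0.self_of_nhds.1
  · rw [Real.sq_sqrt (hνlt x hx).1.le, Real.sq_sqrt (hνlt x hx).2.le]
    ring
  · rw [hfd q hq, hfd q hq, (hall q (hsub hq).1).2, Real.sq_sqrt (hνlt _ (hfst q hq)).1.le,
      Real.sq_sqrt (hνlt _ (hfst q hq)).2.le]
    simp only [hL]
    ring
  · have h1 : L (0, 1, 1) = (0, 1) := by
      rw [hL]
      simp [Prod.ext_iff]
    rw [hfd q hq, ← (hall q (hsub hq).1).1.2.2, h1]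

end Chart

section Frame
open Filter Topology
open scoped ContDiff

variable {M : Type} [NormedAddCommGroup M] [NormedSpace ℝ M] {U : Set M}
  {G : M → M →L[ℝ] M →L[ℝ] ℝ} {B : M → M →L[ℝ] M →L[ℝ] M}

theorem ContDiffAt.deriv_infty {f : ℝ → ℝ} {x : ℝ} (hf : ContDiffAt ℝ ∞ f x) :
    ContDiffAt ℝ ∞ (deriv f) x :=
  (hf.fderiv_right (m := ∞) (by simp)).clm_apply contDiffAt_const

namespace IsAdaptedChart

variable {ξ : M → M} {p : M} {Φ : ℝ × ℝ × ℝ → M} {a b : ℝ → ℝ} {δ : ℝ}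

/-- The function `ω = θ'` when `a = sin θ` and `b = cos θ`. -/
def rot (a b : ℝ → ℝ) (x : ℝ) : ℝ := deriv a x / b x

/-- The unit field in the direction `∂_x`. -/
def e₁ (Φ : ℝ × ℝ × ℝ → M) (q : ℝ × ℝ × ℝ) : M := fderiv ℝ Φ q (1, 0, 0)

/-- The unit field in the direction `∂_y`. -/
def e₂ (Φ : ℝ × ℝ × ℝ → M) (a : ℝ → ℝ) (q : ℝ × ℝ × ℝ) : M :=
  (a q.1)⁻¹ • fderiv ℝ Φ q (0, 1, 0)

/-- The unit field in the direction `∂_z`. -/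
def e₃ (Φ : ℝ × ℝ × ℝ → M) (b : ℝ → ℝ) (q : ℝ × ℝ × ℝ) : M :=
  (b q.1)⁻¹ • fderiv ℝ Φ q (0, 0, 1)

theorem fst_mem {q : ℝ × ℝ × ℝ} (hq : q ∈ Metric.ball 0 δ) : q.1 ∈ Metric.ball 0 δ := by
  rw [Metric.mem_ball, Prod.dist_eq] at hq
  exact (le_max_left _ _).trans_lt hq

theorem contDiffAt_rot (C : IsAdaptedChart U G ξ p Φ a b δ)
    {x : ℝ} (hx : x ∈ Metric.ball 0 δ) : ContDiffAt ℝ ∞ (rot a b) x :=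
  (C.smooth_a x hx).deriv_infty.div (C.smooth_b x hx) (C.b_pos x hx).ne'

theorem hasDerivAt_a (C : IsAdaptedChart U G ξ p Φ a b δ) {x : ℝ} (hx : x ∈ Metric.ball 0 δ) :
    HasDerivAt a (rot a b x * b x) x := by
  rw [rot, div_mul_cancel₀ _ (C.b_pos x hx).ne']
  exact ((C.smooth_a x hx).differentiableAt (by simp)).hasDerivAt

theorem hasDerivAt_b (C : IsAdaptedChart U G ξ p Φ a b δ) {x : ℝ} (hx : x ∈ Metric.ball 0 δ) :
    HasDerivAt b (-(rot a b x * a x)) x := by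
  have hb := ((C.smooth_b x hx).differentiableAt (by simp)).hasDerivAt
  have h1 : (fun x => a x ^ 2 + b x ^ 2) =ᶠ[𝓝 x] fun _ => 1 :=
    eventually_of_mem (Metric.isOpen_ball.mem_nhds hx) C.sq_add_sq
  have h2 := (((C.hasDerivAt_a hx).pow 2).add (hb.pow 2)).unique
    ((hasDerivAt_const x (1 : ℝ)).congr_of_eventuallyEq h1)
  have h3 : deriv b x = -(rot a b x * a x) := by
    have hb0 := (C.b_pos x hx).ne'
    simp only [Nat.cast_ofNat, Nat.add_one_sub_one, pow_one] at h2
    apply mul_left_cancel₀ hb0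
    linarith
  rwa [h3] at hb

theorem contDiffAt_two (C : IsAdaptedChart U G ξ p Φ a b δ)
    {q : ℝ × ℝ × ℝ} (hq : q ∈ Metric.ball 0 δ) : ContDiffAt ℝ 2 Φ q :=
  (C.smooth q hq).of_le ENat.LEInfty.out

theorem fderiv_eq (C : IsAdaptedChart U G ξ p Φ a b δ)
    {q : ℝ × ℝ × ℝ} (hq : q ∈ Metric.ball 0 δ) (v : ℝ × ℝ × ℝ) :
    fderiv ℝ Φ q v = v.1 • e₁ Φ q + (a q.1 * v.2.1) • e₂ Φ a q + (b q.1 * v.2.2) • e₃ Φ b q := by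
  have ha := (C.a_pos _ (fst_mem hq)).ne'
  have hb := (C.b_pos _ (fst_mem hq)).ne'
  rw [e₁, e₂, e₃, smul_smul, smul_smul, mul_right_comm, mul_inv_cancel₀ ha, mul_right_comm,
    mul_inv_cancel₀ hb, one_mul, one_mul, ← map_smul, ← map_smul, ← map_smul, ← map_add, ← map_add]
  congr 1
  simp

theorem inner_e₁ (C : IsAdaptedChart U G ξ p Φ a b δ)
    {q : ℝ × ℝ × ℝ} (hq : q ∈ Metric.ball 0 δ) (v : ℝ × ℝ × ℝ) :
    G (Φ q) (e₁ Φ q) (fderiv ℝ Φ q v) = v.1 := by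
  rw [e₁, C.gram q hq]
  simp

theorem inner_e₂ (C : IsAdaptedChart U G ξ p Φ a b δ)
    {q : ℝ × ℝ × ℝ} (hq : q ∈ Metric.ball 0 δ) (v : ℝ × ℝ × ℝ) :
    G (Φ q) (e₂ Φ a q) (fderiv ℝ Φ q v) = a q.1 * v.2.1 := by
  have ha := (C.a_pos _ (fst_mem hq)).ne'
  rw [e₂, map_smul, smul_apply, C.gram q hq]
  simp
  field_simp

theorem inner_e₃ (C : IsAdaptedChart U G ξ p Φ a b δ)
    {q : ℝ × ℝ × ℝ} (hq : q ∈ Metric.ball 0 δ) (v : ℝ × ℝ × ℝ) :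
    G (Φ q) (e₃ Φ b q) (fderiv ℝ Φ q v) = b q.1 * v.2.2 := by
  have hb := (C.b_pos _ (fst_mem hq)).ne'
  rw [e₃, map_smul, smul_apply, C.gram q hq]
  simp
  field_simp

theorem injective_fderiv (C : IsAdaptedChart U G ξ p Φ a b δ)
    {q : ℝ × ℝ × ℝ} (hq : q ∈ Metric.ball 0 δ) :
    Function.Injective (fderiv ℝ Φ q) := by
  rw [injective_iff_map_eq_zero]
  intro v hv
  have ha := (C.a_pos _ (fst_mem hq)).ne'
  have hb := (C.b_pos _ (fst_mem hq)).ne'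
  have h1 := C.inner_e₁ hq v
  have h2 := C.inner_e₂ hq v
  have h3 := C.inner_e₃ hq v
  simp only [hv, map_zero] at h1 h2 h3
  ext
  · exact h1.symm
  · simpa [ha] using h2.symm
  · simpa [hb] using h3.symm

theorem bijective_fderiv [FiniteDimensional ℝ M] (C : IsAdaptedChart U G ξ p Φ a b δ)
    (hdim : Module.finrank ℝ M = 3)
    {q : ℝ × ℝ × ℝ} (hq : q ∈ Metric.ball 0 δ) : Function.Bijective (fderiv ℝ Φ q) :=
  have hinj := C.injective_fderiv hq
  ⟨hinj, (LinearMap.injective_iff_surjective_of_finrank_eq_finrank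
    (f := (fderiv ℝ Φ q : ℝ × ℝ × ℝ →ₗ[ℝ] M)) (by simp [hdim])).1 hinj⟩

theorem eq_of_inner_eq [FiniteDimensional ℝ M] (C : IsAdaptedChart U G ξ p Φ a b δ)
    (hdim : Module.finrank ℝ M = 3)
    (h : IsLC U G B) {q : ℝ × ℝ × ℝ} (hq : q ∈ Metric.ball 0 δ) {m m' : M}
    (hm : ∀ v, G (Φ q) m (fderiv ℝ Φ q v) = G (Φ q) m' (fderiv ℝ Φ q v)) : m = m' := by
  obtain ⟨v, hv⟩ := (C.bijective_fderiv hdim hq).2 (m - m')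
  by_contra hne
  have := h.pos _ (C.mem q hq) (m - m') (sub_ne_zero.2 hne)
  have h2 : G (Φ q) (m - m') (fderiv ℝ Φ q v) = 0 := by rw [map_sub, sub_apply, hm, sub_self]
  rw [hv] at h2
  exact this.ne' h2

theorem inner_cov_fderiv (C : IsAdaptedChart U G ξ p Φ a b δ)
    (h : IsLC U G B) {q : ℝ × ℝ × ℝ} (hq : q ∈ Metric.ball 0 δ)
    (v w z : ℝ × ℝ × ℝ) :
    G (Φ q) (cov B Φ (fun y => fderiv ℝ Φ y w) q v) (fderiv ℝ Φ q z) =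
      rot a b q.1 * a q.1 * b q.1 * (v.1 * (w.2.1 * z.2.1 - w.2.2 * z.2.2) +
        w.1 * (v.2.1 * z.2.1 - v.2.2 * z.2.2) - z.1 * (v.2.1 * w.2.1 - v.2.2 * w.2.2)) := by
  have key : ∀ v w z : ℝ × ℝ × ℝ,
      fderiv ℝ (fun y => G (Φ y) (fderiv ℝ Φ y w) (fderiv ℝ Φ y z)) q v =
      2 * (rot a b q.1 * a q.1 * b q.1) * (v.1 * (w.2.1 * z.2.1 - w.2.2 * z.2.2)) := by
    intro v w z
    have h1 : (fun y => G (Φ y) (fderiv ℝ Φ y w) (fderiv ℝ Φ y z)) =ᶠ[𝓝 q] fun y =>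
        w.1 * z.1 + a y.1 ^ 2 * (w.2.1 * z.2.1) + b y.1 ^ 2 * (w.2.2 * z.2.2) :=
      eventually_of_mem (Metric.isOpen_ball.mem_nhds hq) fun y hy => C.gram y hy w z
    have hfst : HasFDerivAt (fun y : ℝ × ℝ × ℝ => y.1) (ContinuousLinearMap.fst ℝ ℝ (ℝ × ℝ)) q :=
      hasFDerivAt_fst
    have h2 := ((((C.hasDerivAt_a (fst_mem hq)).comp_hasFDerivAt q hfst).pow 2).mul_const
      (w.2.1 * z.2.1)).const_add (w.1 * z.1) |>.add
      ((((C.hasDerivAt_b (fst_mem hq)).comp_hasFDerivAt q hfst).pow 2).mul_const (w.2.2 * z.2.2))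
    rw [h1.fderiv_eq]
    have h3 := congrArg (fun L => L v) h2.fderiv
    refine Eq.trans h3 ?_
    simp
    ring
  have := h.koszul (C.mem q hq) (C.contDiffAt_two hq) v w z
  rw [key, key, key] at this
  linarith

theorem cov_e₁ [FiniteDimensional ℝ M] (C : IsAdaptedChart U G ξ p Φ a b δ)
    (hdim : Module.finrank ℝ M = 3)
    (h : IsLC U G B) {q : ℝ × ℝ × ℝ} (hq : q ∈ Metric.ball 0 δ) (v : ℝ × ℝ × ℝ) :
    cov B Φ (e₁ Φ) q v = (rot a b q.1 * b q.1 * v.2.1) • e₂ Φ a q +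
      (-(rot a b q.1 * a q.1 * v.2.2)) • e₃ Φ b q := by
  refine C.eq_of_inner_eq hdim h hq fun z => ?_
  simp only [map_add, map_smul, add_apply, smul_apply, smul_eq_mul, C.inner_e₂ hq, C.inner_e₃ hq]
  refine (C.inner_cov_fderiv h hq v (1, 0, 0) z).trans ?_
  simp
  ring

theorem cov_e₂ [FiniteDimensional ℝ M] (C : IsAdaptedChart U G ξ p Φ a b δ)
    (hdim : Module.finrank ℝ M = 3)
    (h : IsLC U G B) {q : ℝ × ℝ × ℝ} (hq : q ∈ Metric.ball 0 δ) (v : ℝ × ℝ × ℝ) :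
    cov B Φ (e₂ Φ a) q v = (-(rot a b q.1 * b q.1 * v.2.1)) • e₁ Φ q := by
  have ha := (C.a_pos _ (fst_mem hq)).ne'
  have h1 : HasFDerivAt (fun y : ℝ × ℝ × ℝ => (a y.1)⁻¹) _ q :=
    ((C.hasDerivAt_a (fst_mem hq)).inv ha).comp_hasFDerivAt q
      (hasFDerivAt_fst (𝕜 := ℝ) (E := ℝ) (F := ℝ × ℝ))
  have h2 := cov_smul B Φ h1.differentiableAt
    ((C.contDiffAt_two hq).differentiableAt_fderiv_apply (0, 1, 0)) v
  rw [h1.fderiv] at h2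
  refine C.eq_of_inner_eq hdim h hq fun z => ?_
  refine (congrArg (fun m => G (Φ q) m (fderiv ℝ Φ q z)) h2).trans ?_
  simp only [map_add, map_smul, add_apply, smul_apply, smul_eq_mul, C.inner_e₁ hq,
    C.inner_cov_fderiv h hq, C.gram q hq]
  simp
  field_simp
  ring

theorem cov_e₃ [FiniteDimensional ℝ M] (C : IsAdaptedChart U G ξ p Φ a b δ)
    (hdim : Module.finrank ℝ M = 3)
    (h : IsLC U G B) {q : ℝ × ℝ × ℝ} (hq : q ∈ Metric.ball 0 δ) (v : ℝ × ℝ × ℝ) :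
    cov B Φ (e₃ Φ b) q v = (rot a b q.1 * a q.1 * v.2.2) • e₁ Φ q := by
  have hb := (C.b_pos _ (fst_mem hq)).ne'
  have h1 : HasFDerivAt (fun y : ℝ × ℝ × ℝ => (b y.1)⁻¹) _ q :=
    ((C.hasDerivAt_b (fst_mem hq)).inv hb).comp_hasFDerivAt q
      (hasFDerivAt_fst (𝕜 := ℝ) (E := ℝ) (F := ℝ × ℝ))
  have h2 := cov_smul B Φ h1.differentiableAt
    ((C.contDiffAt_two hq).differentiableAt_fderiv_apply (0, 0, 1)) v
  rw [h1.fderiv] at h2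
  refine C.eq_of_inner_eq hdim h hq fun z => ?_
  refine (congrArg (fun m => G (Φ q) m (fderiv ℝ Φ q z)) h2).trans ?_
  simp only [map_add, map_smul, add_apply, smul_apply, smul_eq_mul, C.inner_e₁ hq,
    C.inner_cov_fderiv h hq, C.gram q hq]
  simp
  field_simp
  ring

end IsAdaptedChart
end Frame

section Curvature
open Filter Topology
open scoped ContDiff

variable {M : Type} [NormedAddCommGroup M] [NormedSpace ℝ M] {U : Set M}
  {G : M → M →L[ℝ] M →L[ℝ] ℝ} {B : M → M →L[ℝ] M →L[ℝ] M}

theorem curvB_add_smul (B : M → M →L[ℝ] M →L[ℝ] M) (x v w m₁ m₂ m₃ : M) (r₁ r₂ r₃ : ℝ) :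
    curvB B x v w (r₁ • m₁ + r₂ • m₂ + r₃ • m₃) =
      r₁ • curvB B x v w m₁ + r₂ • curvB B x v w m₂ + r₃ • curvB B x v w m₃ := by
  simp only [curvB, map_add, map_smul]
  module

theorem cov_add_smul {E : Type} [NormedAddCommGroup E] [NormedSpace ℝ E]
    (B : M → M →L[ℝ] M →L[ℝ] M) (F : E → M) {r s : E → ℝ} {r' s' : E →L[ℝ] ℝ}
    {V W : E → M} {u : E} (hr : HasFDerivAt r r' u) (hs : HasFDerivAt s s' u)
    (hV : DifferentiableAt ℝ V u) (hW : DifferentiableAt ℝ W u) (v : E) :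
    cov B F (fun y => r y • V y + s y • W y) u v = r' v • V u + r u • cov B F V u v +
      (s' v • W u + s u • cov B F W u v) := by
  rw [cov_add B F (hr.differentiableAt.fun_smul hV) (hs.differentiableAt.fun_smul hW),
    cov_smul B F hr.differentiableAt hV, cov_smul B F hs.differentiableAt hW, hr.fderiv, hs.fderiv]

namespace IsAdaptedChart

variable {ξ : M → M} {p : M} {Φ : ℝ × ℝ × ℝ → M} {a b : ℝ → ℝ} {δ : ℝ}

theorem contDiffAt_fderiv_apply (C : IsAdaptedChart U G ξ p Φ a b δ) {q : ℝ × ℝ × ℝ}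
    (hq : q ∈ Metric.ball 0 δ) (v : ℝ × ℝ × ℝ) : ContDiffAt ℝ ∞ (fun y => fderiv ℝ Φ y v) q :=
  ((C.smooth q hq).fderiv_right (m := ∞) (by simp)).clm_apply contDiffAt_const

theorem contDiffAt_e₁ (C : IsAdaptedChart U G ξ p Φ a b δ) {q : ℝ × ℝ × ℝ}
    (hq : q ∈ Metric.ball 0 δ) : ContDiffAt ℝ ∞ (e₁ Φ) q :=
  C.contDiffAt_fderiv_apply hq _

theorem contDiffAt_e₂ (C : IsAdaptedChart U G ξ p Φ a b δ) {q : ℝ × ℝ × ℝ}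
    (hq : q ∈ Metric.ball 0 δ) : ContDiffAt ℝ ∞ (e₂ Φ a) q :=
  (((C.smooth_a _ (fst_mem hq)).comp q contDiffAt_fst).inv (C.a_pos _ (fst_mem hq)).ne').smul
    (C.contDiffAt_fderiv_apply hq _)

theorem contDiffAt_e₃ (C : IsAdaptedChart U G ξ p Φ a b δ) {q : ℝ × ℝ × ℝ}
    (hq : q ∈ Metric.ball 0 δ) : ContDiffAt ℝ ∞ (e₃ Φ b) q :=
  (((C.smooth_b _ (fst_mem hq)).comp q contDiffAt_fst).inv (C.b_pos _ (fst_mem hq)).ne').smul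
    (C.contDiffAt_fderiv_apply hq _)

theorem hasFDerivAt_a (C : IsAdaptedChart U G ξ p Φ a b δ) {q : ℝ × ℝ × ℝ}
    (hq : q ∈ Metric.ball 0 δ) : HasFDerivAt (fun y : ℝ × ℝ × ℝ => a y.1)
      ((rot a b q.1 * b q.1) • ContinuousLinearMap.fst ℝ ℝ (ℝ × ℝ)) q :=
  (C.hasDerivAt_a (fst_mem hq)).comp_hasFDerivAt q hasFDerivAt_fst

theorem hasFDerivAt_b (C : IsAdaptedChart U G ξ p Φ a b δ) {q : ℝ × ℝ × ℝ}
    (hq : q ∈ Metric.ball 0 δ) : HasFDerivAt (fun y : ℝ × ℝ × ℝ => b y.1)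
      ((-(rot a b q.1 * a q.1)) • ContinuousLinearMap.fst ℝ ℝ (ℝ × ℝ)) q :=
  (C.hasDerivAt_b (fst_mem hq)).comp_hasFDerivAt q hasFDerivAt_fst

/-- Where `ω` is locally constant, the metric has constant curvature `ω²`. -/
theorem curvB_eq [FiniteDimensional ℝ M] (C : IsAdaptedChart U G ξ p Φ a b δ)
    (hdim : Module.finrank ℝ M = 3) (h : IsLC U G B) {q : ℝ × ℝ × ℝ} (hq : q ∈ Metric.ball 0 δ)
    {c : ℝ} (hc : ∀ᶠ x in 𝓝 q.1, rot a b x = c) (v w : ℝ × ℝ × ℝ) (m : M) :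
    curvB B (Φ q) (fderiv ℝ Φ q v) (fderiv ℝ Φ q w) m =
      c ^ 2 • (G (Φ q) m (fderiv ℝ Φ q w) • fderiv ℝ Φ q v -
        G (Φ q) m (fderiv ℝ Φ q v) • fderiv ℝ Φ q w) := by
  have hev : ∀ᶠ y in 𝓝 q, y ∈ Metric.ball 0 δ ∧ rot a b y.1 = c :=
    (eventually_of_mem (Metric.isOpen_ball.mem_nhds hq) fun _ hy => hy).and
      (continuousAt_fst.eventually hc)
  have hcq := hc.self_of_nhds
  have hΦ := C.contDiffAt_two hq
  have d₁ := (C.contDiffAt_e₁ hq).differentiableAt (by simp)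
  have d₂ := (C.contDiffAt_e₂ hq).differentiableAt (by simp)
  have d₃ := (C.contDiffAt_e₃ hq).differentiableAt (by simp)
  have ha := C.hasFDerivAt_a hq
  have hb := C.hasFDerivAt_b hq
  have k₁ : ∀ v w, cov B Φ (fun y => cov B Φ (e₁ Φ) y w) q v =
      ((c * -(c * a q.1 * v.1)) * w.2.1) • e₂ Φ a q +
        (c * b q.1 * w.2.1) • (-(c * b q.1 * v.2.1)) • e₁ Φ q +
      ((-(c * (c * b q.1 * v.1) * w.2.2)) • e₃ Φ b q +
        (-(c * a q.1 * w.2.2)) • (c * a q.1 * v.2.2) • e₁ Φ q) := by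
    intro v w
    have h1 : (fun y => cov B Φ (e₁ Φ) y w) =ᶠ[𝓝 q] fun y =>
        (c * b y.1 * w.2.1) • e₂ Φ a y + (-(c * a y.1 * w.2.2)) • e₃ Φ b y :=
      hev.mono fun y hy => by beta_reduce; rw [C.cov_e₁ hdim h hy.1, hy.2]
    rw [cov_congr B (EventuallyEq.refl (𝓝 q) Φ) h1 v,
      cov_add_smul B Φ ((hb.const_mul c).mul_const _) ((ha.const_mul c).mul_const _).fun_neg d₂ d₃,
      C.cov_e₂ hdim h hq, C.cov_e₃ hdim h hq, hcq]
    simp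
    ring_nf
  have k₂ : ∀ v w, cov B Φ (fun y => cov B Φ (e₂ Φ a) y w) q v =
      (-(c * (-(c * a q.1 * v.1)) * w.2.1)) • e₁ Φ q + (-(c * b q.1 * w.2.1)) •
        ((c * b q.1 * v.2.1) • e₂ Φ a q + (-(c * a q.1 * v.2.2)) • e₃ Φ b q) := by
    intro v w
    have h1 : (fun y => cov B Φ (e₂ Φ a) y w) =ᶠ[𝓝 q] fun y => (-(c * b y.1 * w.2.1)) • e₁ Φ y :=
      hev.mono fun y hy => by beta_reduce; rw [C.cov_e₂ hdim h hy.1, hy.2]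
    have h2 := ((hb.const_mul c).mul_const w.2.1).fun_neg
    rw [cov_congr B (EventuallyEq.refl (𝓝 q) Φ) h1 v, cov_smul B Φ h2.differentiableAt d₁,
      C.cov_e₁ hdim h hq, h2.fderiv, hcq]
    simp
    ring_nf
  have k₃ : ∀ v w, cov B Φ (fun y => cov B Φ (e₃ Φ b) y w) q v =
      (c * (c * b q.1 * v.1) * w.2.2) • e₁ Φ q + (c * a q.1 * w.2.2) •
        ((c * b q.1 * v.2.1) • e₂ Φ a q + (-(c * a q.1 * v.2.2)) • e₃ Φ b q) := by
    intro v w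
    have h1 : (fun y => cov B Φ (e₃ Φ b) y w) =ᶠ[𝓝 q] fun y => (c * a y.1 * w.2.2) • e₁ Φ y :=
      hev.mono fun y hy => by beta_reduce; rw [C.cov_e₃ hdim h hy.1, hy.2]
    have h2 := (ha.const_mul c).mul_const w.2.2
    rw [cov_congr B (EventuallyEq.refl (𝓝 q) Φ) h1 v, cov_smul B Φ h2.differentiableAt d₁,
      C.cov_e₁ hdim h hq, h2.fderiv, hcq]
    simp
    ring_nf
  obtain ⟨z, rfl⟩ := (C.bijective_fderiv hdim hq).2 m
  have hU := C.mem q hq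
  have c₁ := h.cov_cov_sub hU hΦ ((C.contDiffAt_e₁ hq).of_le ENat.LEInfty.out) v w
  have c₂ := h.cov_cov_sub hU hΦ ((C.contDiffAt_e₂ hq).of_le ENat.LEInfty.out) v w
  have c₃ := h.cov_cov_sub hU hΦ ((C.contDiffAt_e₃ hq).of_le ENat.LEInfty.out) v w
  rw [k₁, k₁] at c₁
  rw [k₂, k₂] at c₂
  rw [k₃, k₃] at c₃
  rw [C.gram q hq, C.gram q hq, C.fderiv_eq hq z, curvB_add_smul, ← c₁, ← c₂, ← c₃,
    C.fderiv_eq hq v, C.fderiv_eq hq w]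
  module

theorem cov_field [FiniteDimensional ℝ M] (C : IsAdaptedChart U G ξ p Φ a b δ)
    (hdim : Module.finrank ℝ M = 3) (h : IsLC U G B) (hξ : ContDiffOn ℝ ∞ ξ U)
    {q : ℝ × ℝ × ℝ} (hq : q ∈ Metric.ball 0 δ) :
    cov B id ξ (Φ q) (e₁ Φ q) =
      rot a b q.1 • (b q.1 • e₂ Φ a q - a q.1 • e₃ Φ b q) := by
  have hU := C.mem q hq
  have h1 : (fun y => ξ (Φ y)) =ᶠ[𝓝 q] fun y => a y.1 • e₂ Φ a y + b y.1 • e₃ Φ b y := by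
    filter_upwards [Metric.isOpen_ball.mem_nhds hq] with y hy
    rw [← C.field y hy, C.fderiv_eq hy]
    simp
  have h2 := cov_congr B (EventuallyEq.refl (𝓝 q) Φ) h1 (1, 0, 0)
  rw [cov_field_comp B ((hξ.contDiffAt (h.isOpen.mem_nhds hU)).differentiableAt (by simp))
    ((C.contDiffAt_two hq).differentiableAt (by simp)),
    cov_add_smul B Φ (C.hasFDerivAt_a hq) (C.hasFDerivAt_b hq)
      ((C.contDiffAt_e₂ hq).differentiableAt (by simp))
      ((C.contDiffAt_e₃ hq).differentiableAt (by simp)),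
    C.cov_e₂ hdim h hq, C.cov_e₃ hdim h hq] at h2
  refine h2.trans ?_
  simp
  module

end IsAdaptedChart
end Curvature

section GaussMap
open Filter Topology
open scoped ContDiff

variable {E : Type} [NormedAddCommGroup E] [NormedSpace ℝ E]

theorem exists_ne_zero_apply_eq_zero [FiniteDimensional ℝ E] (hE : 1 < Module.finrank ℝ E)
    (l : E →L[ℝ] ℝ) :
    ∃ t, t ≠ 0 ∧ l t = 0 := by
  have h1 : LinearMap.ker (l : E →ₗ[ℝ] ℝ) ≠ ⊥ := LinearMap.ker_ne_bot_of_finrank_lt (by simpa)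
  obtain ⟨t, ht, ht0⟩ := Submodule.exists_mem_ne_zero_of_ne_bot h1
  exact ⟨t, ht0, ht⟩

theorem exists_apply_eq_one [FiniteDimensional ℝ E] (hE : 1 < Module.finrank ℝ E) {l m : E →L[ℝ] ℝ}
    (h : ∀ v, l v = 0 → m v = 0 → v = 0) : ∃ v, l v = 1 ∧ m v = 0 := by
  obtain ⟨t, ht0, ht⟩ := exists_ne_zero_apply_eq_zero hE m
  have h1 : l t ≠ 0 := fun h1 => ht0 (h t h1 ht)
  exact ⟨(l t)⁻¹ • t, by simp [h1], by simp [ht]⟩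

theorem exists_mul_ne_mul [FiniteDimensional ℝ E] (hE : 1 < Module.finrank ℝ E) {l m : E →L[ℝ] ℝ}
    (h : ∀ v, l v = 0 → m v = 0 → v = 0) : ∃ v w, m w * l v - m v * l w = 1 := by
  obtain ⟨v, hv, hv'⟩ := exists_apply_eq_one hE h
  obtain ⟨w, hw, hw'⟩ := exists_apply_eq_one hE fun v h1 h2 => h v h2 h1
  exact ⟨v, w, by simp [*]⟩

/-- The exterior derivative of `dn = r dY` vanishes. -/
theorem fderiv_mul_fderiv_comm {n r Y : E → ℝ} {u : E} (hn : ContDiffAt ℝ 2 n u)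
    (hY : ContDiffAt ℝ 2 Y u) (hr : DifferentiableAt ℝ r u)
    (h : ∀ᶠ y in 𝓝 u, ∀ v, fderiv ℝ n y v = r y * fderiv ℝ Y y v) (v w : E) :
    fderiv ℝ r u v * fderiv ℝ Y u w = fderiv ℝ r u w * fderiv ℝ Y u v := by
  have key : ∀ v w, fderiv ℝ (fun y => fderiv ℝ n y w) u v =
      r u * fderiv ℝ (fun y => fderiv ℝ Y y w) u v + fderiv ℝ Y u w * fderiv ℝ r u v := by
    intro v w
    have h1 : (fun y => fderiv ℝ n y w) =ᶠ[𝓝 u] fun y => r y * fderiv ℝ Y y w :=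
      h.mono fun y hy => hy w
    rw [h1.fderiv_eq, fderiv_fun_mul hr (hY.differentiableAt_fderiv_apply w)]
    rfl
  have h2 := fderiv_fderiv_apply_comm hn v w
  rw [key, key, fderiv_fderiv_apply_comm hY v w] at h2
  linarith

/-- The components `n₁`, `n₂`, `n₃` in an adapted orthonormal frame of the unit normal of a totally
geodesic surface, whose coordinates are `f`, satisfy the structure equations at `u`. -/
structure IsGaussData (a b κ : ℝ → ℝ) (f : E → ℝ × ℝ × ℝ) (n₁ n₂ n₃ : E → ℝ) (u : E) : Prop where
  smooth : ContDiffAt ℝ ∞ f u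
  smooth₁ : ContDiffAt ℝ ∞ n₁ u
  smooth₂ : ContDiffAt ℝ ∞ n₂ u
  smooth₃ : ContDiffAt ℝ ∞ n₃ u
  smooth_κ : ContDiffAt ℝ ∞ κ (f u).1
  a_pos : 0 < a (f u).1
  b_pos : 0 < b (f u).1
  deriv_a : HasDerivAt a (κ (f u).1 * b (f u).1) (f u).1
  deriv_b : HasDerivAt b (-(κ (f u).1 * a (f u).1)) (f u).1
  fderiv₁ : ∀ v, fderiv ℝ n₁ u v = κ (f u).1 *
    (b (f u).1 * n₂ u * (fderiv ℝ f u v).2.1 - a (f u).1 * n₃ u * (fderiv ℝ f u v).2.2)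
  fderiv₂ : ∀ v, fderiv ℝ n₂ u v = -(κ (f u).1 * b (f u).1 * n₁ u) * (fderiv ℝ f u v).2.1
  fderiv₃ : ∀ v, fderiv ℝ n₃ u v = (κ (f u).1 * a (f u).1 * n₁ u) * (fderiv ℝ f u v).2.2
  orth : ∀ v, n₁ u * (fderiv ℝ f u v).1 + a (f u).1 * n₂ u * (fderiv ℝ f u v).2.1 +
    b (f u).1 * n₃ u * (fderiv ℝ f u v).2.2 = 0
  unit : n₁ u ^ 2 + n₂ u ^ 2 + n₃ u ^ 2 = 1
  inj : ∀ v, fderiv ℝ f u v = 0 → v = 0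

namespace IsGaussData

variable {a b κ : ℝ → ℝ} {f : E → ℝ × ℝ × ℝ} {n₁ n₂ n₃ : E → ℝ} {u : E}

theorem hasFDerivAt (D : IsGaussData a b κ f n₁ n₂ n₃ u) :
    HasFDerivAt (fun y => (f y).1) (.fst ℝ ℝ (ℝ × ℝ) ∘L fderiv ℝ f u) u ∧
    HasFDerivAt (fun y => (f y).2.1) (.fst ℝ ℝ ℝ ∘L .snd ℝ ℝ (ℝ × ℝ) ∘L fderiv ℝ f u) u ∧
    HasFDerivAt (fun y => (f y).2.2) (.snd ℝ ℝ ℝ ∘L .snd ℝ ℝ (ℝ × ℝ) ∘L fderiv ℝ f u) u := by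
  have h := (D.smooth.differentiableAt (by simp)).hasFDerivAt
  exact ⟨h.fst, h.snd.fst, h.snd.snd⟩

theorem eq_zero_of_deriv_ne_zero [FiniteDimensional ℝ E] (hE : 1 < Module.finrank ℝ E)
    (hD : ∀ᶠ y in 𝓝 u, IsGaussData a b κ f n₁ n₂ n₃ y) (hκ : deriv κ (f u).1 ≠ 0) :
    n₁ u = 0 ∨ n₂ u = 0 ∧ n₃ u = 0 := by
  have D := hD.self_of_nhds
  by_contra! hcon
  obtain ⟨hX, hY, hZ⟩ := D.hasFDerivAt
  have hdκ := (D.smooth_κ.differentiableAt (by simp)).hasDerivAt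
  have hd₁ := (D.smooth₁.differentiableAt (by simp)).hasFDerivAt
  obtain ⟨v, w, hvw⟩ := exists_mul_ne_mul hE
    (l := .fst ℝ ℝ ℝ ∘L .snd ℝ ℝ (ℝ × ℝ) ∘L fderiv ℝ f u)
    (m := .snd ℝ ℝ ℝ ∘L .snd ℝ ℝ (ℝ × ℝ) ∘L fderiv ℝ f u) fun t ht ht' => by
      have h1 := D.orth t
      change (fderiv ℝ f u t).2.1 = 0 at ht
      change (fderiv ℝ f u t).2.2 = 0 at ht'
      rw [ht, ht', mul_zero, mul_zero, add_zero, add_zero] at h1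
      exact D.inj t (Prod.ext ((mul_eq_zero.1 h1).resolve_left hcon.1) (Prod.ext ht ht'))
  have hr₂ := (((hdκ.mul D.deriv_b).comp_hasFDerivAt u hX).mul hd₁).neg
  have hr₃ := ((hdκ.mul D.deriv_a).comp_hasFDerivAt u hX).mul hd₁
  have e₂ := fderiv_mul_fderiv_comm (D.smooth₂.of_le ENat.LEInfty.out)
    ((contDiffAt_fst.comp u (contDiffAt_snd.comp u D.smooth)).of_le ENat.LEInfty.out)
    hr₂.differentiableAt (hD.mono fun y hy v => by
      refine (hy.fderiv₂ v).trans ?_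
      rw [show (Prod.fst ∘ Prod.snd ∘ f) = fun y => (f y).2.1 from rfl, hy.hasFDerivAt.2.1.fderiv]
      rfl) v w
  have e₃ := fderiv_mul_fderiv_comm (D.smooth₃.of_le ENat.LEInfty.out)
    ((contDiffAt_snd.comp u (contDiffAt_snd.comp u D.smooth)).of_le ENat.LEInfty.out)
    hr₃.differentiableAt (hD.mono fun y hy v => by
      refine (hy.fderiv₃ v).trans ?_
      rw [show (Prod.snd ∘ Prod.snd ∘ f) = fun y => (f y).2.2 from rfl, hy.hasFDerivAt.2.2.fderiv]
      rfl) v w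
  rw [show (Prod.fst ∘ Prod.snd ∘ f) = fun y => (f y).2.1 from rfl, hY.fderiv, hr₂.fderiv] at e₂
  rw [show (Prod.snd ∘ Prod.snd ∘ f) = fun y => (f y).2.2 from rfl, hZ.fderiv, hr₃.fderiv] at e₃
  simp [D.fderiv₁] at e₂ e₃ hvw
  have ov := D.orth v
  have ow := D.orth w
  have ha := D.a_pos.ne'
  have hb := D.b_pos.ne'
  have z₃ : deriv κ (f u).1 * b (f u).1 ^ 2 * n₃ u = 0 := by
    linear_combination -e₂ - (deriv κ (f u).1 * b (f u).1 - κ (f u).1 ^ 2 * a (f u).1) *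
      ((fderiv ℝ f u w).2.1 * ov - (fderiv ℝ f u v).2.1 * ow) -
      deriv κ (f u).1 * b (f u).1 ^ 2 * n₃ u * hvw
  have z₂ : deriv κ (f u).1 * a (f u).1 ^ 2 * n₂ u = 0 := by
    linear_combination -e₃ + (deriv κ (f u).1 * a (f u).1 + κ (f u).1 ^ 2 * b (f u).1) *
      ((fderiv ℝ f u w).2.2 * ov - (fderiv ℝ f u v).2.2 * ow) -
      deriv κ (f u).1 * a (f u).1 ^ 2 * n₂ u * hvw
  have hn₂ : n₂ u = 0 := by simpa [hκ, ha] using z₂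
  exact hcon.2 hn₂ (by simpa [hκ, hb] using z₃)

theorem eventually_deriv_eq_zero [FiniteDimensional ℝ E] (hE : 1 < Module.finrank ℝ E)
    (hD : ∀ᶠ y in 𝓝 u, IsGaussData a b κ f n₁ n₂ n₃ y) (hκ : κ (f u).1 ≠ 0)
    (hu : a (f u).1 * n₂ u + b (f u).1 * n₃ u = 0) : ∀ᶠ y in 𝓝 u, deriv κ (f y).1 = 0 := by
  have D := hD.self_of_nhds
  have hκ' : ∀ᶠ y in 𝓝 u, κ (f y).1 ≠ 0 :=
    (ContinuousAt.comp (f := fun y => (f y).1) D.smooth_κ.continuousAt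
      D.hasFDerivAt.1.continuousAt).eventually_ne hκ
  have hcase : (∀ᶠ y in 𝓝 u, n₁ y ≠ 0) ∨ ∀ᶠ y in 𝓝 u, n₂ y ≠ 0 ∧ n₃ y ≠ 0 := by
    by_cases h1 : n₁ u = 0
    · right
      have hunit := D.unit
      have h2 : n₂ u ≠ 0 := by
        intro h2
        have h3 : n₃ u = 0 := by simpa [h2, D.b_pos.ne'] using hu
        simp [h1, h2, h3] at hunit
      have h3 : n₃ u ≠ 0 := by
        intro h3
        have h2 : n₂ u = 0 := by simpa [h3, D.a_pos.ne'] using hu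
        contradiction
      exact (D.smooth₂.continuousAt.eventually_ne h2).and (D.smooth₃.continuousAt.eventually_ne h3)
    · exact Or.inl (D.smooth₁.continuousAt.eventually_ne h1)
  have zero_of : ∀ y (m : E → ℝ), (∀ᶠ z in 𝓝 y, m z = 0) → ∀ v, fderiv ℝ m y v = 0 := by
    intro y m hm v
    rw [EventuallyEq.fderiv_eq (f := fun _ => 0) hm]
    simp
  rcases hcase with hcase | hcase
  · filter_upwards [hD.eventually_nhds, hκ', hcase.eventually_nhds] with y hy hκy hny
    by_contra hne
    have Dy := hy.self_of_nhds
    have h23 : ∀ᶠ z in 𝓝 y, n₂ z = 0 ∧ n₃ z = 0 := by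
      have hc : ContinuousAt (fun z => deriv κ (f z).1) y :=
        ContinuousAt.comp (f := fun y => (f y).1) Dy.smooth_κ.deriv_infty.continuousAt
          Dy.hasFDerivAt.1.continuousAt
      filter_upwards [hy.eventually_nhds, hc.eventually_ne hne, hny] with z hz h1 h2
      exact (eq_zero_of_deriv_ne_zero hE hz h1).resolve_left h2
    have hn := hny.self_of_nhds
    have hY : ∀ v, (fderiv ℝ f y v).2.1 = 0 := fun v => by
      simpa [hκy, Dy.b_pos.ne', hn, Dy.fderiv₂] using zero_of y n₂ (h23.mono fun z h => h.1) v
    have hZ : ∀ v, (fderiv ℝ f y v).2.2 = 0 := fun v => by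
      simpa [hκy, Dy.a_pos.ne', hn, Dy.fderiv₃] using zero_of y n₃ (h23.mono fun z h => h.2) v
    obtain ⟨t, ht0, -⟩ := exists_ne_zero_apply_eq_zero hE (0 : E →L[ℝ] ℝ)
    refine ht0 (Dy.inj t (Prod.ext ?_ (Prod.ext (hY t) (hZ t))))
    simpa [hY, hZ, hn] using Dy.orth t
  · filter_upwards [hD.eventually_nhds, hκ', hcase.eventually_nhds] with y hy hκy hny
    by_contra hne
    have Dy := hy.self_of_nhds
    have h1 : ∀ᶠ z in 𝓝 y, n₁ z = 0 := by
      have hc : ContinuousAt (fun z => deriv κ (f z).1) y :=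
        ContinuousAt.comp (f := fun y => (f y).1) Dy.smooth_κ.deriv_infty.continuousAt
          Dy.hasFDerivAt.1.continuousAt
      filter_upwards [hy.eventually_nhds, hc.eventually_ne hne, hny] with z hz h1 h2
      exact (eq_zero_of_deriv_ne_zero hE hz h1).resolve_right fun h => h2.1 h.1
    have hn := hny.self_of_nhds
    obtain ⟨t, ht0, ht⟩ := exists_ne_zero_apply_eq_zero hE
      (.fst ℝ ℝ (ℝ × ℝ) ∘L fderiv ℝ f y)
    have k₁ := zero_of y n₁ h1 t
    have k₂ := Dy.orth t
    rw [Dy.fderiv₁, mul_eq_zero_iff_left hκy] at k₁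
    rw [h1.self_of_nhds, zero_mul, zero_add] at k₂
    have ha := Dy.a_pos
    have hb := Dy.b_pos
    have hY : n₂ y * (fderiv ℝ f y t).2.1 = 0 := by
      have h3 : (a (f y).1 ^ 2 + b (f y).1 ^ 2) * (n₂ y * (fderiv ℝ f y t).2.1) = 0 := by
        linear_combination b (f y).1 * k₁ + a (f y).1 * k₂
      exact (mul_eq_zero.1 h3).resolve_left (by positivity)
    have hZ : n₃ y * (fderiv ℝ f y t).2.2 = 0 := by
      have h3 : b (f y).1 * (n₃ y * (fderiv ℝ f y t).2.2) = 0 := by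
        linear_combination k₂ - a (f y).1 * hY
      exact (mul_eq_zero.1 h3).resolve_left hb.ne'
    exact ht0 (Dy.inj t (Prod.ext ht (Prod.ext ((mul_eq_zero.1 hY).resolve_left hn.1)
      ((mul_eq_zero.1 hZ).resolve_left hn.2))))

end IsGaussData
end GaussMap

section Cover
open Filter Topology
open scoped ContDiff

variable {E : Type} [NormedAddCommGroup E] [NormedSpace ℝ E]

theorem frequently_lt_of_fderiv_fderiv_pos {X : E → ℝ} {u v : E} (hX : ContDiffAt ℝ 2 X u)
    (h0 : fderiv ℝ X u v = 0) (h2 : 0 < fderiv ℝ (fun y => fderiv ℝ X y v) u v) :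
    ∃ᶠ y in 𝓝 u, X u < X y := by
  have hl : ∀ s : ℝ, HasDerivAt (fun s : ℝ => u + s • v) v s := fun s => by
    simpa using ((hasDerivAt_id s).smul_const v).const_add u
  have hl0 : u + (0 : ℝ) • v = u := by simp
  have htend : Tendsto (fun s : ℝ => u + s • v) (𝓝 0) (𝓝 u) := by
    have := (hl 0).continuousAt.tendsto
    rwa [hl0] at this
  have hd : ∀ᶠ y in 𝓝 u, DifferentiableAt ℝ X y :=
    (hX.eventually (by simp)).mono fun y hy => hy.differentiableAt (by simp)
  have hg1 : deriv (fun s : ℝ => X (u + s • v)) =ᶠ[𝓝 0] fun s => fderiv ℝ X (u + s • v) v :=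
    (htend.eventually hd).mono fun s hs => (hs.hasFDerivAt.comp_hasDerivAt s (hl s)).deriv
  have hg2 : deriv (deriv fun s : ℝ => X (u + s • v)) 0 =
      fderiv ℝ (fun y => fderiv ℝ X y v) u v := by
    have h1 := (hX.differentiableAt_fderiv_apply v).hasFDerivAt
    rw [← hl0] at h1
    rw [hg1.deriv_eq]
    refine (h1.comp_hasDerivAt (0 : ℝ) (hl 0)).deriv.trans ?_
    rw [hl0]
  intro hle
  have hmin : IsLocalMin (fun s : ℝ => X (u + s • v)) 0 := by
    refine isLocalMin_of_deriv_deriv_pos (by rwa [hg2]) ?_ ?_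
    · rw [hg1.self_of_nhds]
      beta_reduce
      rw [hl0, h0]
    · refine ContinuousAt.comp (g := X) ?_ (hl 0).continuousAt
      rw [hl0]
      exact hX.continuousAt
  have hconst : (fun s : ℝ => X (u + s • v)) =ᶠ[𝓝 0] fun _ => X u := by
    filter_upwards [hmin, htend.eventually hle] with s hs hs'
    rw [hl0] at hs
    exact le_antisymm (not_lt.1 hs') hs
  have h3 := hconst.deriv.deriv_eq
  rw [hg2] at h3
  simp at h3
  exact h2.ne' h3

namespace IsGaussData

variable {a b κ : ℝ → ℝ} {f : E → ℝ × ℝ × ℝ} {n₁ n₂ n₃ : E → ℝ} {u : E}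

theorem nhds_fst_le_map [FiniteDimensional ℝ E] (hE : 1 < Module.finrank ℝ E)
    (hD : ∀ᶠ y in 𝓝 u, IsGaussData a b κ f n₁ n₂ n₃ y) (hκ : κ (f u).1 ≠ 0) :
    𝓝 (f u).1 ≤ map (fun y => (f y).1) (𝓝 u) := by
  have D := hD.self_of_nhds
  obtain ⟨hX, hY, hZ⟩ := D.hasFDerivAt
  have hXs : ContDiffAt ℝ ∞ (fun y => (f y).1) u := contDiffAt_fst.comp u D.smooth
  have hX2 : ContDiffAt ℝ 2 (fun y => (f y).1) u := hXs.of_le ENat.LEInfty.out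
  have : CompleteSpace E := FiniteDimensional.complete ℝ E
  by_cases h0 : ∀ v, (fderiv ℝ f u v).1 = 0
  swap
  · push Not at h0
    obtain ⟨v, hv⟩ := h0
    refine ((hXs.hasStrictFDerivAt (by simp)).map_nhds_eq_of_surj ?_).ge
    rw [hX.fderiv, LinearMap.range_eq_top]
    intro r
    refine ⟨(r / (fderiv ℝ f u v).1) • v, ?_⟩
    simp [hv]
  have ha := D.a_pos
  have hb := D.b_pos
  have hinj : ∀ t, (fderiv ℝ f u t).2.1 = 0 → (fderiv ℝ f u t).2.2 = 0 → t = 0 := fun t h1 h2 =>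
    D.inj t (Prod.ext (h0 t) (Prod.ext h1 h2))
  obtain ⟨v, hvY, hvZ⟩ := exists_apply_eq_one hE
    (l := .fst ℝ ℝ ℝ ∘L .snd ℝ ℝ (ℝ × ℝ) ∘L fderiv ℝ f u)
    (m := .snd ℝ ℝ ℝ ∘L .snd ℝ ℝ (ℝ × ℝ) ∘L fderiv ℝ f u) hinj
  obtain ⟨w, hwZ, hwY⟩ := exists_apply_eq_one hE
    (m := .fst ℝ ℝ ℝ ∘L .snd ℝ ℝ (ℝ × ℝ) ∘L fderiv ℝ f u)
    (l := .snd ℝ ℝ ℝ ∘L .snd ℝ ℝ (ℝ × ℝ) ∘L fderiv ℝ f u) fun t h1 h2 => hinj t h2 h1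
  change (fderiv ℝ f u v).2.1 = 1 at hvY
  change (fderiv ℝ f u v).2.2 = 0 at hvZ
  change (fderiv ℝ f u w).2.1 = 0 at hwY
  change (fderiv ℝ f u w).2.2 = 1 at hwZ
  have hn₂ : n₂ u = 0 := by simpa [h0, hvY, hvZ, ha.ne'] using D.orth v
  have hn₃ : n₃ u = 0 := by simpa [h0, hwY, hwZ, hb.ne'] using D.orth w
  have hn₁ : n₁ u ≠ 0 := fun h1 => by simpa [h1, hn₂, hn₃] using D.unit
  have hdX : ∀ᶠ y in 𝓝 u, ∀ t, fderiv ℝ (fun y => (f y).1) y t = (fderiv ℝ f y t).1 :=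
    hD.mono fun y hy t => by rw [hy.hasFDerivAt.1.fderiv]; rfl
  have hXX : ∀ t, fderiv ℝ (fun y => fderiv ℝ (fun y => (f y).1) y t) u t =
      κ (f u).1 * a (f u).1 * b (f u).1 *
        ((fderiv ℝ f u t).2.1 ^ 2 - (fderiv ℝ f u t).2.2 ^ 2) := by
    intro t
    have hdf := ((D.smooth.of_le ENat.LEInfty.out).differentiableAt_fderiv_apply t).hasFDerivAt
    have hφ : HasFDerivAt (fun y => (fderiv ℝ f y t).1) _ u := hdf.fst
    have hψ : HasFDerivAt (fun y => (fderiv ℝ f y t).2.1) _ u := hdf.snd.fst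
    have hχ : HasFDerivAt (fun y => (fderiv ℝ f y t).2.2) _ u := hdf.snd.snd
    have ha' : HasFDerivAt (fun y => a (f y).1) _ u := D.deriv_a.comp_hasFDerivAt u hX
    have hb' : HasFDerivAt (fun y => b (f y).1) _ u := D.deriv_b.comp_hasFDerivAt u hX
    have hd := fun {m : E → ℝ} (hm : ContDiffAt ℝ ∞ m u) =>
      (hm.differentiableAt (by simp)).hasFDerivAt
    have key := (((hd D.smooth₁).fun_mul hφ).fun_add ((ha'.fun_mul (hd D.smooth₂)).fun_mul
      hψ)).fun_add ((hb'.fun_mul (hd D.smooth₃)).fun_mul hχ)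
    have key' := key.congr_of_eventuallyEq (f₁ := fun _ => 0) (hD.mono fun y hy => (hy.orth t).symm)
    have h3 := congrArg (fun L => L t) (key'.unique (hasFDerivAt_const 0 u))
    have h4 : (fun y => fderiv ℝ (fun y => (f y).1) y t) =ᶠ[𝓝 u] fun y => (fderiv ℝ f y t).1 :=
      hdX.mono fun y hy => hy t
    rw [h4.fderiv_eq, hφ.fderiv]
    simp [h0, hn₂, hn₃, D.fderiv₂, D.fderiv₃] at h3 ⊢
    apply mul_left_cancel₀ hn₁
    linarith
  have hfreq : (∃ᶠ y in 𝓝 u, (f u).1 < (f y).1) ∧ ∃ᶠ y in 𝓝 u, (f y).1 < (f u).1 := by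
    have hpos : ∀ t, 0 < κ (f u).1 * a (f u).1 * b (f u).1 *
        ((fderiv ℝ f u t).2.1 ^ 2 - (fderiv ℝ f u t).2.2 ^ 2) →
        ∃ᶠ y in 𝓝 u, (f u).1 < (f y).1 := fun t ht =>
      frequently_lt_of_fderiv_fderiv_pos hX2 (by rw [hdX.self_of_nhds, h0]) (by rwa [hXX])
    have hneg : ∀ t, κ (f u).1 * a (f u).1 * b (f u).1 *
        ((fderiv ℝ f u t).2.1 ^ 2 - (fderiv ℝ f u t).2.2 ^ 2) < 0 →
        ∃ᶠ y in 𝓝 u, (f y).1 < (f u).1 := fun t ht => by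
      have h1 : ∀ y, fderiv ℝ (fun y => -(f y).1) y t = -fderiv ℝ (fun y => (f y).1) y t :=
        fun y => by rw [fderiv_fun_neg]; rfl
      refine (frequently_lt_of_fderiv_fderiv_pos (v := t) hX2.neg ?_ ?_).mono
        fun y hy => neg_lt_neg_iff.1 hy
      · refine (h1 u).trans ?_
        rw [hdX.self_of_nhds, h0, neg_zero]
      · have h2 : (fun y => fderiv ℝ (fun y => -(f y).1) y t) =
          fun y => -fderiv ℝ (fun y => (f y).1) y t := funext h1
        refine lt_of_lt_of_eq ?_ (congrArg (fun F => fderiv ℝ F u t) h2).symm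
        rw [fderiv_fun_neg, neg_apply, hXX]
        linarith
    have hab := mul_pos ha hb
    rcases hκ.lt_or_gt with hs | hs
    · exact ⟨hpos w (by rw [hwY, hwZ]; nlinarith), hneg v (by rw [hvY, hvZ]; nlinarith)⟩
    · exact ⟨hpos v (by rw [hvY, hvZ]; nlinarith), hneg w (by rw [hwY, hwZ]; nlinarith)⟩
  intro S hS
  obtain ⟨r, hr, hball⟩ := Metric.eventually_nhds_iff_ball.1 (hD.and hS)
  have hmem := Metric.ball_mem_nhds u hr
  obtain ⟨y₁, hy₁, h₁⟩ := (hfreq.1.and_eventually hmem).exists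
  obtain ⟨y₂, hy₂, h₂⟩ := (hfreq.2.and_eventually hmem).exists
  have hconn : IsPreconnected ((fun y => (f y).1) '' Metric.ball u r) :=
    (convex_ball u r).isPreconnected.image _ fun y hy =>
      (hball y hy).1.hasFDerivAt.1.continuousAt.continuousWithinAt
  refine mem_of_superset (Icc_mem_nhds hy₂ hy₁) ?_
  refine (hconn.ordConnected.out (mem_image_of_mem _ h₂) (mem_image_of_mem _ h₁)).trans ?_
  rintro _ ⟨y, hy, rfl⟩
  exact (hball y hy).2

theorem eventually_const [FiniteDimensional ℝ E] (hE : 1 < Module.finrank ℝ E)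
    (hD : ∀ᶠ y in 𝓝 u, IsGaussData a b κ f n₁ n₂ n₃ y) (hκ : κ (f u).1 ≠ 0)
    (hu : a (f u).1 * n₂ u + b (f u).1 * n₃ u = 0)
    (hd : ∀ᶠ x in 𝓝 (f u).1, DifferentiableAt ℝ κ x) :
    ∀ᶠ x in 𝓝 (f u).1, κ x = κ (f u).1 := by
  have h1 : ∀ᶠ x in 𝓝 (f u).1, deriv κ x = 0 :=
    nhds_fst_le_map hE hD hκ (eventually_deriv_eq_zero hE hD hκ hu)
  obtain ⟨r, hr, hball⟩ := Metric.eventually_nhds_iff_ball.1 (hd.and h1)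
  filter_upwards [Metric.ball_mem_nhds _ hr] with x hx
  exact Metric.isOpen_ball.is_const_of_deriv_eq_zero (convex_ball _ _).isPreconnected
    (fun y hy => (hball y hy).1.differentiableWithinAt) (fun y hy => (hball y hy).2) hx
    (Metric.mem_ball_self hr)

end IsGaussData
end Cover

section Lift
open Filter Topology
open scoped ContDiff

variable {M : Type} [NormedAddCommGroup M] [NormedSpace ℝ M] {U : Set M}
  {G : M → M →L[ℝ] M →L[ℝ] ℝ} {B : M → M →L[ℝ] M →L[ℝ] M}

theorem IsLC.contDiffAt_inner {E : Type} [NormedAddCommGroup E] [NormedSpace ℝ E]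
    (h : IsLC U G B) {F V W : E → M} {u : E} (hu : F u ∈ U)
    (hF : ContDiffAt ℝ ∞ F u) (hV : ContDiffAt ℝ ∞ V u) (hW : ContDiffAt ℝ ∞ W u) :
    ContDiffAt ℝ ∞ (fun y => G (F y) (V y) (W y)) u :=
  (((h.smoothG.contDiffAt (h.isOpen.mem_nhds hu)).comp u hF).clm_apply hV).clm_apply hW

namespace IsAdaptedChart

variable {ξ : M → M} {p : M} {Φ : ℝ × ℝ × ℝ → M} {a b : ℝ → ℝ} {δ : ℝ}
  {E : Type} [NormedAddCommGroup E] [NormedSpace ℝ E]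

theorem exists_lift [FiniteDimensional ℝ M] (C : IsAdaptedChart U G ξ p Φ a b δ)
    (hdim : Module.finrank ℝ M = 3) {F : E → M} {u : E} (hF : ∀ᶠ y in 𝓝 u, ContDiffAt ℝ ∞ F y)
    (hu : F u = p) :
    ∃ f : E → ℝ × ℝ × ℝ, f u = 0 ∧
      ∀ᶠ y in 𝓝 u, ContDiffAt ℝ ∞ f y ∧ f y ∈ Metric.ball 0 δ ∧ Φ (f y) = F y := by
  have h0 : (0 : ℝ × ℝ × ℝ) ∈ Metric.ball 0 δ := Metric.mem_ball_self C.pos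
  have hd : ∀ q ∈ Metric.ball 0 δ, ∃ Φ' : (ℝ × ℝ × ℝ) ≃L[ℝ] M,
      HasFDerivAt Φ (Φ' : ℝ × ℝ × ℝ →L[ℝ] M) q := fun q hq => by
    obtain ⟨hi, hs⟩ := C.bijective_fderiv hdim hq
    refine ⟨.ofBijective (fderiv ℝ Φ q) (LinearMap.ker_eq_bot.2 hi)
      (LinearMap.range_eq_top.2 hs), ?_⟩
    rw [ContinuousLinearEquiv.coe_ofBijective]
    exact ((C.smooth q hq).differentiableAt (by simp)).hasFDerivAt
  obtain ⟨Φ', hΦ'⟩ := hd 0 h0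
  let e := (C.smooth 0 h0).toOpenPartialHomeomorph Φ hΦ' (by simp)
  have hes : (0 : ℝ × ℝ × ℝ) ∈ e.source := ContDiffAt.mem_toOpenPartialHomeomorph_source _ hΦ' _
  have heΦ : ∀ q, e q = Φ q := fun q => rfl
  have hFe : F u = e 0 := hu.trans C.base.symm
  have hsymm : e.symm (F u) = 0 := by rw [hFe, e.left_inv hes]
  have hut : F u ∈ e.target := hFe ▸ e.map_source hes
  have hFu := hF.self_of_nhds.continuousAt
  refine ⟨fun y => e.symm (F y), hsymm, ?_⟩
  have h1 : ∀ᶠ y in 𝓝 u, e.symm (F y) ∈ Metric.ball 0 δ :=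
    ((e.continuousAt_symm hut).comp hFu).eventually
      (by
        rw [Function.comp_apply, hsymm]
        exact Metric.isOpen_ball.mem_nhds h0)
  filter_upwards [h1, hF, hFu.eventually (e.open_target.mem_nhds hut)] with y hy hFy hyt
  obtain ⟨Ψ', hΨ'⟩ := hd _ hy
  exact ⟨(e.contDiffAt_symm hyt hΨ' (C.smooth _ hy)).comp y hFy, hy,
    (heΦ _).symm.trans (e.right_inv hyt)⟩

theorem isGaussData [FiniteDimensional ℝ M] (C : IsAdaptedChart U G ξ p Φ a b δ)
    (hdim : Module.finrank ℝ M = 3) (h : IsLC U G B) {F N : E → M} {f : E → ℝ × ℝ × ℝ} {u : E}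
    (hN : ContDiffAt ℝ ∞ N u) (hNN : G (F u) (N u) (N u) = 1)
    (hNF : ∀ v, G (F u) (N u) (fderiv ℝ F u v) = 0) (htg : ∀ v, cov B F N u v = 0)
    (hinj : ∀ v, fderiv ℝ F u v = 0 → v = 0) (hf : ContDiffAt ℝ ∞ f u)
    (hfu : f u ∈ Metric.ball 0 δ) (hfF : ∀ᶠ y in 𝓝 u, Φ (f y) = F y) :
    IsGaussData a b (rot a b) f (fun y => G (F y) (N y) (e₁ Φ (f y)))
      (fun y => G (F y) (N y) (e₂ Φ a (f y))) (fun y => G (F y) (N y) (e₃ Φ b (f y))) u := by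
  have hu := hfF.self_of_nhds
  have hFf : F =ᶠ[𝓝 u] fun y => Φ (f y) := hfF.mono fun y hy => hy.symm
  have hfst := fst_mem hfu
  have ha := C.a_pos _ hfst
  have hb := C.b_pos _ hfst
  have hF : ContDiffAt ℝ ∞ F u := ((C.smooth _ hfu).comp u hf).congr_of_eventuallyEq hFf
  have hFU : F u ∈ U := hu ▸ C.mem _ hfu
  have hfd := hf.differentiableAt (by simp)
  have hdF : ∀ v, fderiv ℝ F u v = fderiv ℝ Φ (f u) (fderiv ℝ f u v) := fun v => by
    rw [hFf.fderiv_eq]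
    exact congrArg (fun L => L v) (fderiv_comp u ((C.smooth _ hfu).differentiableAt (by simp)) hfd)
  have hn : ∀ {e : ℝ × ℝ × ℝ → M}, ContDiffAt ℝ ∞ e (f u) →
      ContDiffAt ℝ ∞ (fun y => G (F y) (N y) (e (f y))) u ∧
      ∀ v, fderiv ℝ (fun y => G (F y) (N y) (e (f y))) u v =
        G (F u) (N u) (cov B Φ e (f u) (fderiv ℝ f u v)) := by
    intro e he
    have hef : ContDiffAt ℝ ∞ (fun y => e (f y)) u := he.comp u hf
    refine ⟨h.contDiffAt_inner hFU hF hN hef, fun v => ?_⟩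
    rw [h.fderiv_inner hFU (hF.differentiableAt (by simp)) (hN.differentiableAt (by simp))
      (hef.differentiableAt (by simp)), htg, map_zero, zero_apply, zero_add,
      ← cov_comp B ((C.smooth _ hfu).differentiableAt (by simp)) (he.differentiableAt (by simp))
        hfd v, cov_congr B hFf (EventuallyEq.refl _ _)]
  have h₁ := hn (C.contDiffAt_e₁ hfu)
  have h₂ := hn (C.contDiffAt_e₂ hfu)
  have h₃ := hn (C.contDiffAt_e₃ hfu)
  have hexp : ∀ v, G (F u) (N u) (fderiv ℝ Φ (f u) v) = v.1 * G (F u) (N u) (e₁ Φ (f u)) +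
      a (f u).1 * v.2.1 * G (F u) (N u) (e₂ Φ a (f u)) +
      b (f u).1 * v.2.2 * G (F u) (N u) (e₃ Φ b (f u)) := fun v => by
    rw [C.fderiv_eq hfu]
    simp only [map_add, map_smul, smul_eq_mul]
  refine ⟨hf, h₁.1, h₂.1, h₃.1, C.contDiffAt_rot hfst, ha, hb, C.hasDerivAt_a hfst,
    C.hasDerivAt_b hfst, fun v => ?_, fun v => ?_, fun v => ?_, fun v => ?_, ?_, fun v hv => ?_⟩
  · rw [h₁.2, C.cov_e₁ hdim h hfu]
    simp only [map_add, map_smul, smul_eq_mul]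
    ring
  · rw [h₂.2, C.cov_e₂ hdim h hfu]
    simp only [map_smul, smul_eq_mul]
    ring
  · rw [h₃.2, C.cov_e₃ hdim h hfu]
    simp only [map_smul, smul_eq_mul]
    ring
  · have := hNF v
    rw [hdF, hexp] at this
    linarith
  · obtain ⟨v, hv⟩ := (C.bijective_fderiv hdim hfu).2 (N u)
    have h1 := C.inner_e₁ hfu v
    have h2 := C.inner_e₂ hfu v
    have h3 := C.inner_e₃ hfu v
    rw [hv, hu, h.symmG] at h1 h2 h3
    rw [← hNN]
    conv_rhs => rw [← hv, ← hu]
    have h4 := hexp v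
    rw [hv] at h4
    rw [hv, hu, h4, h1, h2, h3]
    ring
  · exact hinj v (by rw [hdF, hv, map_zero])

/-- A totally geodesic surface tangent to `ξ` forces `ω` to be locally constant unless it
vanishes. -/
theorem eventually_rot_eq [FiniteDimensional ℝ M] [FiniteDimensional ℝ E]
    (hE : 1 < Module.finrank ℝ E) (C : IsAdaptedChart U G ξ p Φ a b δ)
    (hdim : Module.finrank ℝ M = 3) (h : IsLC U G B) {V : Set E} (hV : IsOpen V) {F N : E → M}
    (hF : ContDiffOn ℝ ∞ F V) (hN : ContDiffOn ℝ ∞ N V)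
    (hinj : ∀ u ∈ V, ∀ v, fderiv ℝ F u v = 0 → v = 0) (hNN : ∀ u ∈ V, G (F u) (N u) (N u) = 1)
    (hNF : ∀ u ∈ V, ∀ v, G (F u) (N u) (fderiv ℝ F u v) = 0)
    (htg : ∀ u ∈ V, ∀ v, cov B F N u v = 0) {u₀ : E} (hu₀ : u₀ ∈ V) (hp : F u₀ = p)
    (hξ : G p (ξ p) (N u₀) = 0) (hκ : rot a b 0 ≠ 0) :
    ∀ᶠ x in 𝓝 0, rot a b x = rot a b 0 := by
  have h0 : (0 : ℝ × ℝ × ℝ) ∈ Metric.ball 0 δ := Metric.mem_ball_self C.pos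
  obtain ⟨f, hf0, hf⟩ := C.exists_lift hdim
    (eventually_of_mem (hV.mem_nhds hu₀) fun y hy => hF.contDiffAt (hV.mem_nhds hy)) hp
  have hD : ∀ᶠ y in 𝓝 u₀, IsGaussData a b (rot a b) f (fun y => G (F y) (N y) (e₁ Φ (f y)))
      (fun y => G (F y) (N y) (e₂ Φ a (f y))) (fun y => G (F y) (N y) (e₃ Φ b (f y))) y := by
    filter_upwards [hf, hf.eventually_nhds, hV.mem_nhds hu₀] with y h1 h2 h3
    exact C.isGaussData hdim h (hN.contDiffAt (hV.mem_nhds h3)) (hNN y h3) (hNF y h3) (htg y h3)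
      (hinj y h3) h1.1 h1.2.1 (h2.mono fun z hz => hz.2.2)
  have hfield : ξ p = a (0 : ℝ) • e₂ Φ a 0 + b (0 : ℝ) • e₃ Φ b 0 := by
    have := C.field 0 h0
    rw [C.base] at this
    rw [← this, C.fderiv_eq h0]
    simp
  have hf1 : (f u₀).1 = 0 := by rw [hf0]; rfl
  have key := IsGaussData.eventually_const hE hD (by rwa [hf1]) (by
    rw [hf1, hf0, hp]
    rw [hfield, h.symmG] at hξ
    simpa using hξ) ?_
  · rwa [hf1] at key
  · rw [hf1]
    filter_upwards [Metric.ball_mem_nhds 0 C.pos] with x hx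
    exact (C.contDiffAt_rot hx).differentiableAt (by simp)

end IsAdaptedChart
end Lift

section Leaf
open Filter Topology
open scoped ContDiff

theorem mul_eq_mul_of_crossG_eq_zero {g : Met 3} {x v w : Pt 3}
    (hdet : 0 < (Matrix.of (g x)).det) (h : crossG g x v w = 0) (i j : Fin 3) :
    v i * w j = v j * w i := by
  set c : Pt 3 := fun l => ∑ i, ∑ j, lcSymb l i j * v i * w j with hc
  have h1 : crossG g x v w = √(Matrix.of (g x)).det • ((Matrix.of (g x))⁻¹).mulVec c := by
    ext k
    simp [crossG, ginv, Matrix.mulVec, dotProduct, hc]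
  have h2 : ((Matrix.of (g x))⁻¹).mulVec c = 0 :=
    (smul_eq_zero.1 (h1.symm.trans h)).resolve_left (Real.sqrt_pos.2 hdet).ne'
  have h3 : c = 0 := by
    have := congrArg (Matrix.of (g x)).mulVec h2
    rwa [Matrix.mulVec_mulVec, Matrix.mul_nonsing_inv _ hdet.ne'.isUnit, Matrix.one_mulVec,
      Matrix.mulVec_zero] at this
  have h4 : ∀ l, c l = 0 := fun l => congrFun h3 l
  have h40 := h4 0
  have h41 := h4 1
  have h42 := h4 2
  simp only [hc, lcSymb, Fin.sum_univ_three] at h40 h41 h42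
  norm_num at h40 h41 h42
  fin_cases i <;> fin_cases j <;> simp <;> linarith

theorem eq_zero_of_crossG_eq_zero {g : Met 3} {x v w : Pt 3}
    (hdet : 0 < (Matrix.of (g x)).det) (hw : minner g x w w = 1) (hvw : minner g x v w = 0)
    (h : crossG g x v w = 0) : v = 0 := by
  ext i
  have h1 : v i * minner g x w w = minner g x v w * w i := by
    simp only [minner, Finset.mul_sum, Finset.sum_mul]
    refine Finset.sum_congr rfl fun j _ => Finset.sum_congr rfl fun k _ => ?_
    linear_combination g x j k * w k * mul_eq_mul_of_crossG_eq_zero hdet h i j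
  rwa [hw, hvw, mul_one, zero_mul] at h1

namespace IsAdaptedChart

variable {U : Set (Pt 3)} {g : Met 3} {ξ : Pt 3 → Pt 3} {p : Pt 3} {Φ : ℝ × ℝ × ℝ → Pt 3}
  {a b : ℝ → ℝ} {δ : ℝ}

theorem exists_hasConstCurv (hU : IsOpen U) (hg : IsMetricOn U g)
    (C : IsAdaptedChart U (gL g) ξ p Φ a b δ) {c : ℝ} (hc : ∀ᶠ x in 𝓝 0, rot a b x = c) :
    ∃ W, IsOpen W ∧ p ∈ W ∧ W ⊆ U ∧ HasConstCurv W g (c ^ 2) := by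
  have hdim : Module.finrank ℝ (Pt 3) = 3 := by simp
  have h := hg.isLC hU
  obtain ⟨r, hr, hball⟩ := Metric.eventually_nhds_iff_ball.1
    (hc.and (Metric.ball_mem_nhds 0 C.pos))
  have hmem : ∀ q : ℝ × ℝ × ℝ, q ∈ Metric.ball 0 (min r δ) → q ∈ Metric.ball 0 δ :=
    fun q hq => Metric.ball_subset_ball (min_le_right _ _) hq
  refine ⟨Φ '' Metric.ball 0 (min r δ), isOpen_iff_mem_nhds.2 ?_,
    ⟨0, Metric.mem_ball_self (lt_min hr C.pos), C.base⟩, ?_, ?_⟩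
  · rintro _ ⟨q, hq, rfl⟩
    have hs := ((C.smooth q (hmem q hq)).hasStrictFDerivAt (by simp)).map_nhds_eq_of_surj
      (LinearMap.range_eq_top.2 (C.bijective_fderiv hdim (hmem q hq)).2)
    rw [← hs]
    exact image_mem_map (Metric.isOpen_ball.mem_nhds hq)
  · rintro _ ⟨q, hq, rfl⟩
    exact C.mem q (hmem q hq)
  · rintro _ ⟨q, hq, rfl⟩ v w
    have hq1 : q.1 ∈ Metric.ball 0 r :=
      fst_mem (Metric.ball_subset_ball (min_le_left _ _) hq)
    have hq' := hmem q hq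
    obtain ⟨v, rfl⟩ := (C.bijective_fderiv hdim hq').2 v
    obtain ⟨w, rfl⟩ := (C.bijective_fderiv hdim hq').2 w
    rw [riemVec_eq_curvB hU hg (C.mem q hq'), C.curvB_eq hdim h hq' (eventually_of_mem
      (Metric.isOpen_ball.mem_nhds hq1) fun y hy => (hball y hy).1)]
    simp only [← gL_apply, map_smul, map_sub, sub_apply, smul_apply, smul_eq_mul]
    rw [h.symmG _ (fderiv ℝ Φ q w) (fderiv ℝ Φ q v)]
    ring

theorem eq_zero_iff_rot_eq_zero (hU : IsOpen U) (hg : IsMetricOn U g)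
    (C : IsAdaptedChart U (gL g) ξ p Φ a b δ) (hξ : ContDiffOn ℝ ∞ ξ U) (hξu : IsUnitOn U g ξ)
    {τ : ℝ} (hτ : ∀ v, covD g ξ p v = τ • crossG g p v (ξ p)) : τ = 0 ↔ rot a b 0 = 0 := by
  have hdim : Module.finrank ℝ (Pt 3) = 3 := by simp
  have h := hg.isLC hU
  have h0 : (0 : ℝ × ℝ × ℝ) ∈ Metric.ball 0 δ := Metric.mem_ball_self C.pos
  have hp : p ∈ U := C.base ▸ C.mem 0 h0
  have ha : 0 < a 0 := C.a_pos _ (fst_mem h0)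
  have hb : 0 < b 0 := C.b_pos _ (fst_mem h0)
  have key := C.cov_field hdim h hξ h0
  rw [C.base, ← covD_eq_cov g ((hξ.contDiffAt (hU.mem_nhds hp)).differentiableAt (by simp)),
    hτ] at key
  constructor
  · intro h1
    rw [h1, zero_smul] at key
    have h2 := congrArg (fun m => gL g (Φ 0) m (fderiv ℝ Φ 0 (0, 1, 0))) key
    simp only [map_smul, map_sub, sub_apply, smul_apply, smul_eq_mul, C.inner_e₂ h0, C.inner_e₃ h0,
      map_zero, zero_apply] at h2
    simpa [ha.ne', hb.ne'] using h2
  · intro h1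
    rw [show (0 : ℝ × ℝ × ℝ).1 = 0 from rfl, h1, zero_smul] at key
    refine (smul_eq_zero.1 key).resolve_right fun h2 => ?_
    have h3 := eq_zero_of_crossG_eq_zero (det_pos_of_isMetricOn hg hp) (hξu p hp) ?_ h2
    · have h4 := C.inner_e₁ h0 (1, 0, 0)
      rw [h3] at h4
      simp at h4
    · have h4 := C.inner_e₁ h0 (0, 1, 1)
      rwa [C.field 0 h0, C.base, gL_apply] at h4

/-- The inclusion of the leaf `x = 0` in the coordinates of an adapted chart. -/
def leaf : Pt 2 →L[ℝ] ℝ × ℝ × ℝ :=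
  (0 : Pt 2 →L[ℝ] ℝ).prod ((ContinuousLinearMap.proj 0).prod (ContinuousLinearMap.proj 1))

theorem leaf_apply (u : Pt 2) : leaf u = (0, u 0, u 1) := rfl

theorem leaf_injective : Function.Injective leaf := fun u v huv => by
  simp only [leaf_apply, Prod.mk.injEq, true_and] at huv
  ext i
  fin_cases i
  exacts [huv.1, huv.2]

theorem linearIndependent_stdb (n : ℕ) : LinearIndependent ℝ (stdb n) := by
  have := (Pi.basisFun ℝ (Fin n)).linearIndependent
  convert this
  ext
  simp [stdb]

/-- Where `ω` vanishes, the leaf of an adapted chart is totally geodesic and tangent to `ξ`. -/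
theorem exists_totallyGeodesic (hU : IsOpen U) (hg : IsMetricOn U g)
    (C : IsAdaptedChart U (gL g) ξ p Φ a b δ) (hrot : rot a b 0 = 0) :
    ∃ S : Hyp 2, S.IsRegular U g ∧ S.TotallyGeodesic g ∧
      ∃ u ∈ S.V, S.F u = p ∧ minner g p (ξ p) (S.N u) = 0 := by
  have hdim : Module.finrank ℝ (Pt 3) = 3 := by simp
  have h := hg.isLC hU
  have h0 : (0 : ℝ × ℝ × ℝ) ∈ Metric.ball 0 δ := Metric.mem_ball_self C.pos
  have hd : ∀ u : Pt 2, leaf u ∈ Metric.ball 0 δ → ∀ v,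
      fderiv ℝ (fun u => Φ (leaf u)) u v = fderiv ℝ Φ (leaf u) (leaf v) := fun u hu v => by
    have := (((C.smooth _ hu).differentiableAt (by simp)).hasFDerivAt.comp u
      leaf.hasFDerivAt).fderiv
    exact congrArg (fun L => L v) this
  refine ⟨⟨leaf ⁻¹' Metric.ball 0 δ, fun u => Φ (leaf u), fun u => e₁ Φ (leaf u)⟩,
    ⟨Metric.isOpen_ball.preimage leaf.continuous, fun u hu => ?_, fun u hu => C.mem _ hu,
      fun u hu => ?_, fun u hu => ?_, fun u hu => ?_, fun u hu i => ?_⟩, fun u hu i => ?_,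
    0, ?_, ?_, ?_⟩
  · exact ((C.smooth _ hu).comp u leaf.contDiff.contDiffAt).contDiffWithinAt
  · have : LinearIndependent ℝ fun i => (fderiv ℝ Φ (leaf u) ∘L leaf) (stdb 2 i) :=
      (linearIndependent_stdb 2).map' (fderiv ℝ Φ (leaf u) ∘L leaf : Pt 2 →L[ℝ] Pt 3).toLinearMap
        (LinearMap.ker_eq_bot.2 ((C.injective_fderiv hu).comp leaf_injective))
    change LinearIndependent ℝ fun i => fderiv ℝ (fun u => Φ (leaf u)) u (stdb 2 i)
    simp only [hd u hu]
    exact this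
  · exact ((C.contDiffAt_e₁ hu).comp u leaf.contDiff.contDiffAt).contDiffWithinAt
  · rw [← gL_apply]
    exact C.inner_e₁ hu (1, 0, 0)
  · rw [← gL_apply, hd u hu]
    exact C.inner_e₁ hu _
  · have he := (C.contDiffAt_e₁ hu).differentiableAt (by simp)
    have hl : DifferentiableAt ℝ leaf u := leaf.differentiableAt
    refine (covAlong_eq_cov g (he.comp u hl) _).trans ?_
    refine (cov_comp _ ((C.smooth _ hu).differentiableAt (by simp)) he hl _).trans ?_
    rw [C.cov_e₁ hdim h hu, show (leaf u).1 = 0 from rfl, hrot]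
    simp
  · simpa using C.pos
  · simp only [map_zero, C.base]
  · have h1 := C.inner_e₁ h0 (0, 1, 1)
    rw [C.field 0 h0, C.base, h.symmG, gL_apply] at h1
    simpa only [map_zero] using h1

end IsAdaptedChart

theorem eq_sum_stdb (n : ℕ) (v : Pt n) : v = ∑ i, v i • stdb n i := by
  ext j
  simp [stdb, Pi.single_apply]

theorem Hyp.IsRegular.inner_fderiv {n : ℕ} {S : Hyp n} {U : Set (Pt (n + 1))} {g : Met (n + 1)}
    (hS : S.IsRegular U g) {u : Pt n} (hu : u ∈ S.V) (v : Pt n) :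
    gL g (S.F u) (S.N u) (fderiv ℝ S.F u v) = 0 := by
  rw [eq_sum_stdb n v, map_sum, map_sum]
  refine Finset.sum_eq_zero fun i _ => ?_
  rw [map_smul, map_smul, gL_apply, hS.2.2.2.2.2.2 u hu, smul_zero]

theorem Hyp.IsRegular.eq_zero_of_fderiv_eq_zero {n : ℕ} {S : Hyp n} {U : Set (Pt (n + 1))}
    {g : Met (n + 1)} (hS : S.IsRegular U g) {u : Pt n} (hu : u ∈ S.V) {v : Pt n}
    (hv : fderiv ℝ S.F u v = 0) : v = 0 := by
  rw [eq_sum_stdb n v, map_sum] at hv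
  simp only [map_smul] at hv
  ext i
  exact Fintype.linearIndependent_iff.1 (hS.2.2.2.1 u hu) _ hv i

theorem Hyp.TotallyGeodesic.cov_eq_zero {n : ℕ} {S : Hyp n} {U : Set (Pt (n + 1))}
    {g : Met (n + 1)} (hS : S.IsRegular U g) (hSg : S.TotallyGeodesic g) {u : Pt n} (hu : u ∈ S.V)
    (v : Pt n) : cov (chrL g) S.F S.N u v = 0 := by
  have hN := (hS.2.2.2.2.1.contDiffAt (hS.1.mem_nhds hu)).differentiableAt (by simp)
  have h1 : ∀ i, cov (chrL g) S.F S.N u (stdb n i) = 0 := fun i => by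
    rw [← covAlong_eq_cov g hN, hSg u hu]
  let L : Pt n →+ Pt (n + 1) := AddMonoidHom.mk' (cov (chrL g) S.F S.N u) (cov_add_dir _ _ _ _)
  change L v = 0
  rw [eq_sum_stdb n v, map_sum]
  refine Finset.sum_eq_zero fun i _ => ?_
  change cov (chrL g) S.F S.N u (v i • stdb n i) = 0
  rw [cov_smul_dir, h1, smul_zero]

end Leaf

/-- Theorem 3 (3).  Let `M` carry a unit Killing field `ξ` with
associated function `τ` (`∇̃_X ξ = τ (X × ξ)`), and let `Σ₁` be a totally geodesic
surface through `p` neither orthogonal nor tangent to `ξ` at `p`.  If `M` does not have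
constant positive curvature near `p`, then there exists a totally geodesic surface
through `p` which is tangent to `ξ` at `p` if and only if `τ(p) = 0`. -/
theorem statement14 (U : Set (Pt 3)) (hU : IsOpen U)
    (g : Met 3) (hg : IsMetricOn U g)
    (ξ : Pt 3 → Pt 3) (hξs : ContDiffOn ℝ (⊤ : ℕ∞) ξ U)
    (hξu : IsUnitOn U g ξ) (hξk : IsKillingOn U g ξ)
    (τ : Pt 3 → ℝ) (hτs : ContDiffOn ℝ (⊤ : ℕ∞) τ U)
    (hτ : ∀ x ∈ U, ∀ v : Pt 3, covD g ξ x v = τ x • crossG g x v (ξ x))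
    (p : Pt 3) (hp : p ∈ U)
    (S₁ : Hyp 2) (hS₁ : S₁.IsRegular U g) (hS₁g : S₁.TotallyGeodesic g)
    (u₁ : Pt 2) (hu₁ : u₁ ∈ S₁.V) (hpu₁ : S₁.F u₁ = p)
    (hnt : minner g p (ξ p) (S₁.N u₁) ≠ 0)
    (hno : ∃ a : Fin 2, minner g p (ξ p) (fderiv ℝ S₁.F u₁ (stdb 2 a)) ≠ 0)
    -- `M` does not have constant positive curvature near `p`:
    (hnc : ¬ ∃ W : Set (Pt 3), IsOpen W ∧ p ∈ W ∧ W ⊆ U ∧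
      ∃ c : ℝ, 0 < c ∧ HasConstCurv W g c) :
    (∃ S : Hyp 2, S.IsRegular U g ∧ S.TotallyGeodesic g ∧
      ∃ u ∈ S.V, S.F u = p ∧
        -- `S` is tangent to `ξ` at `p`:
        minner g p (ξ p) (S.N u) = 0)
    ↔ τ p = 0 := by
  have hdim : Module.finrank ℝ (Pt 3) = 3 := by simp
  have h := hg.isLC hU
  have hSr := hS₁
  obtain ⟨hV, hF, hFU, hLI, hN, hNN, -⟩ := hSr
  subst hpu₁
  obtain ⟨Φ, a, b, δ, C⟩ := exists_isAdaptedChart h hdim hV hF hFU hLI hN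
    (fun u hu => (gL_apply g _ _ _).trans (hNN u hu)) (fun u hu => hS₁.inner_fderiv hu)
    (fun u hu => hS₁g.cov_eq_zero hS₁ hu) hξs
    (fun x hx => (gL_apply g _ _ _).trans (hξu x hx))
    (fun x hx v w => by
      have hd := (hξs.contDiffAt (hU.mem_nhds hx)).differentiableAt (by simp)
      rw [← covD_eq_cov g hd, ← covD_eq_cov g hd, gL_apply, gL_apply, hξk x hx])
    hu₁ (by rwa [gL_apply]) (by simpa only [gL_apply] using hno)
  rw [C.eq_zero_iff_rot_eq_zero hU hg hξs hξu (hτ _ hp)]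
  refine ⟨fun ⟨S, hS, hSg, u, hu, hup, hξN⟩ => ?_, C.exists_totallyGeodesic hU hg⟩
  by_contra hrot
  have hconst := C.eventually_rot_eq (by simp) hdim h hS.1 hS.2.1 hS.2.2.2.2.1
    (fun u hu v => hS.eq_zero_of_fderiv_eq_zero hu)
    (fun u hu => (gL_apply g _ _ _).trans (hS.2.2.2.2.2.1 u hu)) (fun u hu => hS.inner_fderiv hu)
    (fun u hu => hSg.cov_eq_zero hS hu) hu hup (by rwa [gL_apply]) hrot
  obtain ⟨W, hW, hpW, hWU, hcurv⟩ := C.exists_hasConstCurv hU hg hconst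
  exact hnc ⟨W, hW, hpW, hWU, _, by positivity, hcurv⟩
end
end

section
/- Let θ : ℝ → ℝ be a smooth function whose image avoids all multiples of π and all points π/2 + kπ (k ∈ ℤ), so that sinθ(x) and cosθ(x) never vanish. Then g = dx² + sin²θ(x) dy² + cos²θ(x) dz² defines a smooth Riemannian metric on ℝ³ which is complete. In particular, every curve γ : [0,T) → ℝ³ that diverges to infinity (i.e. γ₁(t)² + γ₂(t)² + γ₃(t)² → ∞ as t → T) has infinite length ∫₀^T √( γ₁′(t)² + sin²(θ(γ₁(t))) γ₂′(t)² + cos²(θ(γ₁(t))) γ₃′(t)² ) dt = ∞. -/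
noncomputable section
open Real Set

open MeasureTheory Filter

/-- A `C¹` function on `[0, T)` whose derivative is dominated by a multiple of a function with
finite integral is bounded. -/
lemma exists_abs_le_of_abs_deriv_le {T K : ℝ} {f s : ℝ → ℝ} (hf : ContDiffOn ℝ 1 f (Ico 0 T))
    (hs : ∫⁻ t in Ioo 0 T, ENNReal.ofReal (s t) ≠ ⊤) (hK : 0 ≤ K)
    (hfs : ∀ t ∈ Ioo 0 T, |deriv f t| ≤ K * s t) :
    ∃ M, ∀ t ∈ Ico 0 T, |f t| ≤ M := by
  refine ⟨|f 0| + (ENNReal.ofReal K * ∫⁻ t in Ioo 0 T, ENNReal.ofReal (s t)).toReal, ?_⟩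
  intro t ht
  have hfin : ENNReal.ofReal K * ∫⁻ t in Ioo 0 T, ENNReal.ofReal (s t) ≠ ⊤ :=
    ENNReal.mul_ne_top ENNReal.ofReal_ne_top hs
  have h1 : ‖f t - f 0‖ₑ ≤ ∫⁻ x in Icc 0 t, ‖deriv f x‖ₑ :=
    enorm_sub_le_lintegral_deriv_of_contDiffOn_Icc
      (hf.mono fun x hx => ⟨hx.1, hx.2.trans_lt ht.2⟩) ht.1
  have h2 : ∫⁻ x in Icc 0 t, ‖deriv f x‖ₑ ≤ ∫⁻ x in Ioo 0 T, ‖deriv f x‖ₑ := by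
    rw [← setLIntegral_congr (Ioo_ae_eq_Icc (a := (0 : ℝ)) (b := t))]
    exact lintegral_mono_set (Ioo_subset_Ioo_right ht.2.le)
  have h3 : ∫⁻ x in Ioo 0 T, ‖deriv f x‖ₑ ≤
      ENNReal.ofReal K * ∫⁻ t in Ioo 0 T, ENNReal.ofReal (s t) := by
    rw [← lintegral_const_mul' _ _ ENNReal.ofReal_ne_top]
    refine setLIntegral_mono' measurableSet_Ioo fun x hx => ?_
    rw [← ENNReal.ofReal_mul hK, Real.enorm_eq_ofReal_abs]
    exact ENNReal.ofReal_le_ofReal (hfs x hx)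
  have h4 := ENNReal.toReal_mono hfin (h1.trans (h2.trans h3))
  rw [Real.enorm_eq_ofReal_abs, ENNReal.toReal_ofReal (abs_nonneg _)] at h4
  have := abs_sub_abs_le_abs_sub (f t) (f 0)
  linarith

lemma minner_tgMet (θ : ℝ → ℝ) (x v w : Pt 3) :
    minner (tgMet θ) x v w =
      v 0 * w 0 + Real.sin (θ (x 0)) ^ 2 * v 1 * w 1 + Real.cos (θ (x 0)) ^ 2 * v 2 * w 2 := by
  simp [minner, tgMet, Fin.sum_univ_three]

lemma isMetricOn_tgMet {θ : ℝ → ℝ} (hθ : ContDiff ℝ (⊤ : ℕ∞) θ)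
    (hsin : ∀ x, Real.sin (θ x) ≠ 0) (hcos : ∀ x, Real.cos (θ x) ≠ 0) :
    IsMetricOn univ (tgMet θ) := by
  refine ⟨fun i j => ?_, fun x i j => ?_, fun x _ v hv => ?_⟩
  · have hx : ContDiff ℝ (⊤ : ℕ∞) fun x : Pt 3 => θ (x 0) :=
      hθ.comp (contDiff_apply ℝ ℝ (0 : Fin 3))
    apply ContDiff.contDiffOn
    unfold tgMet
    split_ifs
    · exact contDiff_const
    · exact hx.sin.pow 2
    · exact hx.cos.pow 2
    · exact contDiff_const
  · by_cases h : i = j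
    · rw [h]
    · simp [tgMet, h, Ne.symm h]
  · rw [minner_tgMet]
    have hs := pow_pos (abs_pos.2 (hsin (x 0))) 2
    have hc := pow_pos (abs_pos.2 (hcos (x 0))) 2
    rw [sq_abs] at hs hc
    obtain ⟨i, hi⟩ := Function.ne_iff.1 hv
    have hi' : 0 < v i ^ 2 := pow_pos (abs_pos.2 hi) 2 |>.trans_eq (sq_abs _)
    have h0 := sq_nonneg (v 0)
    have h1 := mul_nonneg hs.le (sq_nonneg (v 1))
    have h2 := mul_nonneg hc.le (sq_nonneg (v 2))
    fin_cases i
    · simp only [Fin.zero_eta] at hi'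
      nlinarith
    · have := mul_pos hs hi'
      simp only [Fin.mk_one] at this
      nlinarith
    · have := mul_pos hc hi'
      simp only [Fin.reduceFinMk] at this
      nlinarith

/-- On a bounded interval the metric `dx² + sin²θ dy² + cos²θ dz²` dominates a positive multiple
of the Euclidean one. -/
lemma exists_pos_le_sin_sq_cos_sq {θ : ℝ → ℝ} (hθ : Continuous θ)
    (hsin : ∀ x, Real.sin (θ x) ≠ 0) (hcos : ∀ x, Real.cos (θ x) ≠ 0) (M : ℝ) :
    ∃ c > 0, ∀ x, |x| ≤ M → c ^ 2 ≤ Real.sin (θ x) ^ 2 ∧ c ^ 2 ≤ Real.cos (θ x) ^ 2 := by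
  have hcont : Continuous fun x => |Real.sin (θ x)| ⊓ |Real.cos (θ x)| := by fun_prop
  obtain ⟨c, hc, h⟩ := isCompact_Icc.exists_forall_le' (s := Icc (-M) M) hcont.continuousOn
    (a := 0) fun x _ => lt_min (abs_pos.2 (hsin x)) (abs_pos.2 (hcos x))
  refine ⟨c, hc, fun x hx => ?_⟩
  obtain ⟨hs, hc'⟩ := le_min_iff.1 (h x (abs_le.1 hx))
  rw [← sq_abs (Real.sin _), ← sq_abs (Real.cos _)]
  exact ⟨pow_le_pow_left₀ hc.le hs 2, pow_le_pow_left₀ hc.le hc' 2⟩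

lemma abs_le_inv_mul_sqrt {c v q : ℝ} (hc : 0 < c) (h : c ^ 2 * v ^ 2 ≤ q) :
    |v| ≤ c⁻¹ * Real.sqrt q := by
  rw [← div_eq_inv_mul, le_div_iff₀ hc]
  apply Real.le_sqrt_of_sq_le
  rwa [mul_pow, sq_abs, mul_comm]

/-- Proposition 8.  If `θ : ℝ → ℝ` is smooth and avoids all the
values `kπ` and `π/2 + kπ` (`k ∈ ℤ`), then `g = dx² + sin²θ(x) dy² + cos²θ(x) dz²`
defines a smooth Riemannian metric on `ℝ³`, which is moreover complete: every curve
`γ : [0,T) → ℝ³` diverging to infinity has infinite length. -/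
theorem statement19 (θ : ℝ → ℝ) (hθ : ContDiff ℝ (⊤ : ℕ∞) θ)
    (havoid : ∀ x : ℝ, ∀ k : ℤ, θ x ≠ k * π ∧ θ x ≠ π / 2 + k * π) :
    -- `g` is a smooth Riemannian metric on all of `ℝ³` …
    IsMetricOn univ (tgMet θ) ∧
    -- … which is complete: every diverging curve has infinite length.
    (∀ T : ℝ, 0 < T → ∀ γ : ℝ → Pt 3,
      ContDiffOn ℝ 1 γ (Ico 0 T) →
      Tendsto (fun t => (γ t 0) ^ 2 + (γ t 1) ^ 2 + (γ t 2) ^ 2)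
        (nhdsWithin T (Iio T)) atTop →
      ∫⁻ t in Ioo 0 T,
          ENNReal.ofReal (Real.sqrt
            ((deriv (fun r => γ r 0) t) ^ 2
              + (Real.sin (θ (γ t 0))) ^ 2 * (deriv (fun r => γ r 1) t) ^ 2
              + (Real.cos (θ (γ t 0))) ^ 2 * (deriv (fun r => γ r 2) t) ^ 2))
        = ⊤) := by
  have hsin : ∀ x, Real.sin (θ x) ≠ 0 := fun x h => by
    obtain ⟨k, hk⟩ := Real.sin_eq_zero_iff.1 h
    exact (havoid x k).1 hk.symm
  have hcos : ∀ x, Real.cos (θ x) ≠ 0 := fun x h => by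
    obtain ⟨k, hk⟩ := Real.cos_eq_zero_iff.1 h
    exact (havoid x k).2 (hk.trans (by ring))
  refine ⟨isMetricOn_tgMet hθ hsin hcos, fun T hT γ hγ hdiv => ?_⟩
  by_contra hfin
  have hγi (i : Fin 3) : ContDiffOn ℝ 1 (fun t => γ t i) (Ico 0 T) := contDiffOn_pi.1 hγ i
  obtain ⟨M₀, hM₀⟩ := exists_abs_le_of_abs_deriv_le (hγi 0) hfin zero_le_one fun t _ => by
    rw [← inv_one]
    apply abs_le_inv_mul_sqrt one_pos
    nlinarith [mul_nonneg (sq_nonneg (Real.sin (θ (γ t 0)))) (sq_nonneg (deriv (fun r => γ r 1) t)),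
      mul_nonneg (sq_nonneg (Real.cos (θ (γ t 0)))) (sq_nonneg (deriv (fun r => γ r 2) t))]
  obtain ⟨c, hc, hsc⟩ := exists_pos_le_sin_sq_cos_sq hθ.continuous hsin hcos M₀
  obtain ⟨M₁, hM₁⟩ := exists_abs_le_of_abs_deriv_le (hγi 1) hfin (inv_pos.2 hc).le fun t ht => by
    apply abs_le_inv_mul_sqrt hc
    have h := (hsc _ (hM₀ t (Ioo_subset_Ico_self ht))).1
    have h1 := mul_le_mul_of_nonneg_right h (sq_nonneg (deriv (fun r => γ r 1) t))
    have h2 := mul_nonneg (sq_nonneg (Real.cos (θ (γ t 0)))) (sq_nonneg (deriv (fun r => γ r 2) t))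
    linarith [sq_nonneg (deriv (fun r => γ r 0) t)]
  obtain ⟨M₂, hM₂⟩ := exists_abs_le_of_abs_deriv_le (hγi 2) hfin (inv_pos.2 hc).le fun t ht => by
    apply abs_le_inv_mul_sqrt hc
    have h := (hsc _ (hM₀ t (Ioo_subset_Ico_self ht))).2
    have h1 := mul_le_mul_of_nonneg_right h (sq_nonneg (deriv (fun r => γ r 2) t))
    have h2 := mul_nonneg (sq_nonneg (Real.sin (θ (γ t 0)))) (sq_nonneg (deriv (fun r => γ r 1) t))
    linarith [sq_nonneg (deriv (fun r => γ r 0) t)]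
  have hev : ∀ᶠ t in nhdsWithin T (Iio T), t ∈ Ico 0 T := Ico_mem_nhdsLT hT
  obtain ⟨t, ht, hlt⟩ :=
    (hev.and (hdiv.eventually (eventually_gt_atTop (M₀ ^ 2 + M₁ ^ 2 + M₂ ^ 2)))).exists
  have h0 := sq_le_sq' (neg_le_of_abs_le (hM₀ t ht)) (le_of_abs_le (hM₀ t ht))
  have h1 := sq_le_sq' (neg_le_of_abs_le (hM₁ t ht)) (le_of_abs_le (hM₁ t ht))
  have h2 := sq_le_sq' (neg_le_of_abs_le (hM₂ t ht)) (le_of_abs_le (hM₂ t ht))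
  linarith
end
end
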